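/- Let A be a Borel subset of ℝ² with Hausdorff dimension s ∈ (1, 3/2). Then the set of points y ∈ ℝ² for which the pinned distance set Δ_y(A) has packing dimension strictly less than (1 + s + √(3s(2−s)))/4 has Hausdorff dimension at most 1. -/

import Mathlib

open MeasureTheory Set Filter
open scoped ENNReal NNReal

/-- The covering number of `A` by balls of radius `r` (as an extended nonnegative real;
`⊤` if no finite cover exists). -/
noncomputable def coverNum {X : Type*} [PseudoMetricSpace X] (A : Set X) (r : ℝ) : ℝ≥0∞ :=
  ⨅ (t : Finset X) (_ : A ⊆ ⋃ x ∈ t, Metric.ball x r), (t.card : ℝ≥0∞)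

open Classical in
/-- The upper box-counting (Minkowski) dimension of a set, computed along the scales `2⁻ⁿ`. -/
noncomputable def ubDim {X : Type*} [PseudoMetricSpace X] (A : Set X) : ℝ≥0∞ :=
  if ∃ n : ℕ, coverNum A (1 / 2 ^ n) = ⊤ then ⊤
  else limsup (fun n : ℕ =>
    ENNReal.ofReal (Real.logb 2 ((coverNum A (1 / 2 ^ n)).toReal) / n)) atTop

/-- The packing dimension of a set, defined as the modified upper box-counting dimension. -/
noncomputable def pDim {X : Type*} [PseudoMetricSpace X] (A : Set X) : ℝ≥0∞ :=
  ⨅ (F : ℕ → Set X) (_ : A ⊆ ⋃ n, F n), ⨆ n, ubDim (F n)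

/-- `ScaleChain h b ℓ`: there is a chain of scales from `1` to `b`, each at most twice the previous
one, along which the total drop of `h` below its value at the start of each step is at most `ℓ`. -/
inductive ScaleChain (h : ℕ → ℝ) : ℕ → ℝ → Prop
  | base : ScaleChain h 1 0
  | step {a b : ℕ} {l d : ℝ} : ScaleChain h a l → a < b → b ≤ 2 * a → 0 ≤ d →
      (∀ k, a ≤ k → k ≤ b → h a - d ≤ h k) → ScaleChain h b (l + d)

/-- A `ScaleChain` with a prescribed number of steps. -/
inductive ScaleChainN (h : ℕ → ℝ) : ℕ → ℕ → ℝ → Prop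
  | base : ScaleChainN h 0 1 0
  | step {n a b : ℕ} {l d : ℝ} : ScaleChainN h n a l → a < b → b ≤ 2 * a → 0 ≤ d →
      (∀ k, a ≤ k → k ≤ b → h a - d ≤ h k) → ScaleChainN h (n + 1) b (l + d)

lemma ScaleChain.one_le {h : ℕ → ℝ} {b : ℕ} {l : ℝ} (H : ScaleChain h b l) : 1 ≤ b := by
  induction H with
  | base => exact le_rfl
  | step _ hab _ _ _ ih => omega

/-- Merging consecutive short steps does not increase the loss, so a chain may be taken to have
logarithmically many steps. -/
lemma ScaleChain.exists_short {h : ℕ → ℝ} {b : ℕ} {l : ℝ} (H : ScaleChain h b l) :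
    ∃ n l', ScaleChainN h n b l' ∧ l' ≤ l ∧ 2 ^ n ≤ 2 * b ^ 2 := by
  have key : (b = 1 ∧ 0 ≤ l) ∨ ∃ n u lu d, ScaleChainN h n u lu ∧ u < b ∧ b ≤ 2 * u ∧ 0 ≤ d ∧
      (∀ k, u ≤ k → k ≤ b → h u - d ≤ h k) ∧ lu + d ≤ l ∧ 2 ^ n ≤ u * b := by
    induction H with
    | base => exact Or.inl ⟨rfl, le_rfl⟩
    | @step a b l d _ hab hb2 hd hk ih =>
      right
      rcases ih with ⟨rfl, hl⟩ | ⟨n, u, lu, d', hN, hu, ha2, hd', hk', hl, hn⟩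
      · exact ⟨0, 1, 0, d, ScaleChainN.base, hab, hb2, hd, hk, by linarith, by omega⟩
      · by_cases hbu : b ≤ 2 * u
        · refine ⟨n, u, lu, d' + d, hN, by omega, hbu, by linarith, ?_, by linarith, ?_⟩
          · intro k hk1 hk2
            rcases le_total k a with hka | hka
            · linarith [hk' k hk1 hka]
            · linarith [hk k hka hk2, hk' a hu.le le_rfl]
          · exact hn.trans (Nat.mul_le_mul_left _ hab.le)
        · refine ⟨n + 1, a, lu + d', d, ScaleChainN.step hN hu ha2 hd' hk', hab, hb2, hd, hk,
            by linarith, ?_⟩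
          rw [pow_succ]
          nlinarith
  rcases key with ⟨rfl, hl⟩ | ⟨n, u, lu, d, hN, hu, hb2, hd, hk, hl, hn⟩
  · exact ⟨0, 0, ScaleChainN.base, hl, by norm_num⟩
  · refine ⟨n + 1, lu + d, ScaleChainN.step hN hu hb2 hd hk, hl, ?_⟩
    rw [pow_succ]
    nlinarith

/-- Profiles on `[0, m]` that are Lipschitz up to an additive error and lie above the line of slope
`σ`. -/
structure IsProfile (h : ℕ → ℝ) (m : ℕ) (σ : ℝ) : Prop where
  lower : ∀ i j, i ≤ j → j ≤ m → h i - ((j : ℝ) - i) ≤ h j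
  upper : ∀ i j, i ≤ j → j ≤ m → h j ≤ h i + ((j : ℝ) - i) + 2
  linear : ∀ k, k ≤ m → σ * k - 2 ≤ h k
  start : h 1 ≤ 4

lemma ScaleChain.exists_record_low {h : ℕ → ℝ} {w m : ℕ} {S : ℝ} (H : ScaleChain h w S)
    (hwm : w ≤ m) :
    ∃ u, w ≤ u ∧ u ≤ m ∧ ScaleChain h u (S + (h w - h u)) ∧ h u ≤ h w ∧
      ∀ k, u ≤ k → k ≤ 2 * u → k ≤ m → h u ≤ h k := by
  classical
  obtain ⟨u, hu, hmin⟩ := Finset.exists_min_image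
    ((Finset.Icc w m).filter (fun u => ScaleChain h u (S + (h w - h u)) ∧ h u ≤ h w)) h
    ⟨w, by simp [hwm, H]⟩
  simp only [Finset.mem_filter, Finset.mem_Icc] at hu hmin
  obtain ⟨⟨hwu, hum⟩, hR, hle⟩ := hu
  refine ⟨u, hwu, hum, hR, hle, ?_⟩
  by_contra! hcon
  have hex : ∃ k, u ≤ k ∧ k ≤ 2 * u ∧ k ≤ m ∧ h k < h u := hcon
  obtain ⟨h1, h2, h3, h4⟩ := Nat.find_spec hex
  set k := Nat.find hex
  have huk : u < k := by
    rcases h1.eq_or_lt with e | e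
    · rw [← e] at h4; exact absurd h4 (lt_irrefl _)
    · exact e
  have := ScaleChain.step (d := h u - h k) hR huk h2 (by linarith) (by
    intro j hj1 hj2
    rcases hj2.eq_or_lt with e | e
    · rw [e]; linarith
    · have := Nat.find_min hex e
      push Not at this
      linarith [this hj1 (by omega) (by omega)])
  have h5 : ScaleChain h k (S + (h w - h k)) := by
    convert this using 1; ring
  have := hmin k ⟨⟨by omega, h3⟩, h5, by linarith⟩
  linarith

lemma ScaleChain.exists_stuck {h : ℕ → ℝ} {α m : ℕ} {S : ℝ} (H : ScaleChain h α S) (ham : α ≤ m)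
    (hα : ∀ k, α ≤ k → k ≤ 2 * α → k ≤ m → h α ≤ h k) :
    ∃ w, α ≤ w ∧ w ≤ m ∧ ScaleChain h w S ∧ (w = m ∨ (w < m ∧ 2 * α ≤ w ∧
      ∀ v, w + 1 ≤ 2 * v → α ≤ v → v ≤ w → h (w + 1) < h v)) := by
  classical
  obtain ⟨w, hw, hmax⟩ := Finset.exists_max_image
    ((Finset.Icc α m).filter (fun w => ∀ v, α ≤ v → v ≤ w → ScaleChain h v S)) id
    ⟨α, by
      simp only [Finset.mem_filter, Finset.mem_Icc, le_refl, ham, true_and]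
      intro v h1 h2
      obtain rfl : v = α := le_antisymm h2 h1
      exact H⟩
  simp only [Finset.mem_filter, Finset.mem_Icc, id] at hw hmax
  obtain ⟨⟨haw, hwm⟩, hR⟩ := hw
  refine ⟨w, haw, hwm, hR w haw le_rfl, ?_⟩
  rcases hwm.eq_or_lt with e | hlt
  · exact Or.inl e
  right
  have hnot : ¬ ScaleChain h (w + 1) S := by
    intro hc
    have := hmax (w + 1) ⟨⟨by omega, by omega⟩, fun v h1 h2 => by
      rcases h2.eq_or_lt with e | e
      · rw [e]; exact hc
      · exact hR v h1 (by omega)⟩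
    omega
  have hjump : ∀ v, w + 1 ≤ 2 * v → α ≤ v → v ≤ w →
      (∀ k, v ≤ k → k ≤ w + 1 → h v ≤ h k) → False := by
    intro v h1 h2 h3 h4
    apply hnot
    have := ScaleChain.step (d := 0) (hR v h2 h3) (by omega : v < w + 1) h1 le_rfl
      (fun k hk1 hk2 => by linarith [h4 k hk1 hk2])
    simpa using this
  refine ⟨hlt, ?_, ?_⟩
  · by_contra hc
    exact hjump α (by omega) le_rfl haw fun k hk1 hk2 => hα k hk1 (by omega) (by omega)
  · have : ∀ n v, w - v = n → w + 1 ≤ 2 * v → α ≤ v → v ≤ w → h (w + 1) < h v := by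
      intro n
      induction n using Nat.strong_induction_on with
      | _ n ih =>
        intro v hn h1 h2 h3
        by_contra hc
        push Not at hc
        refine hjump v h1 h2 h3 fun k hk1 hk2 => ?_
        rcases hk1.eq_or_lt with e | e
        · rw [e]
        rcases hk2.eq_or_lt with e' | e'
        · rw [e']; exact hc
        · have := ih (w - k) (by omega) k rfl (by omega) (by omega) (by omega)
          linarith
    exact fun v => this _ v rfl

/-- The state maintained when running through the gaps of a profile. -/
structure GapState (h : ℕ → ℝ) (m : ℕ) (i : ℕ) (α : ℕ) (S W : ℝ) : Prop where
  chain : ScaleChain h α S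
  le : α ≤ m
  low : ∀ k, α ≤ k → k ≤ 2 * α → k ≤ m → h α ≤ h k
  bound : h α - α + W / 2 + 2 * S ≤ 16 + 5 * i
  pow_le : 2 ^ i ≤ α
  nonneg : 0 ≤ W
  loss_nonneg : 0 ≤ S

lemma GapState.initial {h : ℕ → ℝ} {m : ℕ} {σ : ℝ} (hp : IsProfile h m σ) (hσ : 0 ≤ σ) (hm : 1 ≤ m) :
    ∃ α S, GapState h m 0 α S 0 ∧ S ≤ 6 := by
  obtain ⟨u, h1, h2, h3, h4, h5⟩ := ScaleChain.base.exists_record_low (h := h) hm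
  have hl := hp.linear u h2
  have hi := hp.start
  have : (0 : ℝ) ≤ σ * u := by positivity
  have hu : (1 : ℝ) ≤ u := by exact_mod_cast h1
  refine ⟨u, _, ⟨h3, h2, h5, ?_, by simpa using h1, le_rfl, by linarith⟩, by linarith⟩
  push_cast
  linarith

lemma GapState.next {h : ℕ → ℝ} {m i α : ℕ} {σ S W : ℝ} (hp : IsProfile h m σ) (hσ : 0 ≤ σ)
    (hs : GapState h m i α S W) :
    ∃ w : ℕ, 2 ^ i ≤ w ∧ w ≤ m ∧ ScaleChain h w S ∧ (w = m ∨ ∃ (α' : ℕ) (l : ℝ), 0 ≤ l ∧ l ≤ w + 7 ∧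
      GapState h m (i + 1) α' (S + l) (W + w) ∧
      (1 + σ) * l + 2 * S + W / 2 ≤ (1 / 2 - σ) * w + (23 + 5 * i)) := by
  obtain ⟨w, h1, h2, h3, h4⟩ := hs.chain.exists_stuck hs.le hs.low
  refine ⟨w, hs.pow_le.trans h1, h2, h3, ?_⟩
  rcases h4 with h4 | ⟨hlt, h2a, hst⟩
  · exact Or.inl h4
  right
  obtain ⟨u, g1, g2, g3, g4, g5⟩ := h3.exists_record_low h2
  have hα1 : 1 ≤ α := hs.chain.one_le
  have hww : h (w + 1) < h w := hst w (by omega) h1 le_rfl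
  have huw : w < u := by
    rcases g1.eq_or_lt with e | e
    · have := g5 (w + 1) (by omega) (by omega) (by omega)
      rw [← e] at this; linarith
    · exact e
  set v := (w + 2) / 2
  have hv : h (w + 1) < h v := hst v (by omega) (by omega) (by omega)
  have e1 := hp.upper α v (by omega) (by omega)
  have e2 := hp.lower w (w + 1) (by omega) (by omega)
  have e3 := hp.lower w u g1 g2
  have e4 := hp.linear u g2
  have e5 := hp.upper 1 w (by omega) h2
  have e6 := hp.start
  have hvw : (v : ℝ) ≤ w / 2 + 1 := by
    have : 2 * v ≤ w + 2 := by omega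
    have : (2 : ℝ) * v ≤ w + 2 := by exact_mod_cast this
    linarith
  have hb := hs.bound
  push_cast at e2 e5
  have hw0 : (0 : ℝ) ≤ w := Nat.cast_nonneg _
  have hσu : σ * (w + (h w - h u)) ≤ σ * u := by
    apply mul_le_mul_of_nonneg_left _ hσ; linarith
  have hσw : 0 ≤ σ * u := by positivity
  refine ⟨u, h w - h u, by linarith, by linarith, ⟨g3, g2, g5, ?_, ?_, ?_, ?_⟩, ?_⟩
  · push_cast; linarith
  · have := hs.pow_le
    rw [pow_succ]; omega
  · linarith [hs.nonneg]
  · linarith [hs.loss_nonneg]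
  · nlinarith

lemma ratio_decrease {σ lam c r S W w l : ℝ} (hσ : 0 ≤ σ) (hlam : 0 < lam)
    (hW : 0 ≤ W) (hw : 0 ≤ w)
    (h1 : (1 + σ) * l + W / 2 ≤ c * w) (h2 : lam * w ≤ S) (h3 : S ≤ r * W) :
    S + l ≤ r * (W + w) - (1 / 2 - c ^ 2 / (4 * (1 + σ) * lam)) / (1 + σ) * W := by
  have hs : 0 < 1 + σ := by linarith
  have key : w * (c - (1 + σ) * r) ≤ c ^ 2 / (4 * (1 + σ) * lam) * W := by
    rcases le_total (c - (1 + σ) * r) 0 with hc | hc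
    · have : 0 ≤ c ^ 2 / (4 * (1 + σ) * lam) * W := by positivity
      nlinarith
    · have e1 : w * (c - (1 + σ) * r) ≤ (r * W / lam) * (c - (1 + σ) * r) := by
        apply mul_le_mul_of_nonneg_right _ hc
        rw [le_div_iff₀ hlam]; linarith
      refine e1.trans ?_
      have e2 : c ^ 2 / (4 * (1 + σ) * lam) * W - (r * W / lam) * (c - (1 + σ) * r)
          = (W / lam) * (c - 2 * (1 + σ) * r) ^ 2 / (4 * (1 + σ)) := by
        field_simp; ring
      have : 0 ≤ (W / lam) * (c - 2 * (1 + σ) * r) ^ 2 / (4 * (1 + σ)) := by positivity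
      linarith
  have e3 : (1 / 2 - c ^ 2 / (4 * (1 + σ) * lam)) / (1 + σ) * W * (1 + σ)
      = W / 2 - c ^ 2 / (4 * (1 + σ) * lam) * W := by
    field_simp
  have : (S + l) * (1 + σ) ≤
      (r * (W + w) - (1 / 2 - c ^ 2 / (4 * (1 + σ) * lam)) / (1 + σ) * W) * (1 + σ) := by
    rw [sub_mul, e3]
    nlinarith
  exact le_of_mul_le_mul_right this hs

noncomputable def lossBound (B lam : ℝ) : ℕ → ℝ
  | 0 => 6
  | i + 1 => lossBound B lam i + (B + lossBound B lam i / lam + 7)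

lemma lossBound_nonneg {B lam : ℝ} (hB : 0 ≤ B) (hlam : 0 < lam) (i : ℕ) :
    0 ≤ lossBound B lam i := by
  induction i with
  | zero => norm_num [lossBound]
  | succ i ih =>
    have : 0 ≤ lossBound B lam i / lam := by positivity
    rw [lossBound]; linarith

lemma lossBound_mono {B lam : ℝ} (hB : 0 ≤ B) (hlam : 0 < lam) :
    Monotone (lossBound B lam) := by
  apply monotone_nat_of_le_succ
  intro i
  have := lossBound_nonneg hB hlam i
  have : 0 ≤ lossBound B lam i / lam := by positivity
  rw [lossBound]; linarith

/-- Every long enough profile admits a chain of scales with small loss. -/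
theorem exists_scaleChain {σ lam : ℝ} (hσ : 0 ≤ σ) (hlam : 0 < lam)
    (hc : (1 / 2 - σ - 2 * lam) ^ 2 < 2 * (1 + σ) * lam) (B : ℕ) :
    ∃ m : ℕ, 1 ≤ m ∧ ∀ h : ℕ → ℝ, IsProfile h m σ →
      ∃ b l, B ≤ b ∧ b ≤ m ∧ l ≤ lam * b ∧ ScaleChain h b l := by
  obtain ⟨ε, hε0, hε1, hε⟩ : ∃ ε : ℝ, 0 < ε ∧ ε ≤ 1 / 2 ∧
      (1 / 2 - σ - 2 * lam + ε) ^ 2 < 2 * (1 + σ) * lam := by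
    have ht : Tendsto (fun ε : ℝ => (1 / 2 - σ - 2 * lam + ε) ^ 2) (nhdsWithin 0 (Ioi 0))
        (nhds ((1 / 2 - σ - 2 * lam + 0) ^ 2)) :=
      ((Continuous.tendsto (by fun_prop) 0).mono_left nhdsWithin_le_nhds)
    rw [add_zero] at ht
    have := (ht.eventually (gt_mem_nhds hc)).and
      (Ioo_mem_nhdsGT (show (0 : ℝ) < 1 / 2 by norm_num))
    obtain ⟨ε, h1, h2⟩ := this.exists
    exact ⟨ε, h2.1, h2.2.le, h1⟩
  set c := 1 / 2 - σ - 2 * lam + ε with hcdef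
  set ε₂ := (1 / 2 - c ^ 2 / (4 * (1 + σ) * lam)) / (1 + σ) with hε₂
  have hε₂0 : 0 < ε₂ := by
    apply div_pos _ (by linarith)
    have : c ^ 2 / (4 * (1 + σ) * lam) < 1 / 2 := by
      rw [div_lt_iff₀ (by positivity)]; linarith
    linarith
  set ε₃ := ε₂ / (1 + 1 / lam) with hε₃
  have hε₃0 : 0 < ε₃ := by positivity
  obtain ⟨i₀, hi₀⟩ : ∃ i₀ : ℕ, ∀ i, i₀ ≤ i → (23 + 5 * i : ℝ) ≤ ε * 2 ^ i ∧ B ≤ 2 ^ i := by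
    have h1 : Tendsto (fun i : ℕ => (23 + 5 * i : ℝ) / 2 ^ i) atTop (nhds 0) := by
      have a := tendsto_pow_const_div_const_pow_of_one_lt 1 (one_lt_two : (1 : ℝ) < 2)
      have b := tendsto_pow_const_div_const_pow_of_one_lt 0 (one_lt_two : (1 : ℝ) < 2)
      have := (b.const_mul 23).add (a.const_mul 5)
      simp only [mul_zero, add_zero] at this
      refine this.congr fun i => ?_
      field_simp
    have h2 := (h1.eventually (gt_mem_nhds hε0)).and
      ((tendsto_pow_atTop_atTop_of_one_lt (one_lt_two : 1 < 2)).eventually_ge_atTop B)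
    obtain ⟨i₀, hi₀⟩ := eventually_atTop.1 h2
    refine ⟨i₀, fun i hi => ⟨?_, (hi₀ i hi).2⟩⟩
    have := (hi₀ i hi).1
    rw [div_lt_iff₀ (by positivity)] at this
    exact this.le
  obtain ⟨J, hJ⟩ := exists_nat_ge (1 / ε₃)
  set T := i₀ + 1 + J with hT
  obtain ⟨m, hm⟩ := exists_nat_gt (B + lossBound B lam T / lam + 1)
  have hFT := lossBound_nonneg (Nat.cast_nonneg B) hlam T
  have hm1 : B < m ∧ 1 ≤ m := by
    have : 0 ≤ lossBound B lam T / lam := by positivity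
    have hB : (0 : ℝ) ≤ B := Nat.cast_nonneg _
    constructor
    · have : (B : ℝ) < m := by linarith
      exact_mod_cast this
    · have : (1 : ℝ) ≤ m := by linarith
      exact_mod_cast this
  refine ⟨m, hm1.2, fun h hp => ?_⟩
  by_contra! hno
  have hw_lt : ∀ {w : ℕ} {S : ℝ}, w ≤ m → B ≤ w → ScaleChain h w S → lam * w < S := by
    intro w S h1 h2 h3
    by_contra! hle
    exact hno w S h2 h1 hle h3
  have hstep : ∀ {i α : ℕ} {S W : ℝ}, i ≤ T → GapState h m i α S W → S ≤ lossBound B lam i →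
      ∃ (w : ℕ) (α' : ℕ) (l : ℝ), 0 ≤ l ∧ 2 ^ i ≤ w ∧ w ≤ m ∧ ScaleChain h w S ∧
        GapState h m (i + 1) α' (S + l) (W + w) ∧ S + l ≤ lossBound B lam (i + 1) ∧
        (1 + σ) * l + 2 * S + W / 2 ≤ (1 / 2 - σ) * w + (23 + 5 * i) := by
    intro i α S W hiT hs hS
    obtain ⟨w, h1, h2, h3, h4⟩ := hs.next hp hσ
    have hwb : (w : ℝ) ≤ B + lossBound B lam i / lam := by
      rcases le_total B w with hB | hB
      · have := hw_lt h2 hB h3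
        have hw : (w : ℝ) ≤ lossBound B lam i / lam := by
          rw [le_div_iff₀ hlam]; linarith
        have hB : (0 : ℝ) ≤ B := Nat.cast_nonneg _
        linarith
      · have : (w : ℝ) ≤ B := by exact_mod_cast hB
        have h0 := lossBound_nonneg (Nat.cast_nonneg B) hlam i
        have : 0 ≤ lossBound B lam i / lam := by positivity
        linarith
    rcases h4 with h4 | ⟨α', l, hl0, hl1, hs', hin⟩
    · exfalso
      have h5 : lossBound B lam i / lam ≤ lossBound B lam T / lam := by
        apply div_le_div_of_nonneg_right _ hlam.le
        exact lossBound_mono (Nat.cast_nonneg B) hlam hiT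
      rw [h4] at hwb
      linarith
    · refine ⟨w, α', l, hl0, h1, h2, h3, hs', ?_, hin⟩
      rw [lossBound]; linarith
  have claim₀ : ∀ i, i ≤ i₀ → ∃ α S W, GapState h m i α S W ∧ S ≤ lossBound B lam i := by
    intro i
    induction i with
    | zero =>
      intro _
      obtain ⟨α, S, h1, h2⟩ := GapState.initial hp hσ hm1.2
      exact ⟨α, S, 0, h1, h2⟩
    | succ i ih =>
      intro hi
      obtain ⟨α, S, W, h1, h2⟩ := ih (by omega)
      obtain ⟨w, α', l, -, -, -, -, h3, h4, -⟩ := hstep (by omega) h1 h2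
      exact ⟨α', _, _, h3, h4⟩
  have claim₁ : ∀ j, j ≤ J → ∃ α S W, GapState h m (i₀ + 1 + j) α S W ∧
      S ≤ lossBound B lam (i₀ + 1 + j) ∧ S ≤ (1 - ε₃ * j) * W := by
    intro j
    induction j with
    | zero =>
      intro _
      obtain ⟨α, S, W, h1, h2⟩ := claim₀ i₀ le_rfl
      obtain ⟨w, α', l, hl, g1, -, -, h3, h4, h5⟩ := hstep (by omega) h1 h2
      refine ⟨α', _, _, h3, h4, ?_⟩
      have hW := h1.nonneg
      have hS := h1.loss_nonneg
      have hb := (hi₀ i₀ le_rfl).1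
      have hw : (2 : ℝ) ^ i₀ ≤ w := by exact_mod_cast g1
      have : ε * 2 ^ i₀ ≤ 1 / 2 * w := by
        apply mul_le_mul hε1 hw (by positivity) (by norm_num)
      have hw0 : (0 : ℝ) ≤ w := Nat.cast_nonneg _
      have hσl : 0 ≤ σ * l := by positivity
      have hσw : 0 ≤ σ * w := by positivity
      push_cast
      linarith
    | succ j ih =>
      intro hj
      obtain ⟨α, S, W, h1, h2, h6⟩ := ih (by omega)
      obtain ⟨w, α', l, -, g1, g2, g3, h3, h4, h5⟩ := hstep (by omega) h1 h2
      refine ⟨α', _, _, h3, h4, ?_⟩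
      have hW := h1.nonneg
      obtain ⟨hb, hB⟩ := hi₀ (i₀ + 1 + j) (by omega)
      have hlw := hw_lt g2 (hB.trans g1) g3
      have hw : (2 : ℝ) ^ (i₀ + 1 + j) ≤ w := by exact_mod_cast g1
      have hw0 : (0 : ℝ) ≤ w := Nat.cast_nonneg _
      have hεw : ε * 2 ^ (i₀ + 1 + j) ≤ ε * w := by gcongr
      have h7 := ratio_decrease (c := c) (l := l) (S := S) (r := 1 - ε₃ * j) hσ hlam hW hw0
        (by
          have : c * w = (1 / 2 - σ) * w - 2 * (lam * w) + ε * w := by rw [hcdef]; ring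
          linarith) hlw.le h6
      have hwW : (W + w) ≤ (1 + 1 / lam) * W := by
        have : (w : ℝ) ≤ W / lam := by
          rw [le_div_iff₀ hlam]
          have : 0 ≤ ε₃ * j * W := by positivity
          nlinarith
        have e : (1 + 1 / lam) * W = W + W / lam := by ring
        linarith
      have h8 : ε₃ * (W + w) ≤ ε₂ * W := by
        calc ε₃ * (W + w) ≤ ε₃ * ((1 + 1 / lam) * W) := by gcongr
          _ = ε₂ * W := by rw [hε₃]; field_simp
      push_cast
      linarith
  obtain ⟨α, S, W, h1, h2, h3⟩ := claim₁ J le_rfl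
  obtain ⟨w, α', l, -, g1, g2, g3, -⟩ := hstep (by omega) h1 h2
  have hlw := hw_lt g2 ((hi₀ (i₀ + 1 + J) (by omega)).2.trans g1) g3
  have hw0 : (0 : ℝ) ≤ w := Nat.cast_nonneg _
  have : 1 ≤ ε₃ * J := by
    rw [div_le_iff₀ hε₃0] at hJ; linarith
  have : 0 ≤ lam * w := by positivity
  nlinarith [h1.nonneg]

/-- The (unnormalised) Poisson kernel of the upper half plane. -/
noncomputable def poissonKer (a u : ℝ) : ℝ := a / (a ^ 2 + u ^ 2)

lemma poissonKer_nonneg {a : ℝ} (ha : 0 ≤ a) (u : ℝ) : 0 ≤ poissonKer a u := by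
  unfold poissonKer; positivity

lemma integrable_inv_sq_add_sq {a : ℝ} (ha : 0 < a) (x : ℝ) :
    Integrable fun u : ℝ => ((u - x) ^ 2 + a ^ 2)⁻¹ := by
  have h := ((integrable_inv_one_add_sq.comp_div ha.ne').comp_sub_right x).const_mul (a ^ 2)⁻¹
  refine h.congr (ae_of_all _ fun u => ?_)
  simp only
  rw [← mul_inv]
  congr 1
  field_simp
  ring

lemma integrable_poissonKer_mul {a b : ℝ} (ha : 0 < a) (hb : 0 < b) (x y : ℝ) :
    Integrable fun u : ℝ => poissonKer a (u - x) * poissonKer b (u - y) := by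
  have h := ((integrable_inv_sq_add_sq ha x).const_mul a)
  refine (h.bdd_mul (c := 1 / b) (g := fun u => a * ((u - x) ^ 2 + a ^ 2)⁻¹)
    (f := fun u => poissonKer b (u - y)) ?_ ?_).congr (ae_of_all _ fun u => ?_)
  · apply Continuous.aestronglyMeasurable
    unfold poissonKer
    exact continuous_const.div (by fun_prop) fun u => by positivity
  · refine ae_of_all _ fun u => ?_
    rw [Real.norm_of_nonneg (poissonKer_nonneg hb.le _)]
    unfold poissonKer
    rw [div_le_div_iff₀ (by positivity) hb]
    nlinarith [sq_nonneg (u - y)]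
  · simp only [poissonKer]
    rw [add_comm ((u - x) ^ 2), mul_comm, div_eq_mul_inv a]

lemma tendsto_log_sub_log (l : Filter ℝ) (hl : l ≤ cocompact ℝ) {a b : ℝ} (ha : 0 < a)
    (hb : 0 < b) (d : ℝ) :
    Tendsto (fun u : ℝ => Real.log ((u + d) ^ 2 + b ^ 2) - Real.log (u ^ 2 + a ^ 2)) l
      (nhds 0) := by
  have h1 : Tendsto (fun u : ℝ => (2 * d * u + (d ^ 2 + b ^ 2 - a ^ 2)) / (u ^ 2 + a ^ 2))
      (cocompact ℝ) (nhds 0) := by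
    have h2 : Tendsto (fun u : ℝ => (2 * |d| + |d ^ 2 + b ^ 2 - a ^ 2|) * ‖u‖⁻¹) (cocompact ℝ)
        (nhds 0) := by
      have := (tendsto_inv_atTop_zero.comp (tendsto_norm_cocompact_atTop (E := ℝ))).const_mul
        (2 * |d| + |d ^ 2 + b ^ 2 - a ^ 2|)
      simpa using this
    refine squeeze_zero_norm' ?_ h2
    filter_upwards [(tendsto_norm_cocompact_atTop (E := ℝ)).eventually_ge_atTop 1] with u hu
    have hu0 : 0 < ‖u‖ := by linarith
    rw [norm_div, ← div_eq_mul_inv, Real.norm_of_nonneg (by positivity : 0 ≤ u ^ 2 + a ^ 2),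
      div_le_div_iff₀ (by positivity) hu0]
    have e1 : ‖2 * d * u + (d ^ 2 + b ^ 2 - a ^ 2)‖ ≤ (2 * |d| + |d ^ 2 + b ^ 2 - a ^ 2|) * ‖u‖ := by
      refine (norm_add_le _ _).trans ?_
      rw [norm_mul, norm_mul]
      simp only [Real.norm_eq_abs] at hu ⊢
      rw [abs_two]
      nlinarith [abs_nonneg (d ^ 2 + b ^ 2 - a ^ 2)]
    have e2 : u ^ 2 = ‖u‖ * ‖u‖ := by rw [← sq, Real.norm_eq_abs, sq_abs]
    have e3 : 0 ≤ (2 * |d| + |d ^ 2 + b ^ 2 - a ^ 2|) := by positivity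
    calc _ ≤ (2 * |d| + |d ^ 2 + b ^ 2 - a ^ 2|) * ‖u‖ * ‖u‖ := by gcongr
      _ = (2 * |d| + |d ^ 2 + b ^ 2 - a ^ 2|) * u ^ 2 := by rw [e2]; ring
      _ ≤ _ := by
        apply mul_le_mul_of_nonneg_left _ e3
        nlinarith
  have h3 := ((h1.mono_left hl).const_add 1)
  rw [add_zero] at h3
  have h4 := h3.log one_ne_zero
  rw [Real.log_one] at h4
  refine h4.congr fun u => ?_
  have : 0 < u ^ 2 + a ^ 2 := by positivity
  rw [← Real.log_div (by positivity) this.ne']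
  congr 1
  field_simp
  ring

lemma hasDerivAt_arctan_div {a : ℝ} (ha : 0 < a) (d u : ℝ) :
    HasDerivAt (fun u => Real.arctan ((u + d) / a)) (a / (a ^ 2 + (u + d) ^ 2)) u := by
  have h := (((hasDerivAt_id u).add_const d).div_const a).arctan
  refine h.congr_deriv ?_
  simp only [id]
  field_simp

lemma tendsto_arctan_div_atTop {a : ℝ} (ha : 0 < a) (d : ℝ) :
    Tendsto (fun u => Real.arctan ((u + d) / a)) atTop (nhds (Real.pi / 2)) :=
  (tendsto_nhds_of_tendsto_nhdsWithin Real.tendsto_arctan_atTop).comp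
    ((tendsto_atTop_add_const_right _ d tendsto_id).atTop_div_const ha)

lemma tendsto_arctan_div_atBot {a : ℝ} (ha : 0 < a) (d : ℝ) :
    Tendsto (fun u => Real.arctan ((u + d) / a)) atBot (nhds (-(Real.pi / 2))) :=
  (tendsto_nhds_of_tendsto_nhdsWithin Real.tendsto_arctan_atBot).comp
    ((tendsto_atBot_add_const_right _ d tendsto_id).atBot_div_const ha)

lemma integral_poissonKer_mul_aux {a b : ℝ} (ha : 0 < a) (hb : 0 < b) (d : ℝ)
    (hd : 0 < (a - b) ^ 2 + d ^ 2) :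
    ∫ u : ℝ, poissonKer a u * poissonKer b (u + d) = Real.pi * poissonKer (a + b) d := by
  have hInt := integrable_poissonKer_mul ha hb 0 (-d)
  simp only [sub_zero, sub_neg_eq_add] at hInt
  set Δ := ((a + b) ^ 2 + d ^ 2) * ((a - b) ^ 2 + d ^ 2) with hΔ
  have hΔ0 : 0 < Δ := by positivity
  set e := d ^ 2 + b ^ 2 - a ^ 2 with he
  set e' := d ^ 2 + a ^ 2 - b ^ 2 with he'
  have hder : ∀ u, HasDerivAt (fun u => a * b / Δ *
      (d * (Real.log ((u + d) ^ 2 + b ^ 2) - Real.log (u ^ 2 + a ^ 2))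
        + (e / a * Real.arctan ((u + 0) / a) + e' / b * Real.arctan ((u + d) / b))))
      (poissonKer a u * poissonKer b (u + d)) u := by
    intro u
    have l1 : HasDerivAt (fun u => Real.log ((u + d) ^ 2 + b ^ 2))
        ((2 * (u + d)) / ((u + d) ^ 2 + b ^ 2)) u := by
      have := ((((hasDerivAt_id u).add_const d).pow 2).add_const (b ^ 2)).log 
        (by positivity : (u + d) ^ 2 + b ^ 2 ≠ 0)
      refine this.congr_deriv ?_
      simp
    have l2 : HasDerivAt (fun u => Real.log (u ^ 2 + a ^ 2)) ((2 * u) / (u ^ 2 + a ^ 2)) u := by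
      have := (((hasDerivAt_id u).pow 2).add_const (a ^ 2)).log 
        (by positivity : u ^ 2 + a ^ 2 ≠ 0)
      refine this.congr_deriv ?_
      simp
    have := (((l1.sub l2).const_mul d).add (((hasDerivAt_arctan_div ha 0 u).const_mul (e / a)).add
      ((hasDerivAt_arctan_div hb d u).const_mul (e' / b)))).const_mul (a * b / Δ)
    refine this.congr_deriv ?_
    unfold poissonKer
    have h1 : (u + d) ^ 2 + b ^ 2 ≠ 0 := by positivity
    have h2 : u ^ 2 + a ^ 2 ≠ 0 := by positivity
    have h3 : b ^ 2 + (u + d) ^ 2 ≠ 0 := by positivity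
    have h4 : a ^ 2 + u ^ 2 ≠ 0 := by positivity
    rw [add_zero, add_comm ((u + d) ^ 2), add_comm (u ^ 2)]
    have h5 : d * (2 * (u + d) / (b ^ 2 + (u + d) ^ 2) - 2 * u / (a ^ 2 + u ^ 2)) +
        (e / a * (a / (a ^ 2 + u ^ 2)) + e' / b * (b / (b ^ 2 + (u + d) ^ 2))) =
        Δ / ((a ^ 2 + u ^ 2) * (b ^ 2 + (u + d) ^ 2)) := by
      field_simp
      rw [hΔ, he, he']
      ring
    rw [h5]
    field_simp
  have key := integral_of_hasDerivAt_of_tendsto hder hInt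
    (((((tendsto_log_sub_log atBot atBot_le_cocompact ha hb d).const_mul d)).add
      (((tendsto_arctan_div_atBot ha 0).const_mul (e / a)).add
        ((tendsto_arctan_div_atBot hb d).const_mul (e' / b)))).const_mul _)
    (((((tendsto_log_sub_log atTop atTop_le_cocompact ha hb d).const_mul d)).add
      (((tendsto_arctan_div_atTop ha 0).const_mul (e / a)).add
        ((tendsto_arctan_div_atTop hb d).const_mul (e' / b)))).const_mul _)
  rw [key]
  unfold poissonKer
  have h1 : (a + b) ^ 2 + d ^ 2 ≠ 0 := by positivity
  rw [hΔ, he, he']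
  field_simp
  ring

lemma integral_poissonKer_sq {a : ℝ} (ha : 0 < a) :
    ∫ u : ℝ, poissonKer a u * poissonKer a u = Real.pi * poissonKer (a + a) 0 := by
  have hInt := integrable_poissonKer_mul ha ha 0 0
  simp only [sub_zero] at hInt
  have hder : ∀ u, HasDerivAt (fun u => 1 / 2 * (u / (u ^ 2 + a ^ 2)) +
      (2 * a)⁻¹ * Real.arctan ((u + 0) / a)) (poissonKer a u * poissonKer a u) u := by
    intro u
    have l1 := ((hasDerivAt_id u).div (((hasDerivAt_id u).pow 2).add_const (a ^ 2)) 
        (by positivity : u ^ 2 + a ^ 2 ≠ 0)).const_mul (1 / 2)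
    have := l1.add ((hasDerivAt_arctan_div ha 0 u).const_mul (2 * a)⁻¹)
    refine this.congr_deriv ?_
    unfold poissonKer
    simp only [id, Pi.pow_apply]
    rw [add_zero, add_comm (u ^ 2)]
    have h4 : a ^ 2 + u ^ 2 ≠ 0 := by positivity
    field_simp
    ring
  have hlim : Tendsto (fun u : ℝ => u / (u ^ 2 + a ^ 2)) (cocompact ℝ) (nhds 0) := by
    have h2 : Tendsto (fun u : ℝ => ‖u‖⁻¹) (cocompact ℝ) (nhds 0) :=
      tendsto_inv_atTop_zero.comp (tendsto_norm_cocompact_atTop (E := ℝ))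
    refine squeeze_zero_norm' ?_ h2
    filter_upwards [(tendsto_norm_cocompact_atTop (E := ℝ)).eventually_ge_atTop 1] with u hu
    have hu0 : 0 < ‖u‖ := by linarith
    rw [norm_div, Real.norm_of_nonneg (by positivity : 0 ≤ u ^ 2 + a ^ 2), inv_eq_one_div,
      div_le_div_iff₀ (by positivity) hu0]
    have e2 : u ^ 2 = ‖u‖ * ‖u‖ := by rw [← sq, Real.norm_eq_abs, sq_abs]
    nlinarith
  have key := integral_of_hasDerivAt_of_tendsto hder hInt
    (((hlim.mono_left atBot_le_cocompact).const_mul (1 / 2)).add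
      ((tendsto_arctan_div_atBot ha 0).const_mul (2 * a)⁻¹))
    (((hlim.mono_left atTop_le_cocompact).const_mul (1 / 2)).add
      ((tendsto_arctan_div_atTop ha 0).const_mul (2 * a)⁻¹))
  rw [key]
  unfold poissonKer
  field_simp
  ring

/-- The semigroup property of the Poisson kernel. -/
lemma integral_poissonKer_mul {a b : ℝ} (ha : 0 < a) (hb : 0 < b) (x y : ℝ) :
    ∫ u : ℝ, poissonKer a (u - x) * poissonKer b (u - y) =
      Real.pi * poissonKer (a + b) (x - y) := by
  have h := integral_add_right_eq_self (μ := (volume : Measure ℝ))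
    (fun u : ℝ => poissonKer a (u - x) * poissonKer b (u - y)) x
  rw [← h]
  simp only [add_sub_cancel_right, add_sub_assoc]
  by_cases hd : 0 < (a - b) ^ 2 + (x - y) ^ 2
  · exact integral_poissonKer_mul_aux ha hb (x - y) hd
  · have h1 : x - y = 0 := by nlinarith [sq_nonneg (a - b), sq_nonneg (x - y)]
    have h2 : a - b = 0 := by nlinarith [sq_nonneg (a - b), sq_nonneg (x - y)]
    obtain rfl : a = b := by linarith
    rw [h1]
    simpa using integral_poissonKer_sq ha

lemma quadratic_eq {a : ℝ} (z₀ z₁ t : ℝ) (ha : 0 < a) :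
    a / (a ^ 2 * (1 + t ^ 2) + (z₀ + t * z₁) ^ 2) =
      a / (a ^ 2 + z₁ ^ 2) * ((t - -(z₀ * z₁ / (a ^ 2 + z₁ ^ 2))) ^ 2 +
        (a * Real.sqrt (a ^ 2 + (z₀ ^ 2 + z₁ ^ 2)) / (a ^ 2 + z₁ ^ 2)) ^ 2)⁻¹ := by
  have h1 : 0 < a ^ 2 + z₁ ^ 2 := by positivity
  have h2 : Real.sqrt (a ^ 2 + (z₀ ^ 2 + z₁ ^ 2)) ^ 2 = a ^ 2 + (z₀ ^ 2 + z₁ ^ 2) :=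
    Real.sq_sqrt (by positivity)
  rw [div_pow, mul_pow, h2]
  rw [div_eq_mul_inv, div_eq_mul_inv, mul_assoc, ← mul_inv]
  congr 2
  field_simp
  ring

lemma integral_univ_inv_sq_add_sq {a : ℝ} (ha : 0 < a) (x : ℝ) :
    ∫ u : ℝ, ((u - x) ^ 2 + a ^ 2)⁻¹ = Real.pi / a := by
  have hder : ∀ u, HasDerivAt (fun u => a⁻¹ * Real.arctan ((u + -x) / a))
      ((u - x) ^ 2 + a ^ 2)⁻¹ u := by
    intro u
    refine ((hasDerivAt_arctan_div ha (-x) u).const_mul a⁻¹).congr_deriv ?_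
    rw [← sub_eq_add_neg, add_comm]
    field_simp
  rw [integral_of_hasDerivAt_of_tendsto hder (integrable_inv_sq_add_sq ha x)
    ((tendsto_arctan_div_atBot ha _).const_mul _) ((tendsto_arctan_div_atTop ha _).const_mul _)]
  field_simp
  ring

lemma integrable_poissonKer_proj {a : ℝ} (ha : 0 < a) (z₀ z₁ : ℝ) :
    Integrable fun t : ℝ => a / (a ^ 2 * (1 + t ^ 2) + (z₀ + t * z₁) ^ 2) := by
  simp only [quadratic_eq z₀ z₁ _ ha]
  exact (integrable_inv_sq_add_sq (by positivity) _).const_mul _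

/-- Averaging the Poisson kernel over all projections gives the (regularised) Riesz kernel. -/
lemma integral_poissonKer_proj {a : ℝ} (ha : 0 < a) (z₀ z₁ : ℝ) :
    ∫ t : ℝ, a / (a ^ 2 * (1 + t ^ 2) + (z₀ + t * z₁) ^ 2) =
      Real.pi / Real.sqrt (a ^ 2 + (z₀ ^ 2 + z₁ ^ 2)) := by
  simp only [quadratic_eq z₀ z₁ _ ha]
  have : 0 < Real.sqrt (a ^ 2 + (z₀ ^ 2 + z₁ ^ 2)) := by positivity
  rw [integral_const_mul, integral_univ_inv_sq_add_sq (by positivity)]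
  field_simp

/-- The Poisson extension of a weighted point configuration on the line. -/
noncomputable def poissonSum {ι : Type*} [Fintype ι] (w X : ι → ℝ) (a u : ℝ) : ℝ :=
  ∑ i, w i * poissonKer a (u - X i)

/-- The Poisson energy of a weighted point configuration on the line. -/
noncomputable def poissonEnergy {ι : Type*} [Fintype ι] (w X : ι → ℝ) (a : ℝ) : ℝ :=
  ∑ i, ∑ j, w i * w j * poissonKer a (X i - X j)

/-- The regularised Riesz energy (of order one) of a weighted point configuration in the plane. -/
noncomputable def rieszEnergy {ι : Type*} [Fintype ι] (w x₀ x₁ : ι → ℝ) (a : ℝ) : ℝ :=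
  ∑ i, ∑ j, w i * w j * (Real.sqrt (a ^ 2 + ((x₀ i - x₀ j) ^ 2 + (x₁ i - x₁ j) ^ 2)))⁻¹

section

variable {ι κ : Type*} [Fintype ι] [Fintype κ]

lemma poissonSum_mul_eq (w X : ι → ℝ) (a b u : ℝ) :
    poissonSum w X a u * poissonSum w X b u =
      ∑ i, ∑ j, w i * w j * (poissonKer a (u - X i) * poissonKer b (u - X j)) := by
  unfold poissonSum
  rw [Finset.sum_mul_sum]
  refine Finset.sum_congr rfl fun i _ => Finset.sum_congr rfl fun j _ => by ring

lemma integrable_poissonSum_mul (w X : ι → ℝ) {a b : ℝ} (ha : 0 < a) (hb : 0 < b) :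
    Integrable fun u => poissonSum w X a u * poissonSum w X b u := by
  simp only [poissonSum_mul_eq]
  exact integrable_finsetSum _ fun i _ => integrable_finsetSum _ fun j _ =>
    (integrable_poissonKer_mul ha hb _ _).const_mul _

lemma integral_poissonSum_mul (w X : ι → ℝ) {a b : ℝ} (ha : 0 < a) (hb : 0 < b) :
    ∫ u, poissonSum w X a u * poissonSum w X b u = Real.pi * poissonEnergy w X (a + b) := by
  simp only [poissonSum_mul_eq]
  rw [integral_finsetSum _ fun i _ => integrable_finsetSum _ fun j _ =>
    (integrable_poissonKer_mul ha hb _ _).const_mul _]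
  unfold poissonEnergy
  rw [Finset.mul_sum]
  refine Finset.sum_congr rfl fun i _ => ?_
  rw [integral_finsetSum _ fun j _ => (integrable_poissonKer_mul ha hb _ _).const_mul _,
    Finset.mul_sum]
  refine Finset.sum_congr rfl fun j _ => ?_
  rw [integral_const_mul, integral_poissonKer_mul ha hb]
  ring

lemma poissonEnergy_div (w x₀ x₁ : ι → ℝ) (a t : ℝ) :
    poissonEnergy w (fun i => x₀ i + t * x₁ i) (a * Real.sqrt (1 + t ^ 2)) / Real.sqrt (1 + t ^ 2) =
      ∑ i, ∑ j, w i * w j *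
        (a / (a ^ 2 * (1 + t ^ 2) + ((x₀ i - x₀ j) + t * (x₁ i - x₁ j)) ^ 2)) := by
  have h : 0 < Real.sqrt (1 + t ^ 2) := by positivity
  have h2 : Real.sqrt (1 + t ^ 2) ^ 2 = 1 + t ^ 2 := Real.sq_sqrt (by positivity)
  unfold poissonEnergy
  rw [Finset.sum_div]
  refine Finset.sum_congr rfl fun i _ => ?_
  rw [Finset.sum_div]
  refine Finset.sum_congr rfl fun j _ => ?_
  unfold poissonKer
  rw [mul_div_assoc]
  congr 1
  rw [mul_pow, h2, div_div, mul_div_mul_right _ _ h.ne']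
  ring

lemma integrable_poissonEnergy_div (w x₀ x₁ : ι → ℝ) {a : ℝ} (ha : 0 < a) :
    Integrable fun t => poissonEnergy w (fun i => x₀ i + t * x₁ i) (a * Real.sqrt (1 + t ^ 2)) /
      Real.sqrt (1 + t ^ 2) := by
  simp only [poissonEnergy_div]
  exact integrable_finsetSum _ fun i _ => integrable_finsetSum _ fun j _ =>
    (integrable_poissonKer_proj ha _ _).const_mul _

lemma integral_poissonEnergy_div (w x₀ x₁ : ι → ℝ) {a : ℝ} (ha : 0 < a) :
    ∫ t, poissonEnergy w (fun i => x₀ i + t * x₁ i) (a * Real.sqrt (1 + t ^ 2)) /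
      Real.sqrt (1 + t ^ 2) = Real.pi * rieszEnergy w x₀ x₁ a := by
  simp only [poissonEnergy_div]
  rw [integral_finsetSum _ fun i _ => integrable_finsetSum _ fun j _ =>
    (integrable_poissonKer_proj ha _ _).const_mul _]
  unfold rieszEnergy
  rw [Finset.mul_sum]
  refine Finset.sum_congr rfl fun i _ => ?_
  rw [integral_finsetSum _ fun j _ => (integrable_poissonKer_proj ha _ _).const_mul _,
    Finset.mul_sum]
  refine Finset.sum_congr rfl fun j _ => ?_
  rw [integral_const_mul, integral_poissonKer_proj ha]
  ring

lemma poissonKer_lower {r ρ v L : ℝ} (hr : 0 < r) (hρ : 1 ≤ ρ) (hρ' : ρ ^ 2 ≤ 5)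
    (hv : |v| ≤ r * L) : 1 / (5 + L ^ 2) / r ≤ poissonKer (r * ρ) v := by
  unfold poissonKer
  have h1 : v ^ 2 ≤ (r * L) ^ 2 := by rw [← sq_abs]; gcongr
  have h2 : (r * ρ) ^ 2 ≤ r ^ 2 * 5 := by rw [mul_pow]; gcongr
  rw [div_div, div_le_div_iff₀ (by positivity) (by positivity), one_mul]
  calc (r * ρ) ^ 2 + v ^ 2 ≤ r * 1 * ((5 + L ^ 2) * r) := by nlinarith
    _ ≤ _ := by gcongr

lemma poissonKer_upper {a : ℝ} (ha : 0 < a) (v : ℝ) : poissonKer a v ≤ 1 / a := by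
  unfold poissonKer
  rw [div_le_div_iff₀ (by positivity) ha]
  nlinarith [sq_nonneg v]

open Classical in
lemma heavy_pointwise {w x₀ x₁ : ι → ℝ} {ν y₀ y₁ : κ → ℝ} (hw : ∀ i, 0 ≤ w i)
    (hν : ∀ k, 0 ≤ ν k) (hν1 : ∑ k, ν k ≤ 1) {r R H K c : ℝ} (hr : 0 < r) (hr1 : r ≤ 1)
    (hR : 0 < R) (hc : 0 < c)
    (hHR : 2 * (5 + (1 + K + 1 / c) ^ 2) ≤ H * R)
    (hK : ∀ i k, |y₁ k - x₁ i| ≤ K) (S : Finset (ι × κ))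
    (hS1 : ∀ p ∈ S, |y₀ p.2 - x₀ p.1| ≤ |y₁ p.2 - x₁ p.1|)
    (hS2 : ∀ p ∈ S, c ≤ |y₁ p.2 - x₁ p.1|)
    (hS3 : ∀ p ∈ S, H * r ≤ ∑ k with |(y₀ p.2 - x₀ p.1) * (y₁ k - x₁ p.1) -
      (y₁ p.2 - x₁ p.1) * (y₀ k - x₀ p.1)| ≤ r, ν k)
    {τ : ℝ} (hτ : 0 < τ) (t u : ℝ) :
    ∑ p ∈ S with |t + (y₀ p.2 - x₀ p.1) / (y₁ p.2 - x₁ p.1)| ≤ r ∧ |u - (x₀ p.1 + t * x₁ p.1)| ≤ r,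
      w p.1 * ν p.2 * (1 / (5 + (1 + K + 1 / c) ^ 2) / r) ^ 2 ≤
    τ * (poissonSum w (fun i => x₀ i + t * x₁ i) (r * Real.sqrt (1 + t ^ 2)) u) ^ 2 +
      (poissonSum ν (fun i => y₀ i + t * y₁ i) (r * Real.sqrt (1 + t ^ 2)) u -
        poissonSum ν (fun i => y₀ i + t * y₁ i) (R * Real.sqrt (1 + t ^ 2)) u) ^ 2 / τ := by
  set ρ := Real.sqrt (1 + t ^ 2) with hρ
  set L := 1 + K + 1 / c with hL
  set c₁ := 1 / (5 + L ^ 2) with hc₁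
  set F := poissonSum w (fun i => x₀ i + t * x₁ i) (r * ρ) u with hF
  set N := poissonSum ν (fun i => y₀ i + t * y₁ i) (r * ρ) u with hN
  set N' := poissonSum ν (fun i => y₀ i + t * y₁ i) (R * ρ) u with hN'
  have hRHS : 0 ≤ τ * F ^ 2 + (N - N') ^ 2 / τ := by positivity
  set S' := S.filter (fun p => |t + (y₀ p.2 - x₀ p.1) / (y₁ p.2 - x₁ p.1)| ≤ r ∧
    |u - (x₀ p.1 + t * x₁ p.1)| ≤ r) with hS'
  rcases S'.eq_empty_or_nonempty with he | ⟨q, hq⟩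
  · rw [he, Finset.sum_empty]; exact hRHS
  have hρ1 : 1 ≤ ρ := by
    rw [hρ, Real.one_le_sqrt]; nlinarith [sq_nonneg t]
  have hρ0 : 0 < ρ := by linarith
  have hρ2 : ρ ^ 2 = 1 + t ^ 2 := Real.sq_sqrt (by positivity)
  have hgeom : ∀ p ∈ S', ρ ^ 2 ≤ 5 ∧ ∀ v₀ v₁ : ℝ, |v₁| ≤ K →
      |(y₀ p.2 - x₀ p.1) * v₁ - (y₁ p.2 - x₁ p.1) * v₀| ≤ r →
      |u - (x₀ p.1 + t * x₁ p.1) - (v₀ + t * v₁)| ≤ r * L := by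
    intro p hp
    rw [hS', Finset.mem_filter] at hp
    obtain ⟨hpS, hp1, hp2⟩ := hp
    have g1 := hS1 p hpS
    have g2 := hS2 p hpS
    set z₀ := y₀ p.2 - x₀ p.1
    set z₁ := y₁ p.2 - x₁ p.1
    have hz1 : 0 < |z₁| := by linarith
    have hz1' : z₁ ≠ 0 := abs_pos.1 hz1
    have hq : |z₀ / z₁| ≤ 1 := by
      rw [abs_div, div_le_one hz1]; exact g1
    constructor
    · have ht : |t| ≤ 2 := by
        have : |t| ≤ |t + z₀ / z₁| + |z₀ / z₁| := by
          simpa using abs_sub (t + z₀ / z₁) (z₀ / z₁)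
        linarith
      rw [hρ2]
      have : t ^ 2 ≤ 2 ^ 2 := sq_le_sq' (by linarith [abs_le.1 ht]) (abs_le.1 ht).2
      linarith
    · intro v₀ v₁ hv hcr
      have e : v₀ + t * v₁ = (t + z₀ / z₁) * v₁ - (z₀ * v₁ - z₁ * v₀) / z₁ := by
        field_simp; ring
      have e1 : |(t + z₀ / z₁) * v₁| ≤ r * K := by
        rw [abs_mul]; gcongr
      have e2 : |(z₀ * v₁ - z₁ * v₀) / z₁| ≤ r * (1 / c) := by
        rw [abs_div, div_le_iff₀ hz1]
        calc |z₀ * v₁ - z₁ * v₀| ≤ r := hcr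
          _ = r * (1 / c) * c := by field_simp
          _ ≤ _ := by gcongr
      rw [e]
      calc _ ≤ |u - (x₀ p.1 + t * x₁ p.1)| + |(t + z₀ / z₁) * v₁ - (z₀ * v₁ - z₁ * v₀) / z₁| :=
            abs_sub _ _
        _ ≤ r + (r * K + r * (1 / c)) := by
            gcongr
            exact (abs_sub _ _).trans (by gcongr)
        _ = _ := by rw [hL]; ring
  have hK0 : 0 ≤ K := (abs_nonneg _).trans (hK q.1 q.2)
  have hL1 : 1 ≤ L := by
    rw [hL]; have : 0 < 1 / c := by positivity
    linarith
  have hc₁0 : 0 < c₁ := by positivity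
  -- lower bound for the fine sum at a point near a heavy pair
  have hNlow : c₁ * H ≤ N := by
    have hqS := (Finset.mem_filter.1 hq).1
    obtain ⟨hρ5, hg⟩ := hgeom q hq
    calc c₁ * H = (H * r) * (c₁ / r) := by field_simp
      _ ≤ (∑ k with |(y₀ q.2 - x₀ q.1) * (y₁ k - x₁ q.1) -
            (y₁ q.2 - x₁ q.1) * (y₀ k - x₀ q.1)| ≤ r, ν k) * (c₁ / r) := by
          gcongr; exact hS3 q hqS
      _ ≤ ∑ k with |(y₀ q.2 - x₀ q.1) * (y₁ k - x₁ q.1) -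
            (y₁ q.2 - x₁ q.1) * (y₀ k - x₀ q.1)| ≤ r,
            ν k * poissonKer (r * ρ) (u - (y₀ k + t * y₁ k)) := by
          rw [Finset.sum_mul]
          refine Finset.sum_le_sum fun k hk => mul_le_mul_of_nonneg_left ?_ (hν k)
          have := hg (y₀ k - x₀ q.1) (y₁ k - x₁ q.1) (hK _ _) (Finset.mem_filter.1 hk).2
          refine poissonKer_lower hr hρ1 hρ5 (L := L) ?_
          convert this using 2
          ring
      _ ≤ N := by
          rw [hN]
          exact Finset.sum_le_sum_of_subset_of_nonneg (Finset.filter_subset _ _) fun k _ _ =>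
            mul_nonneg (hν k) (poissonKer_nonneg (by positivity) _)
  have hN'up : N' ≤ 1 / R := by
    calc N' ≤ ∑ k, ν k * (1 / R) := by
          rw [hN']
          refine Finset.sum_le_sum fun k _ => mul_le_mul_of_nonneg_left ?_ (hν k)
          refine (poissonKer_upper (by positivity) _).trans ?_
          exact one_div_le_one_div_of_le hR (by nlinarith)
      _ = (∑ k, ν k) * (1 / R) := by rw [Finset.sum_mul]
      _ ≤ 1 * (1 / R) := by gcongr
      _ = _ := one_mul _
  have hRH : 2 * (1 / R) ≤ c₁ * H := by
    rw [hc₁, mul_one_div, div_mul_eq_mul_div, one_mul, div_le_div_iff₀ hR (by positivity)]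
    linarith
  have hF0 : 0 ≤ F := Finset.sum_nonneg fun i _ =>
    mul_nonneg (hw i) (poissonKer_nonneg (by positivity) _)
  have hmain : ∑ p ∈ S', w p.1 * ν p.2 * (c₁ / r) ^ 2 ≤ F * N := by
    rw [hF, hN]
    unfold poissonSum
    rw [Finset.sum_mul_sum, ← Finset.sum_product']
    calc _ ≤ ∑ p ∈ S', w p.1 * poissonKer (r * ρ) (u - (x₀ p.1 + t * x₁ p.1)) *
          (ν p.2 * poissonKer (r * ρ) (u - (y₀ p.2 + t * y₁ p.2))) := by
          refine Finset.sum_le_sum fun p hp => ?_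
          obtain ⟨hρ5, hg⟩ := hgeom p hp
          have h1 : c₁ / r ≤ poissonKer (r * ρ) (u - (x₀ p.1 + t * x₁ p.1)) := by
            refine poissonKer_lower hr hρ1 hρ5 (L := L) ?_
            have := (Finset.mem_filter.1 hp).2.2
            nlinarith
          have h2 : c₁ / r ≤ poissonKer (r * ρ) (u - (y₀ p.2 + t * y₁ p.2)) := by
            refine poissonKer_lower hr hρ1 hρ5 (L := L) ?_
            have := hg (y₀ p.2 - x₀ p.1) (y₁ p.2 - x₁ p.1) (hK _ _) (by
              rw [mul_comm, sub_self, abs_zero]; exact hr.le)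
            convert this using 2
            ring
          have h3 : 0 ≤ c₁ / r := by positivity
          calc w p.1 * ν p.2 * (c₁ / r) ^ 2 = (w p.1 * (c₁ / r)) * (ν p.2 * (c₁ / r)) := by ring
            _ ≤ _ := mul_le_mul (mul_le_mul_of_nonneg_left h1 (hw _))
              (mul_le_mul_of_nonneg_left h2 (hν _)) (mul_nonneg (hν _) h3)
              (mul_nonneg (hw _) (h3.trans h1))
      _ ≤ _ := Finset.sum_le_sum_of_subset_of_nonneg (by simp) fun p _ _ =>
          mul_nonneg (mul_nonneg (hw _) (poissonKer_nonneg (by positivity) _))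
            (mul_nonneg (hν _) (poissonKer_nonneg (by positivity) _))
  have hD : N ≤ 2 * (N - N') := by linarith
  calc _ ≤ F * N := hmain
    _ ≤ F * (2 * (N - N')) := by gcongr
    _ ≤ _ := by
      have : τ * F ^ 2 + (N - N') ^ 2 / τ - F * (2 * (N - N')) =
          (τ * F - (N - N')) ^ 2 / τ := by field_simp; ring
      have h : 0 ≤ (τ * F - (N - N')) ^ 2 / τ := by positivity
      linarith

lemma integral_indicator_abs_le {r : ℝ} (hr : 0 ≤ r) (c v : ℝ) :
    ∫ u : ℝ, (if |u - c| ≤ r then v else 0) = 2 * r * v := by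
  have h : (fun u : ℝ => if |u - c| ≤ r then v else 0) =
      (Icc (c - r) (c + r)).indicator (fun _ => v) := by
    ext u
    rw [indicator_apply]
    congr 1
    rw [abs_le, mem_Icc, eq_iff_iff]
    constructor <;> rintro ⟨h1, h2⟩ <;> constructor <;> linarith
  rw [h, integral_indicator_const _ measurableSet_Icc, Real.volume_real_Icc_of_le (by linarith)]
  simp only [smul_eq_mul]
  ring

lemma integrable_indicator_abs_le (r c v : ℝ) :
    Integrable fun u : ℝ => (if |u - c| ≤ r then v else 0) := by
  have h : (fun u : ℝ => if |u - c| ≤ r then v else 0) =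
      (Icc (c - r) (c + r)).indicator (fun _ => v) := by
    ext u
    rw [indicator_apply]
    congr 1
    rw [abs_le, mem_Icc, eq_iff_iff]
    constructor <;> rintro ⟨h1, h2⟩ <;> constructor <;> linarith
  rw [h, integrable_indicator_iff measurableSet_Icc]
  exact integrableOn_const (hs := by rw [Real.volume_Icc]; exact ENNReal.ofReal_ne_top)

lemma integral_combination {f₁ f₂ f₃ f₄ : ℝ → ℝ} (h₁ : Integrable f₁) (h₂ : Integrable f₂)
    (h₃ : Integrable f₃) (h₄ : Integrable f₄) (τ : ℝ) :
    Integrable (fun u => τ * f₁ u + (f₂ u - 2 * f₃ u + f₄ u) / τ) ∧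
      ∫ u, τ * f₁ u + (f₂ u - 2 * f₃ u + f₄ u) / τ =
        τ * (∫ u, f₁ u) + ((∫ u, f₂ u) - 2 * (∫ u, f₃ u) + ∫ u, f₄ u) / τ := by
  have i3 : Integrable (fun u => f₂ u - 2 * f₃ u) := h₂.sub (h₃.const_mul 2)
  have i4 : Integrable (fun u => f₂ u - 2 * f₃ u + f₄ u) := i3.add h₄
  have i5 : Integrable (fun u => (f₂ u - 2 * f₃ u + f₄ u) / τ) := i4.div_const τ
  refine ⟨(h₁.const_mul τ).add i5, ?_⟩
  rw [integral_add (h₁.const_mul τ) i5, integral_const_mul, integral_div, integral_add i3 h₄,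
    integral_sub h₂ (h₃.const_mul 2), integral_const_mul]

open Classical in
/-- The mass of pairs `(i, k)` such that the tube of width `r` spanned by them carries mass
at least `H * r` is controlled by Riesz energies. -/
lemma heavy_mass_le {w x₀ x₁ : ι → ℝ} {ν y₀ y₁ : κ → ℝ} (hw : ∀ i, 0 ≤ w i)
    (hν : ∀ k, 0 ≤ ν k) (hν1 : ∑ k, ν k ≤ 1) {r R H K c : ℝ} (hr : 0 < r) (hr1 : r ≤ 1)
    (hR : 0 < R) (hc : 0 < c)
    (hHR : 2 * (5 + (1 + K + 1 / c) ^ 2) ≤ H * R)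
    (hK : ∀ i k, |y₁ k - x₁ i| ≤ K) (S : Finset (ι × κ))
    (hS1 : ∀ p ∈ S, |y₀ p.2 - x₀ p.1| ≤ |y₁ p.2 - x₁ p.1|)
    (hS2 : ∀ p ∈ S, c ≤ |y₁ p.2 - x₁ p.1|)
    (hS3 : ∀ p ∈ S, H * r ≤ ∑ k with |(y₀ p.2 - x₀ p.1) * (y₁ k - x₁ p.1) -
      (y₁ p.2 - x₁ p.1) * (y₀ k - x₀ p.1)| ≤ r, ν k)
    {τ : ℝ} (hτ : 0 < τ) :
    ∑ p ∈ S, w p.1 * ν p.2 ≤ 10 * (5 + (1 + K + 1 / c) ^ 2) ^ 2 *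
      (τ * rieszEnergy w x₀ x₁ (r + r) + (rieszEnergy ν y₀ y₁ (r + r) -
        2 * rieszEnergy ν y₀ y₁ (r + R) + rieszEnergy ν y₀ y₁ (R + R)) / τ) := by
  set c₁ := 1 / (5 + (1 + K + 1 / c) ^ 2) with hc₁
  have hc₁0 : 0 < c₁ := by positivity
  -- integrate in `u`
  have hu : ∀ t : ℝ, ∑ p ∈ S, (if |t - -((y₀ p.2 - x₀ p.1) / (y₁ p.2 - x₁ p.1))| ≤ r then
      w p.1 * ν p.2 * (2 * c₁ ^ 2 / r) else 0) ≤
      Real.pi * (τ * poissonEnergy w (fun i => x₀ i + t * x₁ i) ((r + r) * Real.sqrt (1 + t ^ 2)) +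
        (poissonEnergy ν (fun i => y₀ i + t * y₁ i) ((r + r) * Real.sqrt (1 + t ^ 2)) -
        2 * poissonEnergy ν (fun i => y₀ i + t * y₁ i) ((r + R) * Real.sqrt (1 + t ^ 2)) +
        poissonEnergy ν (fun i => y₀ i + t * y₁ i) ((R + R) * Real.sqrt (1 + t ^ 2))) / τ) := by
    intro t
    have hpt := heavy_pointwise hw hν hν1 hr hr1 hR hc hHR hK S hS1 hS2 hS3 hτ t
    rw [← hc₁] at hpt
    set ρ := Real.sqrt (1 + t ^ 2) with hρ
    have hρ0 : 0 < ρ := by positivity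
    set F := fun u => poissonSum w (fun i => x₀ i + t * x₁ i) (r * ρ) u with hF
    set N := fun u => poissonSum ν (fun i => y₀ i + t * y₁ i) (r * ρ) u with hN
    set N' := fun u => poissonSum ν (fun i => y₀ i + t * y₁ i) (R * ρ) u with hN'
    have iF := integrable_poissonSum_mul w (fun i => x₀ i + t * x₁ i)
      (show 0 < r * ρ by positivity) (show 0 < r * ρ by positivity)
    have i1 := integrable_poissonSum_mul ν (fun i => y₀ i + t * y₁ i)
      (show 0 < r * ρ by positivity) (show 0 < r * ρ by positivity)
    have i2 := integrable_poissonSum_mul ν (fun i => y₀ i + t * y₁ i)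
      (show 0 < r * ρ by positivity) (show 0 < R * ρ by positivity)
    have i3 := integrable_poissonSum_mul ν (fun i => y₀ i + t * y₁ i)
      (show 0 < R * ρ by positivity) (show 0 < R * ρ by positivity)
    have hcomb := integral_combination iF i1 i2 i3 τ
    have hmono := integral_mono
      (f := fun u => ∑ p ∈ S, (if |u - (x₀ p.1 + t * x₁ p.1)| ≤ r then
        (if |t - -((y₀ p.2 - x₀ p.1) / (y₁ p.2 - x₁ p.1))| ≤ r then
          w p.1 * ν p.2 * (c₁ / r) ^ 2 else 0) else 0))
      (g := fun u => τ * (F u * F u) + (N u * N u - 2 * (N u * N' u) + N' u * N' u) / τ)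
      (integrable_finsetSum _ fun p _ => integrable_indicator_abs_le _ _ _)
      hcomb.1 (by
        intro u
        refine le_trans (le_of_eq ?_) ((hpt u).trans (le_of_eq ?_))
        · simp only
          rw [Finset.sum_filter]
          refine Finset.sum_congr rfl fun p _ => ?_
          rw [sub_neg_eq_add, ite_and]
          split_ifs <;> rfl
        · simp only [hF, hN, hN']
          ring)
    rw [integral_finsetSum _ fun p _ => integrable_indicator_abs_le _ _ _] at hmono
    simp only [integral_indicator_abs_le hr.le] at hmono
    refine le_trans (le_of_eq ?_) (hmono.trans (le_of_eq ?_))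
    · refine Finset.sum_congr rfl fun p _ => ?_
      split_ifs
      · field_simp
      · simp
    · rw [hcomb.2,
        integral_poissonSum_mul _ _ (by positivity) (by positivity),
        integral_poissonSum_mul _ _ (by positivity) (by positivity),
        integral_poissonSum_mul _ _ (by positivity) (by positivity),
        integral_poissonSum_mul _ _ (by positivity) (by positivity),
        ← add_mul, ← add_mul, ← add_mul]
      ring
  -- integrate in `t`
  have j1 := integrable_poissonEnergy_div w x₀ x₁ (show 0 < r + r by positivity)
  have j2 := integrable_poissonEnergy_div ν y₀ y₁ (show 0 < r + r by positivity)
  have j3 := integrable_poissonEnergy_div ν y₀ y₁ (show 0 < r + R by positivity)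
  have j4 := integrable_poissonEnergy_div ν y₀ y₁ (show 0 < R + R by positivity)
  have hcomb := integral_combination j1 j2 j3 j4 τ
  have hmono := integral_mono
    (f := fun t => ∑ p ∈ S, (if |t - -((y₀ p.2 - x₀ p.1) / (y₁ p.2 - x₁ p.1))| ≤ r then
      w p.1 * ν p.2 * (2 * c₁ ^ 2 / r) / 3 else 0))
    (g := fun t => Real.pi * (τ * (poissonEnergy w (fun i => x₀ i + t * x₁ i)
        ((r + r) * Real.sqrt (1 + t ^ 2)) / Real.sqrt (1 + t ^ 2)) +
        (poissonEnergy ν (fun i => y₀ i + t * y₁ i) ((r + r) * Real.sqrt (1 + t ^ 2)) /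
            Real.sqrt (1 + t ^ 2) -
        2 * (poissonEnergy ν (fun i => y₀ i + t * y₁ i) ((r + R) * Real.sqrt (1 + t ^ 2)) /
            Real.sqrt (1 + t ^ 2)) +
        poissonEnergy ν (fun i => y₀ i + t * y₁ i) ((R + R) * Real.sqrt (1 + t ^ 2)) /
            Real.sqrt (1 + t ^ 2)) / τ))
    (integrable_finsetSum _ fun p _ => integrable_indicator_abs_le _ _ _)
    (hcomb.1.const_mul _) (by
      intro t
      set ρ := Real.sqrt (1 + t ^ 2) with hρ
      have hρ0 : 0 < ρ := by positivity
      have := div_le_div_of_nonneg_right (hu t) hρ0.le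
      refine le_trans ?_ (this.trans (le_of_eq ?_))
      · simp only
        rw [Finset.sum_div]
        refine Finset.sum_le_sum fun p hp => ?_
        split_ifs with hcond
        · have hz : 0 < |y₁ p.2 - x₁ p.1| := hc.trans_le (hS2 p hp)
          have hq : |(y₀ p.2 - x₀ p.1) / (y₁ p.2 - x₁ p.1)| ≤ 1 := by
            rw [abs_div, div_le_one hz]; exact hS1 p hp
          have ht : |t| ≤ 2 := by
            rw [sub_neg_eq_add] at hcond
            have := abs_sub (t + (y₀ p.2 - x₀ p.1) / (y₁ p.2 - x₁ p.1))
              ((y₀ p.2 - x₀ p.1) / (y₁ p.2 - x₁ p.1))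
            rw [add_sub_cancel_right] at this
            linarith
          have hρ3 : ρ ≤ 3 := by
            rw [hρ, Real.sqrt_le_left (by norm_num)]
            have : t ^ 2 ≤ 2 ^ 2 := sq_le_sq' (by linarith [abs_le.1 ht]) (abs_le.1 ht).2
            linarith
          have : 0 ≤ w p.1 * ν p.2 := mul_nonneg (hw _) (hν _)
          gcongr
        · simp
      · ring)
  rw [integral_finsetSum _ fun p _ => integrable_indicator_abs_le _ _ _] at hmono
  simp only [integral_indicator_abs_le hr.le] at hmono
  rw [integral_const_mul, hcomb.2,
    integral_poissonEnergy_div _ _ _ (by positivity),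
    integral_poissonEnergy_div _ _ _ (by positivity),
    integral_poissonEnergy_div _ _ _ (by positivity),
    integral_poissonEnergy_div _ _ _ (by positivity)] at hmono
  set E := τ * rieszEnergy w x₀ x₁ (r + r) + (rieszEnergy ν y₀ y₁ (r + r) -
        2 * rieszEnergy ν y₀ y₁ (r + R) + rieszEnergy ν y₀ y₁ (R + R)) / τ with hE
  have h1 : (∑ p ∈ S, w p.1 * ν p.2) * (4 * c₁ ^ 2 / 3) ≤ Real.pi ^ 2 * E := by
    refine le_trans (le_of_eq ?_) (hmono.trans (le_of_eq ?_))
    · rw [Finset.sum_mul]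
      refine Finset.sum_congr rfl fun p _ => ?_
      field_simp
      norm_num
    · rw [hE]; ring
  have h0 : 0 ≤ ∑ p ∈ S, w p.1 * ν p.2 := Finset.sum_nonneg fun p _ => mul_nonneg (hw _) (hν _)
  have hE0 : 0 ≤ E := by
    by_contra hneg
    push Not at hneg
    have : 0 ≤ (∑ p ∈ S, w p.1 * ν p.2) * (4 * c₁ ^ 2 / 3) := by positivity
    have : 0 < Real.pi ^ 2 := by positivity
    nlinarith
  have hpi : Real.pi ^ 2 ≤ 10 := by
    have := Real.pi_lt_d2
    have := Real.pi_pos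
    nlinarith
  have h2 : (5 + (1 + K + 1 / c) ^ 2) ^ 2 = 1 / c₁ ^ 2 := by
    rw [hc₁]; field_simp
  rw [h2]
  have h3 : (∑ p ∈ S, w p.1 * ν p.2) * c₁ ^ 2 ≤ 10 * E := by nlinarith
  calc _ = (∑ p ∈ S, w p.1 * ν p.2) * c₁ ^ 2 / c₁ ^ 2 := by field_simp
    _ ≤ 10 * E / c₁ ^ 2 := by gcongr
    _ = _ := by ring

end

/-- The Euclidean plane. -/
abbrev Plane := EuclideanSpace ℝ (Fin 2)

lemma Plane.dist_sq (p q : Plane) : dist p q ^ 2 = (p 0 - q 0) ^ 2 + (p 1 - q 1) ^ 2 := by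
  rw [EuclideanSpace.dist_eq, Real.sq_sqrt (by positivity), Fin.sum_univ_two, Real.dist_eq,
    Real.dist_eq, sq_abs, sq_abs]

/-- The cross product of `q - p` and `a - p`. -/
def cross (p q a : Plane) : ℝ := (q 0 - p 0) * (a 1 - p 1) - (q 1 - p 1) * (a 0 - p 0)

open Classical in
/-- A finite weighted point configuration of total mass at most `1` satisfying a Frostman condition
of exponent `t` at the scales `2 ^ (-j)` for `j ≤ N`. -/
structure IsFrostman {ι : Type*} [Fintype ι] (w : ι → ℝ) (x : ι → Plane) (C t : ℝ) (N : ℕ) :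
    Prop where
  nonneg : ∀ i, 0 ≤ w i
  sum_le : ∑ i, w i ≤ 1
  ball_le : ∀ (p : Plane) (j : ℕ), j ≤ N →
    ∑ i with dist p (x i) ≤ 2 ^ (-(j : ℝ)), w i ≤ C * 2 ^ (-(j * t))

lemma rpow_max_le {β : ℝ} (hβ : 0 < β) (d : ℝ) (J : ℕ) :
    (max d (2 ^ (-(J : ℝ)))) ^ (-β) ≤
      1 + ∑ j ∈ Finset.range (J + 1), if d ≤ 2 ^ (-(j : ℝ)) then (2 : ℝ) ^ ((j + 1) * β) else 0 := by
  have hterm : ∀ j : ℕ, 0 ≤ if d ≤ 2 ^ (-(j : ℝ)) then (2 : ℝ) ^ ((j + 1) * β) else 0 := by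
    intro j; split_ifs <;> positivity
  induction J with
  | zero =>
    have h : (max d (2 ^ (-((0 : ℕ) : ℝ)))) ^ (-β) ≤ 1 := by
      apply Real.rpow_le_one_of_one_le_of_nonpos _ (by linarith)
      simp
    exact h.trans (by simpa using hterm 0)
  | succ J ih =>
    have hbig : ∀ j : ℕ, d ≤ 2 ^ (-(j : ℝ)) → j < J + 1 + 1 → (2 : ℝ) ^ ((j + 1) * β) ≤
        1 + ∑ j ∈ Finset.range (J + 1 + 1),
          if d ≤ 2 ^ (-(j : ℝ)) then (2 : ℝ) ^ ((j + 1) * β) else 0 := by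
      intro j hj hjJ
      have := Finset.single_le_sum (fun j _ => hterm j) (Finset.mem_range.2 hjJ)
      simp only [hj, if_true] at this
      linarith
    by_cases h1 : d ≤ 2 ^ (-((J + 1 : ℕ) : ℝ))
    · rw [max_eq_right h1]
      refine le_trans ?_ (hbig (J + 1) h1 (by omega))
      rw [← Real.rpow_mul (by norm_num)]
      apply Real.rpow_le_rpow_of_exponent_le (by norm_num)
      push_cast
      nlinarith
    · push Not at h1
      rw [max_eq_left h1.le]
      by_cases h2 : d ≤ 2 ^ (-(J : ℝ))
      · refine le_trans ?_ (hbig J h2 (by omega))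
        have h3 : d ^ (-β) ≤ (2 ^ (-((J + 1 : ℕ) : ℝ))) ^ (-β) :=
          Real.rpow_le_rpow_of_nonpos (by positivity) h1.le (by linarith)
        refine h3.trans (le_of_eq ?_)
        rw [← Real.rpow_mul (by norm_num)]
        congr 1
        push_cast
        ring
      · push Not at h2
        rw [max_eq_left h2.le] at ih
        refine ih.trans ?_
        rw [Finset.sum_range_succ _ (J + 1)]
        linarith [hterm (J + 1)]

/-- A Frostman condition of exponent `t` gives bounded potentials of order `β < t`. -/
lemma IsFrostman.potential_le {ι : Type*} [Fintype ι] {w : ι → ℝ} {x : ι → Plane} {C t : ℝ}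
    {N : ℕ} (h : IsFrostman w x C t N) (hC : 0 ≤ C) {β : ℝ} (hβ : 0 < β) (hβt : β < t) (p : Plane)
    {J : ℕ} (hJ : J ≤ N) :
    ∑ i, w i * (max (dist p (x i)) (2 ^ (-(J : ℝ)))) ^ (-β) ≤
      1 + C * 2 ^ β * (1 - 2 ^ (-(t - β)))⁻¹ := by
  classical
  have hq : (2 : ℝ) ^ (-(t - β)) < 1 := Real.rpow_lt_one_of_one_lt_of_neg (by norm_num) (by linarith)
  calc _ ≤ ∑ i, w i * (1 + ∑ j ∈ Finset.range (J + 1),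
          if dist p (x i) ≤ 2 ^ (-(j : ℝ)) then (2 : ℝ) ^ ((j + 1) * β) else 0) :=
        Finset.sum_le_sum fun i _ => mul_le_mul_of_nonneg_left (rpow_max_le hβ _ J)
          (h.nonneg i)
    _ = ∑ i, w i + ∑ j ∈ Finset.range (J + 1),
          (∑ i with dist p (x i) ≤ 2 ^ (-(j : ℝ)), w i) * (2 : ℝ) ^ ((j + 1) * β) := by
        simp only [mul_add, mul_one, Finset.sum_add_distrib, Finset.mul_sum]
        congr 1
        rw [Finset.sum_comm]
        refine Finset.sum_congr rfl fun j _ => ?_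
        rw [Finset.sum_mul, Finset.sum_filter]
        refine Finset.sum_congr rfl fun i _ => ?_
        split_ifs <;> simp
    _ ≤ 1 + ∑ j ∈ Finset.range (J + 1), C * 2 ^ β * (2 ^ (-(t - β))) ^ j := by
        refine add_le_add h.sum_le (Finset.sum_le_sum fun j hj => ?_)
        have hj' : j ≤ N := by have := Finset.mem_range.1 hj; omega
        refine (mul_le_mul_of_nonneg_right (h.ball_le p j hj') (by positivity)).trans (le_of_eq ?_)
        rw [mul_assoc, mul_assoc, ← Real.rpow_natCast, ← Real.rpow_mul (by norm_num),
          ← Real.rpow_add (by norm_num), ← Real.rpow_add (by norm_num)]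
        congr 2
        ring
    _ ≤ _ := by
        rw [← Finset.mul_sum]
        gcongr
        exact (Summable.sum_le_tsum _ (fun _ _ => by positivity)
          (summable_geometric_of_lt_one (by positivity) hq)).trans
          (tsum_geometric_of_lt_one (by positivity) hq).le

lemma inv_sqrt_le_rpow {a d r : ℝ} (hr : 0 < r) (hra : r ≤ a) :
    (Real.sqrt (a ^ 2 + d ^ 2))⁻¹ ≤ (max d r) ^ (-1 : ℝ) := by
  rw [Real.rpow_neg_one]
  have h0 : 0 < max d r := lt_max_of_lt_right hr
  apply inv_anti₀ h0
  apply max_le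
  · exact Real.le_sqrt_of_sq_le (by nlinarith [sq_nonneg a])
  · exact Real.le_sqrt_of_sq_le (by nlinarith [sq_nonneg d])

lemma riesz_difference_le {r R d γ : ℝ} (hr : 0 < r) (hrR : r ≤ R)
    (hγ : 0 < γ) (hγ2 : γ ≤ 2) :
    (Real.sqrt ((r + r) ^ 2 + d ^ 2))⁻¹ - 2 * (Real.sqrt ((r + R) ^ 2 + d ^ 2))⁻¹ +
      (Real.sqrt ((R + R) ^ 2 + d ^ 2))⁻¹ ≤ 2 * R ^ γ * (max d r) ^ (-(1 + γ)) := by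
  have hR : 0 < R := hr.trans_le hrR
  have h0 : 0 < max d r := lt_max_of_lt_right hr
  set A := Real.sqrt ((r + r) ^ 2 + d ^ 2) with hA
  set B := Real.sqrt ((R + R) ^ 2 + d ^ 2) with hB
  have hA0 : 0 < A := by positivity
  have hB0 : 0 < B := by positivity
  have h1 : B⁻¹ ≤ (Real.sqrt ((r + R) ^ 2 + d ^ 2))⁻¹ := by
    apply inv_anti₀ (by positivity)
    apply Real.sqrt_le_sqrt
    gcongr
  have h2 : A⁻¹ - B⁻¹ ≤ 2 * R ^ γ * (max d r) ^ (-(1 + γ)) := by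
    rcases le_or_gt (max d r) R with hm | hm
    · have e1 : A⁻¹ ≤ (max d r) ^ (-1 : ℝ) := inv_sqrt_le_rpow hr (by linarith)
      have e2 : (max d r) ^ (-1 : ℝ) = (max d r) ^ γ * (max d r) ^ (-(1 + γ)) := by
        rw [← Real.rpow_add h0]; congr 1; ring
      have e3 : (max d r) ^ γ ≤ R ^ γ := Real.rpow_le_rpow h0.le hm hγ.le
      have e4 : 0 < B⁻¹ := by positivity
      have e5 : 0 < (max d r) ^ (-(1 + γ)) := by positivity
      have e6 : 0 < R ^ γ := by positivity
      nlinarith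
    · have hdR : R < d := by
        rcases lt_max_iff.1 hm with h | h
        · exact h
        · linarith
      have hd0 : 0 < d := by linarith
      have hmd : max d r = d := max_eq_left (by linarith)
      have hAd : d ≤ A := Real.le_sqrt_of_sq_le (by nlinarith)
      have hBd : d ≤ B := Real.le_sqrt_of_sq_le (by nlinarith)
      have hA2 : A ^ 2 = (r + r) ^ 2 + d ^ 2 := Real.sq_sqrt (by positivity)
      have hB2 : B ^ 2 = (R + R) ^ 2 + d ^ 2 := Real.sq_sqrt (by positivity)
      have e1 : A⁻¹ - B⁻¹ ≤ 2 * R ^ 2 / d ^ 3 := by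
        have : A⁻¹ - B⁻¹ = (B ^ 2 - A ^ 2) / (A * B * (A + B)) := by
          field_simp; ring
        rw [this]
        calc _ ≤ 4 * R ^ 2 / (A * B * (A + B)) := by
              gcongr; nlinarith
          _ ≤ 4 * R ^ 2 / (d * d * (d + d)) := by gcongr
          _ = _ := by field_simp; norm_num
      refine e1.trans ?_
      rw [hmd]
      have e2 : (R / d) ^ (2 - γ) ≤ 1 :=
        Real.rpow_le_one (by positivity) (by rw [div_le_one hd0]; exact hdR.le) (by linarith)
      have e3 : 2 * R ^ 2 / d ^ 3 = 2 * R ^ γ * d ^ (-(1 + γ)) * (R / d) ^ (2 - γ) := by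
        have f1 : R ^ γ * R ^ (2 - γ) = R ^ 2 := by
          rw [← Real.rpow_add hR, ← Real.rpow_natCast]
          congr 1
          push_cast; ring
        have f2 : d ^ (-(1 + γ)) / d ^ (2 - γ) = (d ^ 3)⁻¹ := by
          rw [← Real.rpow_sub hd0, ← Real.rpow_natCast, ← Real.rpow_neg hd0.le]
          congr 1
          push_cast; ring
        rw [Real.div_rpow hR.le hd0.le]
        calc _ = 2 * (R ^ γ * R ^ (2 - γ)) * (d ^ (-(1 + γ)) / d ^ (2 - γ)) := by
              rw [f1, f2, div_eq_mul_inv]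
          _ = _ := by ring
      rw [e3]
      have e4 : 0 ≤ 2 * R ^ γ * d ^ (-(1 + γ)) := by positivity
      nlinarith
  linarith

lemma rieszEnergy_eq {ι : Type*} [Fintype ι] (w : ι → ℝ) (x : ι → Plane) (a : ℝ) :
    rieszEnergy w (fun i => x i 0) (fun i => x i 1) a =
      ∑ i, ∑ j, w i * w j * (Real.sqrt (a ^ 2 + dist (x i) (x j) ^ 2))⁻¹ := by
  simp only [rieszEnergy, Plane.dist_sq]

lemma rieszEnergy_swap {ι : Type*} [Fintype ι] (w x₀ x₁ : ι → ℝ) (a : ℝ) :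
    rieszEnergy w x₁ x₀ a = rieszEnergy w x₀ x₁ a := by
  simp only [rieszEnergy]
  refine Finset.sum_congr rfl fun i _ => Finset.sum_congr rfl fun j _ => ?_
  rw [add_comm ((x₁ i - x₁ j) ^ 2)]

lemma IsFrostman.rieszEnergy_le {ι : Type*} [Fintype ι] {w : ι → ℝ} {x : ι → Plane}
    {C t : ℝ} {N : ℕ} (h : IsFrostman w x C t N) (hC : 0 ≤ C) (ht : 1 < t) {J : ℕ} (hJ : J ≤ N) :
    rieszEnergy w (fun i => x i 0) (fun i => x i 1) (2 ^ (-(J : ℝ)) + 2 ^ (-(J : ℝ))) ≤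
      1 + C * 2 ^ (1 : ℝ) * (1 - 2 ^ (-(t - 1)))⁻¹ := by
  rw [rieszEnergy_eq]
  set M := 1 + C * 2 ^ (1 : ℝ) * (1 - 2 ^ (-(t - 1)))⁻¹ with hM
  have hM0 : 0 ≤ M := by
    have hq : (2 : ℝ) ^ (-(t - 1)) < 1 := Real.rpow_lt_one_of_one_lt_of_neg (by norm_num) (by linarith)
    have : 0 ≤ (1 - (2 : ℝ) ^ (-(t - 1)))⁻¹ := inv_nonneg.2 (by linarith)
    positivity
  have h2 : (0 : ℝ) < 2 ^ (-(J : ℝ)) := by positivity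
  calc _ ≤ ∑ i, w i * ∑ j, w j * (max (dist (x i) (x j)) (2 ^ (-(J : ℝ)))) ^ (-1 : ℝ) := by
        refine Finset.sum_le_sum fun i _ => ?_
        rw [Finset.mul_sum]
        refine Finset.sum_le_sum fun j _ => ?_
        rw [mul_assoc]
        refine mul_le_mul_of_nonneg_left (mul_le_mul_of_nonneg_left ?_ (h.nonneg j)) (h.nonneg i)
        exact inv_sqrt_le_rpow h2 (by linarith)
    _ ≤ ∑ i, w i * M := Finset.sum_le_sum fun i _ =>
        mul_le_mul_of_nonneg_left (h.potential_le hC one_pos ht _ hJ) (h.nonneg i)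
    _ ≤ M := by rw [← Finset.sum_mul]; nlinarith [h.sum_le]

lemma IsFrostman.rieszEnergy_difference_le {ι : Type*} [Fintype ι] {w : ι → ℝ}
    {x : ι → Plane} {C t : ℝ} {N : ℕ} (h : IsFrostman w x C t N) (hC : 0 ≤ C) {γ : ℝ} (hγ : 0 < γ)
    (hγ2 : γ ≤ 2) (ht : 1 + γ < t) {J : ℕ} (hJ : J ≤ N) {r R : ℝ} (hr : r = 2 ^ (-(J : ℝ)))
    (hrR : r ≤ R) :
    rieszEnergy w (fun i => x i 0) (fun i => x i 1) (r + r) -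
      2 * rieszEnergy w (fun i => x i 0) (fun i => x i 1) (r + R) +
      rieszEnergy w (fun i => x i 0) (fun i => x i 1) (R + R) ≤
      2 * R ^ γ * (1 + C * 2 ^ (1 + γ) * (1 - 2 ^ (-(t - (1 + γ))))⁻¹) := by
  simp only [rieszEnergy_eq]
  set M := 1 + C * 2 ^ (1 + γ) * (1 - 2 ^ (-(t - (1 + γ))))⁻¹ with hM
  have hM0 : 0 ≤ M := by
    have hq : (2 : ℝ) ^ (-(t - (1 + γ))) < 1 :=
      Real.rpow_lt_one_of_one_lt_of_neg (by norm_num) (by linarith)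
    have : 0 ≤ (1 - (2 : ℝ) ^ (-(t - (1 + γ))))⁻¹ := inv_nonneg.2 (by linarith)
    positivity
  have h2 : 0 < r := by rw [hr]; positivity
  have hR : 0 < R := h2.trans_le hrR
  calc _ = ∑ i, ∑ j, w i * w j * ((Real.sqrt ((r + r) ^ 2 + dist (x i) (x j) ^ 2))⁻¹ -
        2 * (Real.sqrt ((r + R) ^ 2 + dist (x i) (x j) ^ 2))⁻¹ +
        (Real.sqrt ((R + R) ^ 2 + dist (x i) (x j) ^ 2))⁻¹) := by
        simp only [Finset.mul_sum, ← Finset.sum_sub_distrib, ← Finset.sum_add_distrib]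
        refine Finset.sum_congr rfl fun i _ => Finset.sum_congr rfl fun j _ => ?_
        ring
    _ ≤ ∑ i, w i * (2 * R ^ γ * ∑ j, w j * (max (dist (x i) (x j)) r) ^ (-(1 + γ))) := by
        refine Finset.sum_le_sum fun i _ => ?_
        rw [Finset.mul_sum, Finset.mul_sum]
        refine Finset.sum_le_sum fun j _ => ?_
        have := riesz_difference_le (d := dist (x i) (x j)) h2 hrR hγ hγ2
        calc _ ≤ w i * w j * _ := mul_le_mul_of_nonneg_left this (mul_nonneg (h.nonneg i) (h.nonneg j))
          _ = _ := by ring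
    _ ≤ ∑ i, w i * (2 * R ^ γ * M) := by
        refine Finset.sum_le_sum fun i _ => mul_le_mul_of_nonneg_left ?_ (h.nonneg i)
        refine mul_le_mul_of_nonneg_left ?_ (by positivity)
        rw [hr]
        exact h.potential_le hC (by linarith) ht _ hJ
    _ ≤ 2 * R ^ γ * M := by
        rw [← Finset.sum_mul]
        have : 0 ≤ 2 * R ^ γ * M := by positivity
        nlinarith [h.sum_le]

set_option maxHeartbeats 1000000 in
open Classical in
/-- Thin tubes for Frostman configurations: only few pairs span a tube which is much heavier than
its width. -/
theorem exists_heavy_mass_le {s t : ℝ} (hs : 1 < s) (ht : 1 < t) {C c K : ℝ} (hC : 0 ≤ C)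
    (hc : 0 < c) :
    ∃ C' γ : ℝ, 0 ≤ C' ∧ 0 < γ ∧ ∀ (ι κ : Type) [Fintype ι] [Fintype κ] (w : ι → ℝ) (x : ι → Plane)
      (ν : κ → ℝ) (y : κ → Plane) (N J : ℕ) (H : ℝ) (S : Finset (ι × κ)),
      IsFrostman w x C s N → IsFrostman ν y C t N → J ≤ N → 0 < H →
      (∀ i k, dist (x i) (y k) ≤ K) →
      (∀ p ∈ S, c ≤ dist (x p.1) (y p.2)) →
      (∀ p ∈ S, H * 2 ^ (-(J : ℝ)) ≤
        ∑ k with |cross (x p.1) (y p.2) (y k)| ≤ 2 ^ (-(J : ℝ)), ν k) →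
      ∑ p ∈ S, w p.1 * ν p.2 ≤ C' * H ^ (-γ) := by
  set γ := min ((t - 1) / 2) 1 with hγdef
  have hγ : 0 < γ := lt_min (by linarith) one_pos
  have hγ1 : γ ≤ 1 := min_le_right _ _
  have hγt : 1 + γ < t := by
    have : γ ≤ (t - 1) / 2 := min_le_left _ _
    linarith
  set M₁ := 1 + C * 2 ^ (1 : ℝ) * (1 - 2 ^ (-(s - 1)))⁻¹ with hM₁
  set M₂ := 1 + C * 2 ^ (1 + γ) * (1 - 2 ^ (-(t - (1 + γ))))⁻¹ with hM₂
  have hM₁0 : 0 ≤ M₁ := by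
    have hq : (2 : ℝ) ^ (-(s - 1)) < 1 := Real.rpow_lt_one_of_one_lt_of_neg (by norm_num) (by linarith)
    have : 0 ≤ (1 - (2 : ℝ) ^ (-(s - 1)))⁻¹ := inv_nonneg.2 (by linarith)
    positivity
  have hM₂0 : 0 ≤ M₂ := by
    have hq : (2 : ℝ) ^ (-(t - (1 + γ))) < 1 :=
      Real.rpow_lt_one_of_one_lt_of_neg (by norm_num) (by linarith)
    have : 0 ≤ (1 - (2 : ℝ) ^ (-(t - (1 + γ))))⁻¹ := inv_nonneg.2 (by linarith)
    positivity
  set Q := 5 + (1 + K + 1 / (c / 2)) ^ 2 with hQ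
  have hQ0 : 0 < Q := by positivity
  have hQ5 : 5 ≤ Q := by rw [hQ]; nlinarith [sq_nonneg (1 + K + 1 / (c / 2))]
  refine ⟨2 * (10 * Q ^ 2 * ((2 * Q) ^ (γ / 2) * (M₁ + 2 * M₂))), γ / 2, by positivity, by linarith,
    ?_⟩
  intro ι κ _ _ w x ν y N J H S hw hν hJ hH hK hfar hheavy
  set r : ℝ := 2 ^ (-(J : ℝ)) with hr
  have hr0 : 0 < r := by positivity
  have hr1 : r ≤ 1 := Real.rpow_le_one_of_one_le_of_nonpos (by norm_num) (by simp)
  rcases S.eq_empty_or_nonempty with he | ⟨q, hq⟩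
  · rw [he, Finset.sum_empty]; positivity
  have hHr : H * r ≤ 1 := (hheavy q hq).trans ((Finset.sum_le_sum_of_subset_of_nonneg
    (Finset.filter_subset _ _) fun k _ _ => hν.nonneg k).trans hν.sum_le)
  set R := 2 * Q / H with hR
  have hR0 : 0 < R := by positivity
  have hrR : r ≤ R := by
    rw [hR, le_div_iff₀ hH]; linarith
  have hHR : 2 * Q ≤ H * R := by rw [hR]; field_simp; exact le_rfl
  have hτ : 0 < R ^ (γ / 2) := by positivity
  have e1 := hw.rieszEnergy_le hC hs hJ
  have e2 := hν.rieszEnergy_difference_le hC hγ (by linarith) hγt hJ hr hrR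
  rw [← hr, ← hM₁] at e1
  rw [← hM₂] at e2
  have hRγ : R ^ γ = R ^ (γ / 2) * R ^ (γ / 2) := by
    rw [← Real.rpow_add hR0]; congr 1; ring
  have hbound : R ^ (γ / 2) * rieszEnergy w (fun i => x i 0) (fun i => x i 1) (r + r) +
      (rieszEnergy ν (fun i => y i 0) (fun i => y i 1) (r + r) -
      2 * rieszEnergy ν (fun i => y i 0) (fun i => y i 1) (r + R) +
      rieszEnergy ν (fun i => y i 0) (fun i => y i 1) (R + R)) / R ^ (γ / 2) ≤
      (2 * Q) ^ (γ / 2) * (M₁ + 2 * M₂) * H ^ (-(γ / 2)) := by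
    have h1 : R ^ (γ / 2) = (2 * Q) ^ (γ / 2) * H ^ (-(γ / 2)) := by
      rw [hR, Real.div_rpow (by positivity) hH.le, Real.rpow_neg hH.le, div_eq_mul_inv]
    have h2 : (2 * R ^ γ * M₂) / R ^ (γ / 2) = R ^ (γ / 2) * (2 * M₂) := by
      rw [hRγ]; field_simp
    calc _ ≤ R ^ (γ / 2) * M₁ + (2 * R ^ γ * M₂) / R ^ (γ / 2) := by gcongr
      _ = R ^ (γ / 2) * (M₁ + 2 * M₂) := by rw [h2]; ring
      _ = _ := by rw [h1]; ring
  have hcoord : ∀ (i : ι) (k : κ), |y k 0 - x i 0| ≤ K ∧ |y k 1 - x i 1| ≤ K := by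
    intro i k
    have h1 := Plane.dist_sq (x i) (y k)
    have h2 := hK i k
    have h3 : 0 ≤ K := dist_nonneg.trans h2
    have h4 : dist (x i) (y k) ^ 2 ≤ K ^ 2 := by gcongr
    rw [h1, ← neg_sub, neg_sq, ← neg_sub (y k 1), neg_sq] at h4
    have h5 := sq_nonneg (y k 0 - x i 0)
    have h6 := sq_nonneg (y k 1 - x i 1)
    exact ⟨abs_le_of_sq_le_sq (by linarith) h3, abs_le_of_sq_le_sq (by linarith) h3⟩
  have hsplit := Finset.sum_filter_add_sum_filter_not S
    (fun p => |y p.2 0 - x p.1 0| ≤ |y p.2 1 - x p.1 1|) (fun p => w p.1 * ν p.2)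
  have hfar' : ∀ p ∈ S, c / 2 ≤ max |y p.2 0 - x p.1 0| |y p.2 1 - x p.1 1| := by
    intro p hp
    by_contra! hlt
    obtain ⟨h1, h2⟩ := max_lt_iff.1 hlt
    have h3 := Plane.dist_sq (x p.1) (y p.2)
    have h4 := hfar p hp
    have h5 : (y p.2 0 - x p.1 0) ^ 2 < (c / 2) ^ 2 := by rw [← sq_abs]; gcongr
    have h6 : (y p.2 1 - x p.1 1) ^ 2 < (c / 2) ^ 2 := by rw [← sq_abs]; gcongr
    have h7 : c ^ 2 ≤ dist (x p.1) (y p.2) ^ 2 := by gcongr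
    have h8 : 0 < c ^ 2 := by positivity
    rw [h3, ← neg_sub, neg_sq, ← neg_sub (y p.2 1), neg_sq] at h7
    linarith
  have k1 := heavy_mass_le (x₀ := fun i => x i 0) (x₁ := fun i => x i 1) (y₀ := fun i => y i 0)
    (y₁ := fun i => y i 1) hw.nonneg hν.nonneg hν.sum_le hr0 hr1 hR0 (half_pos hc) hHR
    (fun i k => (hcoord i k).2) (S.filter (fun p => |y p.2 0 - x p.1 0| ≤ |y p.2 1 - x p.1 1|))
    (fun p hp => (Finset.mem_filter.1 hp).2)
    (fun p hp => by
      have := hfar' p (Finset.mem_filter.1 hp).1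
      rwa [max_eq_right (Finset.mem_filter.1 hp).2] at this)
    (fun p hp => hheavy p (Finset.mem_filter.1 hp).1) hτ
  have k2 := heavy_mass_le (x₀ := fun i => x i 1) (x₁ := fun i => x i 0) (y₀ := fun i => y i 1)
    (y₁ := fun i => y i 0) hw.nonneg hν.nonneg hν.sum_le hr0 hr1 hR0 (half_pos hc) hHR
    (fun i k => (hcoord i k).1) (S.filter (fun p => ¬ |y p.2 0 - x p.1 0| ≤ |y p.2 1 - x p.1 1|))
    (fun p hp => (not_le.1 (Finset.mem_filter.1 hp).2).le)
    (fun p hp => by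
      have := hfar' p (Finset.mem_filter.1 hp).1
      rwa [max_eq_left (not_le.1 (Finset.mem_filter.1 hp).2).le] at this)
    (fun p hp => by
      refine (hheavy p (Finset.mem_filter.1 hp).1).trans (le_of_eq ?_)
      refine Finset.sum_congr (Finset.filter_congr fun k _ => ?_) fun _ _ => rfl
      rw [cross, abs_sub_comm]) hτ
  rw [rieszEnergy_swap w (fun i => x i 0), rieszEnergy_swap ν (fun k => y k 0) (fun k => y k 1) (r + r),
    rieszEnergy_swap ν (fun k => y k 0) (fun k => y k 1) (r + R),
    rieszEnergy_swap ν (fun k => y k 0) (fun k => y k 1) (R + R)] at k2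
  rw [← hQ] at k1 k2
  have h10 : 0 ≤ 10 * Q ^ 2 := by positivity
  have hb := mul_le_mul_of_nonneg_left hbound h10
  rw [← hsplit]
  refine (add_le_add (k1.trans hb) (k2.trans hb)).trans (le_of_eq ?_)
  ring

open Classical in
/-- Points whose fibre of `q` inside `Z` carries only a small proportion of the fibre have small
total mass. -/
lemma sum_light_le {ι β : Type*} [Fintype ι] {w : ι → ℝ} (hw : ∀ i, 0 ≤ w i) (hw1 : ∑ i, w i ≤ 1)
    (q : ι → β) (Z : Finset ι) {ε : ℝ} (hε : 0 ≤ ε) :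
    ∑ i ∈ Z with ¬ ε * ∑ j with q j = q i, w j ≤ ∑ j ∈ Z with q j = q i, w j, w i ≤ ε := by
  set Y := Z.filter fun i => ¬ ε * ∑ j with q j = q i, w j ≤ ∑ j ∈ Z with q j = q i, w j
  have hfib : ∑ i ∈ Y, w i = ∑ c ∈ Y.image q, ∑ i ∈ Y with q i = c, w i :=
    (Finset.sum_fiberwise_of_maps_to (fun i hi => Finset.mem_image_of_mem q hi) w).symm
  rw [hfib]
  calc _ ≤ ∑ c ∈ Y.image q, ε * ∑ i with q i = c, w i := by
        refine Finset.sum_le_sum fun c hc => ?_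
        obtain ⟨i, hi, rfl⟩ := Finset.mem_image.1 hc
        refine le_trans ?_ (not_le.1 (Finset.mem_filter.1 hi).2).le
        exact Finset.sum_le_sum_of_subset_of_nonneg
          (Finset.filter_subset_filter _ (Finset.filter_subset _ _)) fun j _ _ => hw j
    _ = ε * ∑ c ∈ Y.image q, ∑ i with q i = c, w i := by rw [Finset.mul_sum]
    _ ≤ ε * ∑ c ∈ Finset.univ.image q, ∑ i with q i = c, w i := by
        refine mul_le_mul_of_nonneg_left ?_ hε
        exact Finset.sum_le_sum_of_subset_of_nonneg
          (Finset.image_subset_image (Finset.subset_univ _))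
          fun c _ _ => Finset.sum_nonneg fun j _ => hw j
    _ = ε * ∑ i, w i := by
        rw [Finset.sum_fiberwise_of_maps_to (fun i hi => Finset.mem_image_of_mem q hi) w]
    _ ≤ ε := by nlinarith

open Classical in
/-- Along a scale chain, a set of points whose distances have small local correlations has
many different distances. -/
theorem ScaleChainN.le_card {ι β : Type*} [Fintype ι] {w : ι → ℝ} (hw : ∀ i, 0 ≤ w i)
    (hw1 : ∑ i, w i ≤ 1) (q : ℕ → ι → β) (D : ι → ℝ) {M m : ℕ} (hM : 3 ≤ M) {p : ℕ → ℝ}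
    (G : Finset ι)
    (hq : ∀ a i j, q a i = q a j → |D i - D j| ≤ 2 * 2 ^ (-((a : ℝ) * M)))
    (hW : ∀ i ∈ G, ∀ a ≤ m, 2 ^ (-(M * (p a + 1))) ≤ ∑ j with q a j = q a i, w j)
    (he : ∀ i ∈ G, ∀ a b : ℕ, ∀ d : ℝ, a < b → b ≤ 2 * a → b ≤ m →
      (∀ k : ℕ, a ≤ k → k ≤ b → p a - a - d ≤ p k - k) →
      ∑ j ∈ G with q a j = q a i ∧ |D i - D j| ≤ 2 ^ (-((b : ℝ) * M)), w j ≤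
        2 ^ (4 * M - M * (p a - a - d + b)))
    {n b : ℕ} {l : ℝ} (H : ScaleChainN (fun k => p k - k) n b l) (hb : b ≤ m)
    (Z : Finset ι) (hZG : Z ⊆ G) (hZ : n * 2 ^ (-(M : ℝ)) < ∑ i ∈ Z, w i) :
    (2 : ℝ) ^ (M * (b - 1 - l - 7 * n)) ≤ (Z.image fun i => ⌊(2 : ℝ) ^ ((b : ℝ) * M) * D i⌋).card := by
  induction H generalizing Z with
  | base =>
    have hne : Z.Nonempty := by
      rw [Finset.nonempty_iff_ne_empty]
      rintro rfl
      simp at hZ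
    have : 1 ≤ (Z.image fun i => ⌊(2 : ℝ) ^ (((1 : ℕ) : ℝ) * M) * D i⌋).card :=
      Finset.card_pos.2 (hne.image _)
    have h1 : (2 : ℝ) ^ ((M : ℝ) * ((1 : ℕ) - 1 - 0 - 7 * (0 : ℕ))) = 1 := by
      norm_num
    rw [h1]
    exact_mod_cast this
  | @step n a b l d H hab hb2 hd hk ih =>
    set ε : ℝ := 2 ^ (-(M : ℝ)) with hε
    have hε0 : 0 < ε := by positivity
    set Z' := Z.filter fun i => ε * ∑ j with q a j = q a i, w j ≤ ∑ j ∈ Z with q a j = q a i, w j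
      with hZ'
    have hsplit := Finset.sum_filter_add_sum_filter_not Z
      (fun i => ε * ∑ j with q a j = q a i, w j ≤ ∑ j ∈ Z with q a j = q a i, w j) w
    have hlight := sum_light_le hw hw1 (q a) Z hε0.le
    have hZ'big : n * ε < ∑ i ∈ Z', w i := by
      rw [hZ']
      push_cast at hZ
      linarith
    have hih := ih (hab.le.trans hb) Z' ((Finset.filter_subset _ _).trans hZG) hZ'big
    set fa : ι → ℤ := fun i => ⌊(2 : ℝ) ^ ((a : ℝ) * M) * D i⌋ with hfa
    set fb : ι → ℤ := fun i => ⌊(2 : ℝ) ^ ((b : ℝ) * M) * D i⌋ with hfb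
    have hsel : ∀ u : ℤ, ∃ i, u ∈ Z'.image fa → i ∈ Z' ∧ fa i = u := by
      intro u
      by_cases hu : u ∈ Z'.image fa
      · obtain ⟨i, hi, h⟩ := Finset.mem_image.1 hu
        exact ⟨i, fun _ => ⟨hi, h⟩⟩
      · obtain ⟨i, hi⟩ : Z.Nonempty := by
          rw [Finset.nonempty_iff_ne_empty]
          rintro rfl
          rw [Finset.sum_empty] at hZ
          have : 0 ≤ ((n + 1 : ℕ) : ℝ) * ε := by positivity
          linarith
        exact ⟨i, fun h => absurd h hu⟩
    choose rep hrep using hsel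
    set V := Z.image fb with hV
    have hpa : (0 : ℝ) < 2 ^ ((a : ℝ) * M) := by positivity
    have hpb : (0 : ℝ) < 2 ^ ((b : ℝ) * M) := by positivity
    have hpaI : (2 : ℝ) ^ (-((a : ℝ) * M)) * 2 ^ ((a : ℝ) * M) = 1 := by
      rw [← Real.rpow_add (by norm_num)]; simp
    have hpbI : (2 : ℝ) ^ (-((b : ℝ) * M)) * 2 ^ ((b : ℝ) * M) = 1 := by
      rw [← Real.rpow_add (by norm_num)]; simp
    have hbab : (2 : ℝ) ^ ((a : ℝ) * M) ≤ 2 ^ ((b : ℝ) * M) := by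
      apply Real.rpow_le_rpow_of_exponent_le (by norm_num)
      have : (a : ℝ) ≤ b := by exact_mod_cast hab.le
      gcongr
    have hcard : (((Z'.image fa).card : ℕ) : ℝ) * 2 ^ (M * ((b : ℝ) - a - d - 6)) ≤ V.card * 8 := by
      have := Finset.card_nsmul_le_card_nsmul (R := ℝ) (s := Z'.image fa) (t := V)
        (m := 2 ^ (M * ((b : ℝ) - a - d - 6))) (n := 8)
        (fun u v => ∃ i ∈ Z, q a i = q a (rep u) ∧ fb i = v) ?_ ?_
      · simpa [nsmul_eq_mul] using this
      · intro u hu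
        obtain ⟨h1, h2⟩ := hrep u hu
        rw [hZ', Finset.mem_filter] at h1
        set Q := Z.filter fun j => q a j = q a (rep u) with hQ
        have hQV : Q.image fb ⊆ V.bipartiteAbove
            (fun u v => ∃ i ∈ Z, q a i = q a (rep u) ∧ fb i = v) u := by
          intro v hv
          obtain ⟨i, hi, rfl⟩ := Finset.mem_image.1 hv
          rw [hQ, Finset.mem_filter] at hi
          exact (Finset.mem_bipartiteAbove _).2 ⟨Finset.mem_image_of_mem _ hi.1, i, hi.1, hi.2, rfl⟩
        have hmass : ∑ j ∈ Q, w j ≤ (Q.image fb).card * 2 ^ (4 * M - M * (p a - a - d + b)) := by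
          rw [← Finset.sum_fiberwise_of_maps_to (fun i hi => Finset.mem_image_of_mem fb hi) w,
            ← nsmul_eq_mul]
          refine Finset.sum_le_card_nsmul _ _ _ fun v hv => ?_
          obtain ⟨i, hi, rfl⟩ := Finset.mem_image.1 hv
          rw [hQ, Finset.mem_filter] at hi
          refine le_trans ?_ (he i (hZG hi.1) a b d hab hb2 hb hk)
          refine Finset.sum_le_sum_of_subset_of_nonneg ?_ fun j _ _ => hw j
          intro j hj
          simp only [hQ, Finset.mem_filter] at hj ⊢
          refine ⟨hZG hj.1.1, hj.1.2.trans hi.2.symm, ?_⟩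
          have := Int.abs_sub_lt_one_of_floor_eq_floor hj.2.symm
          rw [← mul_sub, abs_mul, abs_of_pos hpb] at this
          nlinarith [abs_nonneg (D i - D j)]
        have hlow : ε * 2 ^ (-(M * (p a + 1))) ≤ ∑ j ∈ Q, w j :=
          (mul_le_mul_of_nonneg_left (hW _ (hZG h1.1) a (hab.le.trans hb)) hε0.le).trans h1.2
        have hc1 : ((Q.image fb).card : ℝ) ≤ (V.bipartiteAbove
            (fun u v => ∃ i ∈ Z, q a i = q a (rep u) ∧ fb i = v) u).card := by
          exact_mod_cast Finset.card_le_card hQV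
        refine le_trans ?_ hc1
        have h3 := hlow.trans hmass
        have h4 : (2 : ℝ) ^ (M * ((b : ℝ) - a - d - 6)) * 2 ^ (4 * M - M * (p a - a - d + b)) =
            ε * 2 ^ (-(M * (p a + 1))) := by
          rw [hε, ← Real.rpow_add (by norm_num), ← Real.rpow_add (by norm_num)]
          congr 1; ring
        rw [← h4] at h3
        exact le_of_mul_le_mul_right h3 (by positivity)
      · intro v hv
        set z : ℝ := v / 2 ^ ((b : ℝ) * M) * 2 ^ ((a : ℝ) * M) with hz
        have hsub : (Z'.image fa).bipartiteBelow
            (fun u v => ∃ i ∈ Z, q a i = q a (rep u) ∧ fb i = v) v ⊆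
            Finset.Ico (⌊z⌋ - 3) (⌊z⌋ + 5) := by
          intro u hu
          obtain ⟨hu1, i, hi, hqi, hfi⟩ := (Finset.mem_bipartiteBelow _).1 hu
          obtain ⟨h1, h2⟩ := hrep u hu1
          have h3 := hq a _ _ hqi
          have h5 : |(2 : ℝ) ^ ((a : ℝ) * M) * D i - 2 ^ ((a : ℝ) * M) * D (rep u)| ≤ 2 := by
            rw [← mul_sub, abs_mul, abs_of_pos hpa]
            nlinarith
          have hvl : (v : ℝ) ≤ 2 ^ ((b : ℝ) * M) * D i := by rw [← hfi]; exact Int.floor_le _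
          have hvu : 2 ^ ((b : ℝ) * M) * D i < v + 1 := by rw [← hfi]; exact Int.lt_floor_add_one _
          have hzl : z ≤ 2 ^ ((a : ℝ) * M) * D i := by
            rw [hz, mul_comm]
            refine mul_le_mul_of_nonneg_left ?_ hpa.le
            rw [div_le_iff₀ hpb]; linarith
          have hzu : 2 ^ ((a : ℝ) * M) * D i ≤ z + 1 := by
            have : D i ≤ (v + 1) / 2 ^ ((b : ℝ) * M) := by rw [le_div_iff₀ hpb]; linarith
            have h6 := mul_le_mul_of_nonneg_left this hpa.le
            have h7 : 2 ^ ((a : ℝ) * M) * ((v + 1) / 2 ^ ((b : ℝ) * M)) =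
                z + 2 ^ ((a : ℝ) * M) / 2 ^ ((b : ℝ) * M) := by rw [hz]; ring
            have h8 : (2 : ℝ) ^ ((a : ℝ) * M) / 2 ^ ((b : ℝ) * M) ≤ 1 := (div_le_one hpb).2 hbab
            linarith
          obtain ⟨h5a, h5b⟩ := abs_le.1 h5
          have hul : (u : ℝ) ≤ 2 ^ ((a : ℝ) * M) * D (rep u) := by
            conv_lhs => rw [← h2]
            exact Int.floor_le _
          have huu : 2 ^ ((a : ℝ) * M) * D (rep u) < u + 1 := by
            conv_rhs => rw [← h2]
            exact Int.lt_floor_add_one _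
          have hfl := Int.floor_le z
          have hfu := Int.lt_floor_add_one z
          rw [Finset.mem_Ico]
          constructor
          · have : (⌊z⌋ : ℝ) - 3 < u + 1 := by linarith
            have : ⌊z⌋ - 3 < u + 1 := by exact_mod_cast this
            omega
          · have : (u : ℝ) < ⌊z⌋ + 5 := by linarith
            exact_mod_cast this
        have := Finset.card_le_card hsub
        rw [Int.card_Ico] at this
        have h8 : (⌊z⌋ + 5 - (⌊z⌋ - 3)).toNat = 8 := by
          have : ⌊z⌋ + 5 - (⌊z⌋ - 3) = 8 := by ring
          rw [this]; rfl
        rw [h8] at this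
        exact_mod_cast this
    have hM8 : (8 : ℝ) ≤ 2 ^ (M : ℝ) := by
      have : (8 : ℝ) = 2 ^ (3 : ℝ) := by norm_num
      rw [this]
      exact Real.rpow_le_rpow_of_exponent_le (by norm_num) (by exact_mod_cast hM)
    have hmain : (2 : ℝ) ^ (M * ((a : ℝ) - 1 - l - 7 * n)) * 2 ^ (M * ((b : ℝ) - a - d - 6)) ≤
        V.card * 2 ^ (M : ℝ) :=
      ((mul_le_mul_of_nonneg_right hih (by positivity)).trans hcard).trans
        (mul_le_mul_of_nonneg_left hM8 (by positivity))
    have h9 : (2 : ℝ) ^ (M * ((a : ℝ) - 1 - l - 7 * n)) * 2 ^ (M * ((b : ℝ) - a - d - 6)) =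
        2 ^ (M * ((b : ℝ) - 1 - (l + d) - 7 * ((n + 1 : ℕ) : ℝ))) * 2 ^ (M : ℝ) := by
      rw [← Real.rpow_add (by norm_num), ← Real.rpow_add (by norm_num)]
      congr 1; push_cast; ring
    rw [h9] at hmain
    exact le_of_mul_le_mul_right hmain (by positivity)

/-- The dyadic cell of level `n` containing a point of the plane. -/
noncomputable def Plane.cell (n : ℕ) (p : Plane) : ℤ × ℤ := (⌊(2 : ℝ) ^ n * p 0⌋, ⌊(2 : ℝ) ^ n * p 1⌋)

lemma Plane.abs_coord_sub_le (p q : Plane) (i : Fin 2) : |p i - q i| ≤ dist p q := by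
  have h := Plane.dist_sq p q
  have h0 := sq_nonneg (p 0 - q 0)
  have h1 := sq_nonneg (p 1 - q 1)
  refine abs_le_of_sq_le_sq ?_ dist_nonneg
  fin_cases i
  · show (p 0 - q 0) ^ 2 ≤ _
    linarith
  · show (p 1 - q 1) ^ 2 ≤ _
    linarith

lemma two_rpow_neg_mul_pow (n : ℕ) : (2 : ℝ) ^ (-(n : ℝ)) * 2 ^ n = 1 := by
  rw [Real.rpow_neg (by norm_num), Real.rpow_natCast, inv_mul_cancel₀ (by positivity)]

lemma Plane.dist_le_of_cell_eq {n : ℕ} {p q : Plane} (h : p.cell n = q.cell n) :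
    dist p q ≤ 2 * 2 ^ (-(n : ℝ)) := by
  have h0 := Int.abs_sub_lt_one_of_floor_eq_floor (congrArg Prod.fst h)
  have h1 := Int.abs_sub_lt_one_of_floor_eq_floor (congrArg Prod.snd h)
  rw [← mul_sub, abs_mul, abs_of_pos (by positivity)] at h0 h1
  have hI := two_rpow_neg_mul_pow n
  have hpos : (0 : ℝ) < 2 ^ (-(n : ℝ)) := by positivity
  have hposn : (0 : ℝ) < 2 ^ n := by positivity
  set e : ℝ := 2 ^ (-(n : ℝ))
  have h0' : |p 0 - q 0| ≤ e := by nlinarith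
  have h1' : |p 1 - q 1| ≤ e := by nlinarith
  refine abs_le_of_sq_le_sq' ?_ (by positivity) |>.2
  rw [Plane.dist_sq, ← sq_abs (p 0 - q 0), ← sq_abs (p 1 - q 1)]
  nlinarith [abs_nonneg (p 0 - q 0), abs_nonneg (p 1 - q 1)]

lemma floor_mem_Icc {u v : ℝ} (h : |u - v| ≤ 2) : ⌊v⌋ ∈ Finset.Icc (⌊u⌋ - 2) (⌊u⌋ + 2) := by
  obtain ⟨h1, h2⟩ := abs_le.1 h
  have a1 := Int.floor_le u
  have a2 := Int.lt_floor_add_one u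
  have a3 := Int.floor_le v
  have a4 := Int.lt_floor_add_one v
  rw [Finset.mem_Icc]
  constructor
  · have : ((⌊u⌋ - 2 : ℤ) : ℝ) < ⌊v⌋ + 1 := by push_cast; linarith
    have : ⌊u⌋ - 2 < ⌊v⌋ + 1 := by exact_mod_cast this
    omega
  · have : ((⌊v⌋ : ℤ) : ℝ) < ((⌊u⌋ + 3 : ℤ) : ℝ) := by push_cast; linarith
    have : ⌊v⌋ < ⌊u⌋ + 3 := by exact_mod_cast this
    omega

/-- A ball of radius comparable to the side length meets boundedly many cells. -/
lemma Plane.exists_cells (n : ℕ) (p : Plane) : ∃ T : Finset (ℤ × ℤ), T.card ≤ 25 ∧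
    ∀ q : Plane, dist p q ≤ 2 * 2 ^ (-(n : ℝ)) → q.cell n ∈ T := by
  refine ⟨Finset.Icc ((p.cell n).1 - 2) ((p.cell n).1 + 2) ×ˢ
    Finset.Icc ((p.cell n).2 - 2) ((p.cell n).2 + 2), ?_, fun q hq => ?_⟩
  · rw [Finset.card_product, Int.card_Icc, Int.card_Icc]
    have h1 : ∀ z : ℤ, z + 2 + 1 - (z - 2) = 5 := fun z => by ring
    rw [h1, h1]
    decide
  · have hI := two_rpow_neg_mul_pow n
    have hposn : (0 : ℝ) < 2 ^ n := by positivity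
    have key : ∀ i, |(2 : ℝ) ^ n * p i - 2 ^ n * q i| ≤ 2 := by
      intro i
      rw [← mul_sub, abs_mul, abs_of_pos hposn]
      have := (Plane.abs_coord_sub_le p q i).trans hq
      nlinarith
    exact Finset.mem_product.2 ⟨floor_mem_Icc (key 0), floor_mem_Icc (key 1)⟩

open Classical in
/-- A ball has small mass inside a family of points lying in light cells. -/
lemma sum_ball_le {ι : Type*} [Fintype ι] {w : ι → ℝ} (hw : ∀ i, 0 ≤ w i) (x : ι → Plane)
    (X : Finset ι) (n : ℕ) {B : ℝ} (hB : 0 ≤ B)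
    (hX : ∀ i ∈ X, ∑ j with (x j).cell n = (x i).cell n, w j ≤ B) (p : Plane) :
    ∑ j ∈ X with dist p (x j) ≤ 2 * 2 ^ (-(n : ℝ)), w j ≤ 25 * B := by
  obtain ⟨T, hT, hTm⟩ := Plane.exists_cells n p
  rw [← Finset.sum_fiberwise_of_maps_to (t := T) (g := fun j => (x j).cell n)
    (fun j hj => hTm _ (Finset.mem_filter.1 hj).2)]
  calc _ ≤ ∑ c ∈ T, B := by
        refine Finset.sum_le_sum fun c _ => ?_
        rcases (Finset.filter (fun i => (x i).cell n = c)
          (X.filter fun j => dist p (x j) ≤ 2 * 2 ^ (-(n : ℝ)))).eq_empty_or_nonempty with he | ⟨i, hi⟩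
        · rw [he, Finset.sum_empty]; exact hB
        · simp only [Finset.mem_filter] at hi
          refine le_trans ?_ (hX i hi.1.1)
          rw [hi.2]
          refine Finset.sum_le_sum_of_subset_of_nonneg ?_ fun j _ _ => hw j
          intro j hj
          simp only [Finset.mem_filter, Finset.mem_univ, true_and] at hj ⊢
          exact hj.2
    _ = T.card * B := by rw [Finset.sum_const, nsmul_eq_mul]
    _ ≤ 25 * B := by
        have : (T.card : ℝ) ≤ 25 := by exact_mod_cast hT
        gcongr

/-- Two pins for which `x` and `x'` are almost equidistant span a thin tube with `x`. -/
lemma abs_cross_mul_dist_le {x x' y₀ y : Plane} {R τ : ℝ} (hτ : 0 ≤ τ)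
    (h0 : |dist x y₀ - dist x' y₀| ≤ τ) (h : |dist x y - dist x' y| ≤ τ)
    (hd : dist x x' ^ 2 ≤ 4 * τ) (hR0 : dist x y₀ ≤ R) (hR0' : dist x' y₀ ≤ R)
    (hR : dist x y ≤ R) (hR' : dist x' y ≤ R) :
    |cross x y₀ y| * dist x x' ≤ 2 * R * (R + 2) * τ := by
  have hRn : 0 ≤ R := dist_nonneg.trans hR
  have hin : ∀ z : Plane, |dist x z - dist x' z| ≤ τ → dist x z ≤ R → dist x' z ≤ R →
      |(z 0 - x 0) * (x' 0 - x 0) + (z 1 - x 1) * (x' 1 - x 1)| ≤ (R + 2) * τ := by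
    intro z h1 h2 h3
    have e1 := Plane.dist_sq x z
    have e2 := Plane.dist_sq x' z
    have e3 := Plane.dist_sq x x'
    have e4 : 2 * ((z 0 - x 0) * (x' 0 - x 0) + (z 1 - x 1) * (x' 1 - x 1)) =
        (dist x z - dist x' z) * (dist x z + dist x' z) + dist x x' ^ 2 := by
      linear_combination -e1 + e2 - e3
    have e5 : |(dist x z - dist x' z) * (dist x z + dist x' z)| ≤ τ * (2 * R) := by
      rw [abs_mul, abs_of_nonneg (add_nonneg dist_nonneg dist_nonneg)]
      gcongr
      linarith
    have e6 := abs_le.1 e5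
    rw [abs_le]
    constructor <;> nlinarith [sq_nonneg (dist x x')]
  have hcr : ∀ z : Plane, dist x z ≤ R →
      |(x' 0 - x 0) * (z 1 - x 1) - (x' 1 - x 1) * (z 0 - x 0)| ≤ dist x x' * R := by
    intro z h2
    have e1 := Plane.dist_sq x z
    have e3 := Plane.dist_sq x x'
    refine (abs_le_of_sq_le_sq (b := dist x x' * dist x z) ?_ (by positivity)).trans (by gcongr)
    rw [mul_pow, e1, e3]
    nlinarith [sq_nonneg ((x' 0 - x 0) * (z 0 - x 0) + (x' 1 - x 1) * (z 1 - x 1))]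
  have a1 := hin y₀ h0 hR0 hR0'
  have a2 := hin y h hR hR'
  have b1 := hcr y₀ hR0
  have b2 := hcr y hR
  have e3 := Plane.dist_sq x x'
  set d := dist x x' with hdd
  have hd0 : 0 ≤ d := dist_nonneg
  rcases hd0.eq_or_lt with hz | hpos
  · rw [← hz, mul_zero]; positivity
  have hid : cross x y₀ y * d ^ 2 =
      ((y₀ 0 - x 0) * (x' 0 - x 0) + (y₀ 1 - x 1) * (x' 1 - x 1)) *
        ((x' 0 - x 0) * (y 1 - x 1) - (x' 1 - x 1) * (y 0 - x 0)) -
      ((y 0 - x 0) * (x' 0 - x 0) + (y 1 - x 1) * (x' 1 - x 1)) *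
        ((x' 0 - x 0) * (y₀ 1 - x 1) - (x' 1 - x 1) * (y₀ 0 - x 0)) := by
    rw [e3, cross]; ring
  have h5 : |cross x y₀ y * d ^ 2| ≤ (R + 2) * τ * (d * R) + (R + 2) * τ * (d * R) := by
    rw [hid]
    refine (abs_sub _ _).trans ?_
    rw [abs_mul, abs_mul]
    gcongr
  rw [abs_mul, abs_of_nonneg (sq_nonneg d)] at h5
  nlinarith

open Classical in
/-- The pins of good pairs which almost equidistribute a given pair of points have small mass. -/
lemma sum_equidistant_le {κ : Type*} [Fintype κ] {ν : κ → ℝ} (hν : ∀ k, 0 ≤ ν k)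
    (hν1 : ∑ k, ν k ≤ 1) (y : κ → Plane) {x x' : Plane} {R : ℝ} {c N M a b : ℕ}
    (hRc : R * (R + 2) ≤ 2 ^ (c : ℝ)) (V : Finset κ)
    (hR : ∀ k, dist x (y k) ≤ R) (hR' : ∀ k, dist x' (y k) ≤ R)
    (hgood : ∀ k ∈ V, ∀ j ≤ N, ∑ l with |cross x (y k) (y l)| ≤ 2 ^ (-(j : ℝ)), ν l ≤
      2 ^ (M : ℝ) * 2 ^ (-(j : ℝ)))
    (hV : ∀ k ∈ V, |dist x (y k) - dist x' (y k)| ≤ 2 ^ (-((b : ℝ) * M)))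
    (hab : a ≤ b) (hb2 : b ≤ 2 * a) (hbN : b * M ≤ N)
    (hd : dist x x' ≤ 2 * 2 ^ (-((a : ℝ) * M))) :
    ∑ k ∈ V, ν k ≤ ∑ k ∈ Finset.Icc a b,
      if dist x x' ≤ 2 * 2 ^ (-((k : ℝ) * M)) then (2 : ℝ) ^ (2 * (M : ℝ) + c - (b - k) * M) else 0 := by
  obtain ⟨k, hk, hkd, hkmax⟩ : ∃ k ∈ Finset.Icc a b, dist x x' ≤ 2 * 2 ^ (-((k : ℝ) * M)) ∧
      (k = b ∨ 2 * 2 ^ (-(((k : ℝ) + 1) * M)) < dist x x') := by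
    obtain ⟨k, hk, hkm⟩ := Finset.exists_max_image ((Finset.Icc a b).filter
      fun k : ℕ => dist x x' ≤ 2 * 2 ^ (-((k : ℝ) * M))) id ⟨a, by simp [hab, hd]⟩
    rw [Finset.mem_filter] at hk
    refine ⟨k, hk.1, hk.2, ?_⟩
    by_contra! hcon
    have hkb := (Finset.mem_Icc.1 hk.1)
    have := hkm (k + 1) (Finset.mem_filter.2 ⟨Finset.mem_Icc.2 ⟨by omega, by omega⟩, by
      push_cast; exact hcon.2⟩)
    simp at this
  have hkI := Finset.mem_Icc.1 hk
  have hsingle := Finset.single_le_sum (f := fun k : ℕ =>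
    if dist x x' ≤ 2 * 2 ^ (-((k : ℝ) * M)) then (2 : ℝ) ^ (2 * (M : ℝ) + c - (b - k) * M) else 0)
    (fun k _ => by split_ifs <;> positivity) hk
  refine le_trans ?_ hsingle
  simp only [hkd, if_true]
  have hV1 : ∑ k ∈ V, ν k ≤ 1 :=
    (Finset.sum_le_sum_of_subset_of_nonneg (Finset.subset_univ _) fun k _ _ => hν k).trans hν1
  have htriv : ((b : ℝ) - k) * M ≤ 2 * M + c → ∑ k ∈ V, ν k ≤ 2 ^ (2 * (M : ℝ) + c - (b - k) * M) :=
    fun h => hV1.trans (Real.one_le_rpow (by norm_num) (by linarith))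
  rcases hkmax with rfl | hlt
  · apply htriv
    have : (0 : ℝ) ≤ 2 * M + c := by positivity
    simpa using this
  by_cases hsmall : ((b : ℝ) - k) * M ≤ 2 * M + c
  · exact htriv hsmall
  rcases V.eq_empty_or_nonempty with he | ⟨k₀, hk₀⟩
  · rw [he, Finset.sum_empty]; positivity
  have hkb : k + 1 ≤ b := by
    by_contra! hcon
    obtain rfl : k = b := by omega
    apply hsmall
    have : (0 : ℝ) ≤ 2 * M + c := by positivity
    simpa using this
  obtain ⟨j, hj⟩ : ∃ j : ℕ, (j : ℝ) = (b - k - 1) * M - c := by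
    have hle : c ≤ (b - k - 1) * M := by
      have h1 : (c : ℝ) ≤ ((b - k - 1 : ℕ) : ℝ) * M := by
        rw [Nat.sub_sub, Nat.cast_sub hkb]
        push_cast
        have : (0 : ℝ) ≤ M := by positivity
        linarith
      exact_mod_cast h1
    refine ⟨(b - k - 1) * M - c, ?_⟩
    rw [Nat.cast_sub hle, Nat.cast_mul, Nat.sub_sub, Nat.cast_sub hkb]
    push_cast
    ring
  have hjN : j ≤ N := by
    have : (j : ℝ) ≤ b * M := by
      rw [hj]
      have h1 : (0 : ℝ) ≤ k * M := by positivity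
      have h2 : (0 : ℝ) ≤ M := by positivity
      have h3 : (0 : ℝ) ≤ c := by positivity
      linarith
    have : j ≤ b * M := by exact_mod_cast this
    omega
  have hstep : ∑ k ∈ V, ν k ≤ ∑ l with |cross x (y k₀) (y l)| ≤ 2 ^ (-(j : ℝ)), ν l := by
    refine Finset.sum_le_sum_of_subset_of_nonneg (fun l hl => ?_) fun l _ _ => hν l
    rw [Finset.mem_filter]
    refine ⟨Finset.mem_univ _, ?_⟩
    have hdsq : dist x x' ^ 2 ≤ 4 * 2 ^ (-((b : ℝ) * M)) := by
      have h1 : dist x x' ^ 2 ≤ (2 * 2 ^ (-((a : ℝ) * M))) ^ 2 := by gcongr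
      refine h1.trans ?_
      rw [mul_pow, sq ((2 : ℝ) ^ _), ← Real.rpow_add (by norm_num)]
      have : (2 : ℝ) ^ (-((a : ℝ) * M) + -((a : ℝ) * M)) ≤ 2 ^ (-((b : ℝ) * M)) := by
        apply Real.rpow_le_rpow_of_exponent_le (by norm_num)
        have h2 : (b : ℝ) ≤ 2 * a := by exact_mod_cast hb2
        have h3 : (0 : ℝ) ≤ M := by positivity
        nlinarith
      linarith
    have h1 := abs_cross_mul_dist_le (by positivity) (hV k₀ hk₀) (hV l hl) hdsq (hR _) (hR' _) (hR _)
      (hR' _)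
    have h2 : |cross x (y k₀) (y l)| * (2 * 2 ^ (-(((k : ℝ) + 1) * M))) ≤
        2 * 2 ^ (c : ℝ) * 2 ^ (-((b : ℝ) * M)) := by
      refine (mul_le_mul_of_nonneg_left hlt.le (abs_nonneg _)).trans (h1.trans ?_)
      exact mul_le_mul_of_nonneg_right (by linarith) (by positivity)
    have h3 : 2 * 2 ^ (c : ℝ) * (2 : ℝ) ^ (-((b : ℝ) * M)) =
        2 ^ (-(j : ℝ)) * (2 * 2 ^ (-(((k : ℝ) + 1) * M))) := by
      have : (2 : ℝ) ^ (c : ℝ) * (2 : ℝ) ^ (-((b : ℝ) * M)) =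
        2 ^ (-(j : ℝ)) * 2 ^ (-(((k : ℝ) + 1) * M)) := by
        rw [← Real.rpow_add (by norm_num), ← Real.rpow_add (by norm_num), hj]
        congr 1; ring
      linear_combination 2 * this
    rw [h3] at h2
    exact le_of_mul_le_mul_right h2 (by positivity)
  refine (hstep.trans (hgood k₀ hk₀ j hjN)).trans (le_of_eq ?_)
  rw [← Real.rpow_add (by norm_num), hj]
  congr 1; ring

open Classical in
/-- The average local correlation of the distances to the good pins is small. -/
lemma sum_correlation_le {ι κ : Type*} [Fintype ι] [Fintype κ] {w : ι → ℝ} (hw : ∀ i, 0 ≤ w i)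
    {ν : κ → ℝ} (hν : ∀ k, 0 ≤ ν k) (hν1 : ∑ k, ν k ≤ 1) (x : ι → Plane) (y : κ → Plane)
    {R : ℝ} {c N M m a b : ℕ} (hRc : R * (R + 2) ≤ 2 ^ (c : ℝ)) (hR : ∀ i k, dist (x i) (y k) ≤ R)
    (hMm : 25 * (m + 1) * 2 ^ (c : ℝ) ≤ (2 : ℝ) ^ (M : ℝ)) {p : ℕ → ℝ} {d : ℝ} (X : Finset ι)
    (hX : ∀ i ∈ X, ∀ k ≤ m, ∑ j with (x j).cell (k * M) = (x i).cell (k * M), w j ≤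
      2 ^ (-(M * p k)))
    (hab : a ≤ b) (hb2 : b ≤ 2 * a) (hbm : b ≤ m) (hmN : m * M ≤ N)
    (hp : ∀ k : ℕ, a ≤ k → k ≤ b → p a - a - d ≤ p k - k) (i : ι) (K : Finset κ)
    (hgood : ∀ k ∈ K, ∀ j ≤ N, ∑ l with |cross (x i) (y k) (y l)| ≤ 2 ^ (-(j : ℝ)), ν l ≤
      2 ^ (M : ℝ) * 2 ^ (-(j : ℝ))) :
    ∑ k ∈ K, ν k * ∑ j ∈ X with (x j).cell (a * M) = (x i).cell (a * M) ∧
      |dist (x i) (y k) - dist (x j) (y k)| ≤ 2 ^ (-((b : ℝ) * M)), w j ≤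
    2 ^ (3 * M - M * (p a - a - d + b)) := by
  have hswap : ∑ k ∈ K, ν k * ∑ j ∈ X with (x j).cell (a * M) = (x i).cell (a * M) ∧
      |dist (x i) (y k) - dist (x j) (y k)| ≤ 2 ^ (-((b : ℝ) * M)), w j =
      ∑ j ∈ X with (x j).cell (a * M) = (x i).cell (a * M), w j * ∑ k ∈ K with
        |dist (x i) (y k) - dist (x j) (y k)| ≤ 2 ^ (-((b : ℝ) * M)), ν k := by
    simp only [Finset.mul_sum, Finset.sum_filter]
    rw [Finset.sum_comm]
    refine Finset.sum_congr rfl fun j _ => ?_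
    by_cases h : (x j).cell (a * M) = (x i).cell (a * M)
    · simp only [h, true_and, if_true, mul_ite, mul_zero]
      refine Finset.sum_congr rfl fun k _ => ?_
      split_ifs
      · ring
      · rfl
    · simp [h]
  rw [hswap]
  calc _ ≤ ∑ j ∈ X with (x j).cell (a * M) = (x i).cell (a * M), w j * ∑ k ∈ Finset.Icc a b,
        (if dist (x i) (x j) ≤ 2 * 2 ^ (-((k : ℝ) * M)) then
          (2 : ℝ) ^ (2 * (M : ℝ) + c - (b - k) * M) else 0) := by
        refine Finset.sum_le_sum fun j hj => mul_le_mul_of_nonneg_left ?_ (hw j)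
        have hcell := Plane.dist_le_of_cell_eq (Finset.mem_filter.1 hj).2.symm
        push_cast at hcell
        refine sum_equidistant_le hν hν1 y hRc _ (hR i) (hR j)
          (fun k hk => hgood k (Finset.mem_filter.1 hk).1) (fun k hk => (Finset.mem_filter.1 hk).2)
          hab hb2 ((Nat.mul_le_mul_right M hbm).trans hmN) hcell
    _ ≤ ∑ j ∈ X, w j * ∑ k ∈ Finset.Icc a b,
        (if dist (x i) (x j) ≤ 2 * 2 ^ (-((k : ℝ) * M)) then
          (2 : ℝ) ^ (2 * (M : ℝ) + c - (b - k) * M) else 0) := by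
        refine Finset.sum_le_sum_of_subset_of_nonneg (Finset.filter_subset _ _) fun j _ _ => ?_
        refine mul_nonneg (hw j) (Finset.sum_nonneg fun k _ => ?_)
        split_ifs <;> positivity
    _ = ∑ k ∈ Finset.Icc a b, 2 ^ (2 * (M : ℝ) + c - (b - k) * M) *
        ∑ j ∈ X with dist (x i) (x j) ≤ 2 * 2 ^ (-(((k * M : ℕ) : ℝ))), w j := by
        simp only [Finset.mul_sum, Finset.sum_filter]
        rw [Finset.sum_comm]
        refine Finset.sum_congr rfl fun k _ => Finset.sum_congr rfl fun j _ => ?_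
        push_cast
        split_ifs
        · ring
        · ring
    _ ≤ ∑ k ∈ Finset.Icc a b, 2 ^ (2 * (M : ℝ) + c - (b - k) * M) * (25 * 2 ^ (-(M * p k))) := by
        refine Finset.sum_le_sum fun k hk => mul_le_mul_of_nonneg_left ?_ (by positivity)
        exact sum_ball_le hw x X (k * M) (by positivity)
          (fun i hi => hX i hi k ((Finset.mem_Icc.1 hk).2.trans hbm)) _
    _ ≤ ∑ k ∈ Finset.Icc a b, 25 * 2 ^ (c : ℝ) * 2 ^ (2 * M - M * (p a - a - d + b)) := by
        refine Finset.sum_le_sum fun k hk => ?_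
        rw [mul_left_comm, mul_assoc, ← Real.rpow_add (by norm_num), ← Real.rpow_add (by norm_num)]
        refine mul_le_mul_of_nonneg_left ?_ (by norm_num)
        apply Real.rpow_le_rpow_of_exponent_le (by norm_num)
        have h1 := hp k (Finset.mem_Icc.1 hk).1 (Finset.mem_Icc.1 hk).2
        have h2 : (0 : ℝ) ≤ M := by positivity
        nlinarith
    _ = (Finset.Icc a b).card * (25 * 2 ^ (c : ℝ) * 2 ^ (2 * M - M * (p a - a - d + b))) := by
        rw [Finset.sum_const, nsmul_eq_mul]
    _ ≤ (m + 1) * (25 * 2 ^ (c : ℝ) * 2 ^ (2 * M - M * (p a - a - d + b))) := by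
        refine mul_le_mul_of_nonneg_right ?_ (by positivity)
        rw [Nat.card_Icc]
        have : b + 1 - a ≤ m + 1 := by omega
        exact_mod_cast this
    _ = (25 * (m + 1) * 2 ^ (c : ℝ)) * 2 ^ (2 * M - M * (p a - a - d + b)) := by ring
    _ ≤ 2 ^ (M : ℝ) * 2 ^ (2 * M - M * (p a - a - d + b)) := by gcongr
    _ = _ := by
        rw [← Real.rpow_add (by norm_num)]
        congr 1; ring

lemma floor_two_pow_mem {a n : ℕ} (u : ℝ) :
    ⌊(2 : ℝ) ^ a * u⌋ * 2 ^ n ≤ ⌊(2 : ℝ) ^ (a + n) * u⌋ ∧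
      ⌊(2 : ℝ) ^ (a + n) * u⌋ < (⌊(2 : ℝ) ^ a * u⌋ + 1) * 2 ^ n := by
  have h1 := Int.floor_le ((2 : ℝ) ^ a * u)
  have h2 := Int.lt_floor_add_one ((2 : ℝ) ^ a * u)
  have hp : (0 : ℝ) < 2 ^ n := by positivity
  constructor
  · rw [Int.le_floor]
    push_cast
    rw [pow_add]
    nlinarith
  · rw [Int.floor_lt]
    push_cast
    rw [pow_add]
    nlinarith

lemma floor_two_pow_eq {a n : ℕ} {u v : ℝ}
    (h : ⌊(2 : ℝ) ^ (a + n) * u⌋ = ⌊(2 : ℝ) ^ (a + n) * v⌋) :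
    ⌊(2 : ℝ) ^ a * u⌋ = ⌊(2 : ℝ) ^ a * v⌋ := by
  obtain ⟨h1, h2⟩ := floor_two_pow_mem (a := a) (n := n) u
  obtain ⟨h3, h4⟩ := floor_two_pow_mem (a := a) (n := n) v
  rw [h] at h1 h2
  have hp : (0 : ℤ) < 2 ^ n := by positivity
  have h5 := lt_of_mul_lt_mul_right (h1.trans_lt h4) hp.le
  have h6 := lt_of_mul_lt_mul_right (h3.trans_lt h2) hp.le
  omega

lemma Plane.cell_eq_of_le {a b : ℕ} (hab : a ≤ b) {p q : Plane} (h : p.cell b = q.cell b) :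
    p.cell a = q.cell a := by
  obtain ⟨n, rfl⟩ := Nat.exists_eq_add_of_le hab
  exact Prod.ext (floor_two_pow_eq (congrArg Prod.fst h)) (floor_two_pow_eq (congrArg Prod.snd h))

/-- The descendants of a cell. -/
noncomputable def cellDescendants (n : ℕ) (c : ℤ × ℤ) : Finset (ℤ × ℤ) :=
  Finset.Ico (c.1 * 2 ^ n) ((c.1 + 1) * 2 ^ n) ×ˢ Finset.Ico (c.2 * 2 ^ n) ((c.2 + 1) * 2 ^ n)

lemma Plane.cell_mem_cellDescendants (a n : ℕ) (p : Plane) :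
    p.cell (a + n) ∈ cellDescendants n (p.cell a) := by
  simp only [cellDescendants, Finset.mem_product, Finset.mem_Ico]
  exact ⟨floor_two_pow_mem _, floor_two_pow_mem _⟩

lemma card_cellDescendants (n : ℕ) (c : ℤ × ℤ) : (cellDescendants n c).card = 4 ^ n := by
  have h : ∀ z : ℤ, ((z + 1) * 2 ^ n - z * 2 ^ n).toNat = 2 ^ n := by
    intro z
    have : (z + 1) * 2 ^ n - z * 2 ^ n = ((2 ^ n : ℕ) : ℤ) := by push_cast; ring
    rw [this, Int.toNat_natCast]
  rw [cellDescendants, Finset.card_product, Int.card_Ico, Int.card_Ico, h, h, ← mul_pow]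
  norm_num

open Classical in
/-- The mass of the cell of level `n` containing the point `x i`. -/
noncomputable def cellMass {ι : Type*} [Fintype ι] (w : ι → ℝ) (x : ι → Plane) (n : ℕ) (i : ι) : ℝ :=
  ∑ j with (x j).cell n = (x i).cell n, w j

lemma sum_biUnion_le {ι α : Type*} [DecidableEq ι] {w : ι → ℝ} (hw : ∀ i, 0 ≤ w i) (P : Finset α) (Y : α → Finset ι) :
    ∑ i ∈ P.biUnion Y, w i ≤ ∑ p ∈ P, ∑ i ∈ Y p, w i := by
  classical
  induction P using Finset.induction_on with
  | empty => simp
  | insert p P hp ih =>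
    rw [Finset.biUnion_insert, Finset.sum_insert hp]
    have h1 := Finset.sum_union_inter (s₁ := Y p) (s₂ := P.biUnion Y) (f := w)
    have h2 : 0 ≤ ∑ i ∈ Y p ∩ P.biUnion Y, w i := Finset.sum_nonneg fun i _ => hw i
    linarith

section
variable {ι : Type*} [Fintype ι] {w : ι → ℝ} {x : ι → Plane}

lemma cellMass_nonneg (hw : ∀ i, 0 ≤ w i) (n : ℕ) (i : ι) : 0 ≤ cellMass w x n i :=
  Finset.sum_nonneg fun j _ => hw j

lemma cellMass_anti (hw : ∀ i, 0 ≤ w i) {a b : ℕ} (hab : a ≤ b) (i : ι) :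
    cellMass w x b i ≤ cellMass w x a i := by
  classical
  refine Finset.sum_le_sum_of_subset_of_nonneg (fun j hj => ?_) fun j _ _ => hw j
  rw [Finset.mem_filter] at hj ⊢
  exact ⟨hj.1, Plane.cell_eq_of_le hab hj.2⟩

open Classical in
/-- A set of points in few light cells has small mass. -/
lemma sum_le_card_mul (hw : ∀ i, 0 ≤ w i) (n : ℕ) (Y : Finset ι) (T : Finset (ℤ × ℤ)) {B : ℝ}
    (hB : 0 ≤ B) (hT : ∀ i ∈ Y, (x i).cell n ∈ T) (hY : ∀ i ∈ Y, cellMass w x n i ≤ B) :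
    ∑ i ∈ Y, w i ≤ T.card * B := by
  rw [← Finset.sum_fiberwise_of_maps_to hT, ← nsmul_eq_mul]
  refine Finset.sum_le_card_nsmul _ _ _ fun c _ => ?_
  rcases (Finset.filter (fun i => (x i).cell n = c) Y).eq_empty_or_nonempty with he | ⟨i, hi⟩
  · rw [he, Finset.sum_empty]; exact hB
  · rw [Finset.mem_filter] at hi
    refine le_trans ?_ (hY i hi.1)
    rw [cellMass, hi.2]
    refine Finset.sum_le_sum_of_subset_of_nonneg ?_ fun j _ _ => hw j
    exact Finset.filter_subset_filter _ (Finset.subset_univ _)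

open Classical in
lemma sum_irregular_le (hw : ∀ i, 0 ≤ w i) (hw1 : ∑ i, w i ≤ 1) (a n : ℕ) {ε : ℝ} (hε : 0 ≤ ε) :
    ∑ i with cellMass w x (a + n) i < ε * (4 ^ n)⁻¹ * cellMass w x a i, w i ≤ ε := by
  set Y := Finset.univ.filter fun i => cellMass w x (a + n) i < ε * (4 ^ n)⁻¹ * cellMass w x a i with hY
  set q : ι → ℤ × ℤ := fun i => (x i).cell a with hq
  rw [← Finset.sum_fiberwise_of_maps_to (fun i _ => Finset.mem_image_of_mem q (Finset.mem_univ i))]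
  calc _ ≤ ∑ c ∈ Finset.univ.image q, ε * ∑ i with q i = c, w i := by
        refine Finset.sum_le_sum fun c hc => ?_
        obtain ⟨i, _, rfl⟩ := Finset.mem_image.1 hc
        have := sum_le_card_mul (x := x) hw (a + n) (Y.filter fun j => q j = q i)
          (cellDescendants n (q i)) (B := ε * (4 ^ n)⁻¹ * cellMass w x a i)
          (mul_nonneg (by positivity) (cellMass_nonneg hw _ _))
          (fun j hj => by
            rw [← (Finset.mem_filter.1 hj).2]
            exact Plane.cell_mem_cellDescendants _ _ _)
          (fun j hj => by
            obtain ⟨h1, h2⟩ := Finset.mem_filter.1 hj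
            refine (Finset.mem_filter.1 h1).2.le.trans (le_of_eq ?_)
            have h3 : (x j).cell a = (x i).cell a := h2
            rw [cellMass, cellMass, h3])
        refine this.trans (le_of_eq ?_)
        rw [card_cellDescendants, cellMass]
        push_cast
        field_simp
        rfl
    _ = ε * ∑ i, w i := by
        rw [← Finset.mul_sum,
          Finset.sum_fiberwise_of_maps_to (fun i _ => Finset.mem_image_of_mem q (Finset.mem_univ i))]
    _ ≤ ε := by nlinarith

/-- A point around which mass does not drop too quickly when passing to smaller cells. -/
structure IsRegularPt (w : ι → ℝ) (x : ι → Plane) (M m : ℕ) (i : ι) : Prop where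
  zero : 2 ^ (-(M : ℝ)) ≤ cellMass w x 0 i
  step : ∀ a b, a ≤ b → b ≤ m →
    2 ^ (-(M : ℝ)) * (4 ^ ((b - a) * M))⁻¹ * cellMass w x (a * M) i ≤ cellMass w x (b * M) i

open Classical in
lemma sum_not_isRegularPt_le (hw : ∀ i, 0 ≤ w i) (hw1 : ∑ i, w i ≤ 1) (M m : ℕ) (T : Finset (ℤ × ℤ))
    (hT : ∀ i, (x i).cell 0 ∈ T) :
    ∑ i with ¬ IsRegularPt w x M m i, w i ≤ (T.card + (m + 1) ^ 2) * 2 ^ (-(M : ℝ)) := by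
  set ε : ℝ := 2 ^ (-(M : ℝ)) with hε
  have hε0 : 0 ≤ ε := by positivity
  set P := Finset.range (m + 1) ×ˢ Finset.range (m + 1)
  set Y₀ := Finset.univ.filter fun i => cellMass w x 0 i < ε
  set Y : ℕ × ℕ → Finset ι := fun p => Finset.univ.filter fun i =>
    cellMass w x (p.1 * M + p.2 * M) i < ε * (4 ^ (p.2 * M))⁻¹ * cellMass w x (p.1 * M) i
  have hsub : (Finset.univ.filter fun i => ¬ IsRegularPt w x M m i) ⊆ Y₀ ∪ P.biUnion Y := by
    intro i hi
    rw [Finset.mem_filter] at hi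
    by_contra hcon
    simp only [Finset.mem_union, Finset.mem_biUnion, not_or, not_exists, not_and, Y₀, Y, P,
      Finset.mem_filter, Finset.mem_univ, true_and, not_lt, Finset.mem_product,
      Finset.mem_range] at hcon
    refine hi.2 ⟨hcon.1, fun a b hab hb => ?_⟩
    have := hcon.2 (a, b - a) ⟨by simp; omega, by simp; omega⟩
    have h2 : a * M + (b - a) * M = b * M := by rw [← add_mul, Nat.add_sub_cancel' hab]
    simpa only [h2] using this
  have hunion : ∑ i ∈ Y₀ ∪ P.biUnion Y, w i ≤ ∑ i ∈ Y₀, w i + ∑ p ∈ P, ∑ i ∈ Y p, w i := by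
    have h1 := Finset.sum_union_inter (s₁ := Y₀) (s₂ := P.biUnion Y) (f := w)
    have h2 : 0 ≤ ∑ i ∈ Y₀ ∩ P.biUnion Y, w i := Finset.sum_nonneg fun i _ => hw i
    have h3 := sum_biUnion_le hw P Y
    linarith
  have h0 : ∑ i ∈ Y₀, w i ≤ T.card * ε :=
    sum_le_card_mul hw 0 Y₀ T hε0 (fun i _ => hT i) fun i hi => (Finset.mem_filter.1 hi).2.le
  have h1 : ∑ p ∈ P, ∑ i ∈ Y p, w i ≤ P.card * ε := by
    rw [← nsmul_eq_mul]
    exact Finset.sum_le_card_nsmul _ _ _ fun p _ => sum_irregular_le hw hw1 _ _ hε0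
  have h2 : (P.card : ℝ) = (m + 1) ^ 2 := by
    rw [Finset.card_product, Finset.card_range]; push_cast; ring
  have h3 := Finset.sum_le_sum_of_subset_of_nonneg hsub fun i _ _ => hw i
  rw [h2] at h1
  linarith

/-- The logarithmic profile of the masses of the cells containing `x i`. -/
noncomputable def profile (w : ι → ℝ) (x : ι → Plane) (M k : ℕ) (i : ι) : ℤ :=
  ⌊-Real.logb 2 (cellMass w x (k * M) i) / M⌋

lemma IsRegularPt.cellMass_pos {M m : ℕ} {i : ι} (h : IsRegularPt w x M m i) {k : ℕ} (hk : k ≤ m) :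
    0 < cellMass w x (k * M) i := by
  have h0 : 0 < cellMass w x (0 * M) i := by
    rw [zero_mul]
    exact lt_of_lt_of_le (by positivity) h.zero
  exact lt_of_lt_of_le (by positivity) (h.step 0 k (Nat.zero_le _) hk)

lemma profile_le {M k : ℕ} (hM : 0 < M) {i : ι} (h : 0 < cellMass w x (k * M) i) :
    cellMass w x (k * M) i ≤ 2 ^ (-((M : ℝ) * profile w x M k i)) := by
  have hM' : (0 : ℝ) < M := by exact_mod_cast hM
  have h1 : (profile w x M k i : ℝ) ≤ _ := Int.floor_le _
  rw [le_div_iff₀ hM'] at h1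
  rw [← Real.logb_le_iff_le_rpow (by norm_num) h]
  linarith

lemma lt_profile {M k : ℕ} (hM : 0 < M) {i : ι} (h : 0 < cellMass w x (k * M) i) :
    2 ^ (-((M : ℝ) * (profile w x M k i + 1))) < cellMass w x (k * M) i := by
  have hM' : (0 : ℝ) < M := by exact_mod_cast hM
  have h1 : _ < (profile w x M k i : ℝ) + 1 := Int.lt_floor_add_one _
  rw [div_lt_iff₀ hM'] at h1
  rw [← Real.lt_logb_iff_rpow_lt (by norm_num) h]
  linarith

lemma IsRegularPt.profile_mono (hw : ∀ i, 0 ≤ w i) {M m : ℕ} {i : ι}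
    (h : IsRegularPt w x M m i) {a b : ℕ} (hab : a ≤ b) (hb : b ≤ m) :
    profile w x M a i ≤ profile w x M b i := by
  refine Int.floor_le_floor ?_
  have h1 := Real.logb_le_logb_of_le (b := 2) (by norm_num) (h.cellMass_pos hb)
    (cellMass_anti (x := x) hw (Nat.mul_le_mul_right M hab) i)
  gcongr

lemma IsRegularPt.profile_le_add {M m : ℕ} (hM : 0 < M) {i : ι}
    (h : IsRegularPt w x M m i) {a b : ℕ} (hab : a ≤ b) (hb : b ≤ m) :
    profile w x M b i ≤ profile w x M a i + 2 * (b - a) + 2 := by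
  have hM' : (0 : ℝ) < M := by exact_mod_cast hM
  have h1 := profile_le hM (h.cellMass_pos hb)
  have h2 := lt_profile hM (h.cellMass_pos (hab.trans hb))
  have h3 := h.step a b hab hb
  have h4 : ((4 : ℝ) ^ ((b - a) * M))⁻¹ = 2 ^ (-(2 * ((b : ℝ) - a) * M)) := by
    rw [Real.rpow_neg (by norm_num), ← Nat.cast_sub hab, mul_assoc, Real.rpow_mul (by norm_num)]
    norm_num
    rw [← Nat.cast_mul, Real.rpow_natCast]
  rw [h4] at h3
  have h5 : (2 : ℝ) ^ (-(M : ℝ)) * 2 ^ (-(2 * ((b : ℝ) - a) * M)) *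
      2 ^ (-((M : ℝ) * (profile w x M a i + 1))) < 2 ^ (-((M : ℝ) * profile w x M b i)) :=
    lt_of_lt_of_le (mul_lt_mul_of_pos_left h2 (by positivity)) (h3.trans h1)
  rw [← Real.rpow_add (by norm_num), ← Real.rpow_add (by norm_num),
    Real.rpow_lt_rpow_left_iff (by norm_num)] at h5
  have h6 : (profile w x M b i : ℝ) < profile w x M a i + 2 * (b - a) + 2 := by
    by_contra! hcon
    have := mul_le_mul_of_nonneg_left hcon hM'.le
    linarith
  have h7 : (profile w x M b i : ℝ) ≤ ((profile w x M a i + 2 * (b - a) + 2 : ℤ) : ℝ) := by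
    push_cast
    exact h6.le
  exact_mod_cast h7

lemma profile_nonneg (hw : ∀ i, 0 ≤ w i) (hw1 : ∑ i, w i ≤ 1) (M k : ℕ) (i : ι) :
    0 ≤ profile w x M k i := by
  refine Int.floor_nonneg.2 (div_nonneg ?_ (by positivity))
  rw [neg_nonneg]
  refine Real.logb_nonpos (by norm_num) (cellMass_nonneg hw _ _) ?_
  exact (Finset.sum_le_sum_of_subset_of_nonneg (Finset.subset_univ _) fun j _ _ => hw j).trans hw1

lemma IsRegularPt.profile_zero_le {M m : ℕ} (hM : 0 < M) {i : ι} (h : IsRegularPt w x M m i) :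
    profile w x M 0 i ≤ 1 := by
  have hM' : (0 : ℝ) < M := by exact_mod_cast hM
  have h1 : 0 < cellMass w x 0 i := lt_of_lt_of_le (by positivity) h.zero
  have h2 := (Real.le_logb_iff_rpow_le (b := 2) (by norm_num) h1).2 h.zero
  rw [profile, Int.floor_le_iff, div_lt_iff₀ hM', zero_mul]
  push_cast
  linarith

lemma IsFrostman.cellMass_le {C s : ℝ} {N n : ℕ} (h : IsFrostman w x C s N) (hn : 1 ≤ n)
    (hnN : n ≤ N) (i : ι) : cellMass w x n i ≤ C * 2 ^ (s - n * s) := by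
  classical
  have h1 := h.ball_le (x i) (n - 1) ((Nat.sub_le _ _).trans hnN)
  rw [Nat.cast_sub hn] at h1
  have h2 : -(((n : ℝ) - ((1 : ℕ) : ℝ)) * s) = s - n * s := by push_cast; ring
  rw [h2] at h1
  refine le_trans ?_ h1
  refine Finset.sum_le_sum_of_subset_of_nonneg (fun j hj => ?_) fun j _ _ => h.nonneg j
  rw [Finset.mem_filter] at hj ⊢
  refine ⟨hj.1, (Plane.dist_le_of_cell_eq hj.2.symm).trans (le_of_eq ?_)⟩
  rw [neg_sub, sub_eq_add_neg, Real.rpow_add (by norm_num)]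
  push_cast
  rw [Real.rpow_one]

/-- The profile of a regular point of a Frostman configuration. -/
lemma IsFrostman.isProfile {C s : ℝ} {N M m : ℕ} (hF : IsFrostman w x C s N) (hM : 0 < M)
    (hm : 1 ≤ m) (hC : C * 2 ^ s ≤ 2 ^ (M : ℝ)) (hN : m * M ≤ N) {i : ι}
    (h : IsRegularPt w x M m i) :
    IsProfile (fun k => (profile w x M k i : ℝ) - k) m (s - 1) := by
  have hM' : (0 : ℝ) < M := by exact_mod_cast hM
  refine ⟨fun a b hab hb => ?_, fun a b hab hb => ?_, fun k hk => ?_, ?_⟩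
  · have : (profile w x M a i : ℝ) ≤ profile w x M b i := by
      exact_mod_cast h.profile_mono hF.nonneg hab hb
    linarith
  · have : (profile w x M b i : ℝ) ≤ ((profile w x M a i + 2 * (b - a) + 2 : ℤ) : ℝ) := by
      exact_mod_cast h.profile_le_add hM hab hb
    push_cast at this
    linarith
  · rcases Nat.eq_zero_or_pos k with rfl | hk0
    · have : (0 : ℝ) ≤ profile w x M 0 i := by
        exact_mod_cast profile_nonneg hF.nonneg hF.sum_le M 0 i
      push_cast
      linarith
    · have hkM : 1 ≤ k * M := Nat.mul_pos hk0 hM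
      have h1 := hF.cellMass_le hkM ((Nat.mul_le_mul_right M hk).trans hN) i
      have h2 := lt_profile hM (h.cellMass_pos hk)
      have h3 : (2 : ℝ) ^ (-((M : ℝ) * (profile w x M k i + 1))) < 2 ^ ((M : ℝ) - k * M * s) := by
        refine h2.trans_le (h1.trans ?_)
        rw [sub_eq_add_neg, sub_eq_add_neg, Real.rpow_add (by norm_num),
          Real.rpow_add (by norm_num), ← mul_assoc]
        push_cast
        gcongr
      rw [Real.rpow_lt_rpow_left_iff (by norm_num)] at h3
      by_contra! hcon
      have h4 : (profile w x M k i : ℝ) + 1 ≤ s * k - 1 := by linarith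
      have := mul_le_mul_of_nonneg_left h4 hM'.le
      linarith
  · have h1 := h.profile_le_add hM (Nat.zero_le 1) hm
    have h2 := h.profile_zero_le hM
    have h3 : profile w x M 1 i ≤ 5 := by
      push_cast at h1
      omega
    have h4 : (profile w x M 1 i : ℝ) ≤ 5 := by exact_mod_cast h3
    push_cast
    linarith

end

section
variable {ι κ : Type} [Fintype ι] [Fintype κ] {w : ι → ℝ} {x : ι → Plane} {ν : κ → ℝ} {y : κ → Plane}

open Classical in
/-- The regular points with the same profile as `x i`. -/
noncomputable def profileClass (w : ι → ℝ) (x : ι → Plane) (M m : ℕ) (i : ι) : Finset ι :=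
  Finset.univ.filter fun j =>
    IsRegularPt w x M m j ∧ ∀ k ≤ m, profile w x M k j = profile w x M k i

open Classical in
/-- All tubes spanned by a pair have mass not much larger than their width. -/
def IsThinPair (ν : κ → ℝ) (y : κ → Plane) (N M : ℕ) (p : Plane) (k : κ) : Prop :=
  ∀ j ≤ N, ∑ l with |cross p (y k) (y l)| ≤ 2 ^ (-(j : ℝ)), ν l ≤ 2 ^ (M : ℝ) * 2 ^ (-(j : ℝ))

open Classical in
/-- The mass of the points near `x i` having almost the same distance to the pin. -/
noncomputable def localCorr (w : ι → ℝ) (x : ι → Plane) (X : Finset ι) (M a b : ℕ) (i : ι)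
    (p : Plane) : ℝ :=
  ∑ j ∈ X with (x j).cell (a * M) = (x i).cell (a * M) ∧
      |dist (x i) p - dist (x j) p| ≤ 2 ^ (-((b : ℝ) * M)), w j

/-- The local correlation between the blocks `a` and `b` exceeds its expected size, the profile
being lowest at `k₀`. -/
def IsCorrelated (w : ι → ℝ) (x : ι → Plane) (M m a b k₀ : ℕ) (i : ι) (p : Plane) : Prop :=
  (a ≤ b ∧ b ≤ 2 * a ∧ b ≤ m ∧ ∀ k, a ≤ k → k ≤ b →
    (profile w x M k₀ i : ℝ) - k₀ ≤ profile w x M k i - k) ∧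
  2 ^ (4 * M - M * ((profile w x M k₀ i : ℝ) - k₀ + b)) <
    localCorr w x (profileClass w x M m i) M a b i p

open Classical in
lemma sum_isCorrelated_le (hw : ∀ i, 0 ≤ w i) (hν : ∀ k, 0 ≤ ν k) (hν1 : ∑ k, ν k ≤ 1)
    {R : ℝ} {c N M m : ℕ} (hRc : R * (R + 2) ≤ 2 ^ (c : ℝ)) (hR : ∀ i k, dist (x i) (y k) ≤ R)
    (hM : 0 < M) (hMm : 25 * (m + 1) * 2 ^ (c : ℝ) ≤ (2 : ℝ) ^ (M : ℝ)) (hmN : m * M ≤ N)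
    (a b k₀ : ℕ) (i : ι) :
    ∑ k with IsThinPair ν y N M (x i) k ∧ IsCorrelated w x M m a b k₀ i (y k), ν k ≤
      2 ^ (-(M : ℝ)) := by
  set K := Finset.univ.filter fun k =>
    IsThinPair ν y N M (x i) k ∧ IsCorrelated w x M m a b k₀ i (y k) with hK
  rcases K.eq_empty_or_nonempty with he | ⟨k₁, hk₁⟩
  · rw [he, Finset.sum_empty]; positivity
  obtain ⟨⟨hab, hb2, hbm, hp⟩, -⟩ := (Finset.mem_filter.1 hk₁).2.2
  have hmain := sum_correlation_le hw hν hν1 x y hRc hR hMm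
    (p := fun k => (profile w x M k i : ℝ))
    (d := (profile w x M a i : ℝ) - a - (profile w x M k₀ i - k₀))
    (profileClass w x M m i)
    (fun j hj k hk => by
      obtain ⟨h1, h2⟩ := (Finset.mem_filter.1 hj).2
      have := profile_le hM (h1.cellMass_pos hk)
      rwa [h2 k hk] at this) hab hb2 hbm hmN
    (fun k h1 h2 => by linarith [hp k h1 h2]) i K
    (fun k hk => (Finset.mem_filter.1 hk).2.1)
  set θ : ℝ := (profile w x M k₀ i : ℝ) - k₀ + b with hθ
  have hexp : (3 * (M : ℝ) - M * ((profile w x M a i : ℝ) - a -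
    ((profile w x M a i : ℝ) - a - (profile w x M k₀ i - k₀)) + b)) = 3 * M - M * θ := by
    rw [hθ]; ring
  rw [hexp] at hmain
  have hlow : (∑ k ∈ K, ν k) * 2 ^ (4 * M - M * θ) ≤ 2 ^ (3 * M - M * θ) := by
    refine le_trans ?_ hmain
    rw [Finset.sum_mul]
    exact Finset.sum_le_sum fun k hk =>
      mul_le_mul_of_nonneg_left (Finset.mem_filter.1 hk).2.2.2.le (hν k)
  have h4 : (2 : ℝ) ^ (3 * M - M * θ) = 2 ^ (-(M : ℝ)) * 2 ^ (4 * M - M * θ) := by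
    rw [← Real.rpow_add (by norm_num)]; congr 1; ring
  rw [h4] at hlow
  exact le_of_mul_le_mul_right hlow (by positivity)

lemma sum_product_le_of_fiber (hw : ∀ i, 0 ≤ w i) (hw1 : ∑ i, w i ≤ 1) {ε : ℝ} (hε : 0 ≤ ε)
    (P : ι → κ → Prop) [∀ i, DecidablePred (P i)] (hP : ∀ i, ∑ k with P i k, ν k ≤ ε) :
    ∑ p : ι × κ with P p.1 p.2, w p.1 * ν p.2 ≤ ε := by
  rw [Finset.sum_filter, Fintype.sum_prod_type]
  calc _ ≤ ∑ i, w i * ε := by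
        refine Finset.sum_le_sum fun i _ => ?_
        have h1 : ∑ k, (if P i k then w i * ν k else 0) = w i * ∑ k with P i k, ν k := by
          rw [← Finset.sum_filter, ← Finset.mul_sum]
        exact h1.trans_le (mul_le_mul_of_nonneg_left (hP i) (hw i))
    _ ≤ ε := by rw [← Finset.sum_mul]; nlinarith

/-- A pair which is regular, thin and not correlated at any pair of scales. -/
structure IsGoodPair (w : ι → ℝ) (x : ι → Plane) (ν : κ → ℝ) (y : κ → Plane) (N M m : ℕ) (i : ι)
    (k : κ) : Prop where
  regular : IsRegularPt w x M m i
  thin : IsThinPair ν y N M (x i) k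
  not_correlated : ∀ a b k₀, b ≤ m → k₀ ≤ m → ¬ IsCorrelated w x M m a b k₀ i (y k)

open Classical in
/-- Most pairs are good. -/
lemma sum_not_isGoodPair_le (hw : ∀ i, 0 ≤ w i) (hw1 : ∑ i, w i ≤ 1) (hν : ∀ k, 0 ≤ ν k)
    (hν1 : ∑ k, ν k ≤ 1) {R : ℝ} {c N M m : ℕ} (hRc : R * (R + 2) ≤ 2 ^ (c : ℝ))
    (hR : ∀ i k, dist (x i) (y k) ≤ R) (hM : 0 < M)
    (hMm : 25 * (m + 1) * 2 ^ (c : ℝ) ≤ (2 : ℝ) ^ (M : ℝ)) (hmN : m * M ≤ N)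
    (T : Finset (ℤ × ℤ)) (hT : ∀ i, (x i).cell 0 ∈ T) (S : Finset (ι × κ)) {δ : ℝ}
    (hδ : ∀ j ≤ N, ∑ p ∈ S with 2 ^ (M : ℝ) * 2 ^ (-(j : ℝ)) <
      ∑ l with |cross (x p.1) (y p.2) (y l)| ≤ 2 ^ (-(j : ℝ)), ν l, w p.1 * ν p.2 ≤ δ) :
    ∑ p ∈ S with ¬ IsGoodPair w x ν y N M m p.1 p.2, w p.1 * ν p.2 ≤
      (T.card + (m + 1) ^ 2 + (2 * m + 1) ^ 3) * 2 ^ (-(M : ℝ)) + (N + 1) * δ := by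
  set f : ι × κ → ℝ := fun p => w p.1 * ν p.2 with hf
  have hf0 : ∀ p, 0 ≤ f p := fun p => mul_nonneg (hw _) (hν _)
  set ε : ℝ := 2 ^ (-(M : ℝ)) with hε
  have hε0 : 0 ≤ ε := by positivity
  set S₁ : Finset (ι × κ) := Finset.univ.filter fun p => ¬ IsRegularPt w x M m p.1 with hS₁
  set S₂ : ℕ → Finset (ι × κ) := fun j => S.filter fun p => 2 ^ (M : ℝ) * 2 ^ (-(j : ℝ)) <
      ∑ l with |cross (x p.1) (y p.2) (y l)| ≤ 2 ^ (-(j : ℝ)), ν l with hS₂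
  set S₃ : ℕ × ℕ × ℕ → Finset (ι × κ) := fun q => Finset.univ.filter fun p =>
    IsThinPair ν y N M (x p.1) p.2 ∧ IsCorrelated w x M m q.1 q.2.1 q.2.2 p.1 (y p.2) with hS₃
  set I := Finset.range (2 * m + 1) ×ˢ Finset.range (2 * m + 1) ×ˢ Finset.range (2 * m + 1) with hI
  have hsub : (S.filter fun p => ¬ IsGoodPair w x ν y N M m p.1 p.2) ⊆
      S₁ ∪ ((Finset.range (N + 1)).biUnion S₂ ∪ I.biUnion S₃) := by
    intro p hp
    rw [Finset.mem_filter] at hp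
    by_contra hcon
    simp only [Finset.mem_union, Finset.mem_biUnion, not_or, not_exists, not_and] at hcon
    obtain ⟨h1, h2, h3⟩ := hcon
    have hthin : IsThinPair ν y N M (x p.1) p.2 := by
      intro j hj
      by_contra! hlt
      exact h2 j (Finset.mem_range.2 (by omega)) (Finset.mem_filter.2 ⟨hp.1, hlt⟩)
    refine hp.2 ⟨?_, hthin, fun a b k₀ hb hk₀ hc => ?_⟩
    · by_contra hr
      exact h1 (Finset.mem_filter.2 ⟨Finset.mem_univ _, hr⟩)
    · have := hc.1.1
      refine h3 (a, b, k₀) ?_ (Finset.mem_filter.2 ⟨Finset.mem_univ _, hthin, hc⟩)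
      simp only [hI, Finset.mem_product, Finset.mem_range]
      omega
  have hunion : ∀ U V : Finset (ι × κ), ∑ p ∈ U ∪ V, f p ≤ ∑ p ∈ U, f p + ∑ p ∈ V, f p := by
    intro U V
    have h1 := Finset.sum_union_inter (s₁ := U) (s₂ := V) (f := f)
    have h2 : 0 ≤ ∑ i ∈ U ∩ V, f i := Finset.sum_nonneg fun i _ => hf0 i
    linarith
  have e1 : ∑ p ∈ S₁, f p ≤ (T.card + (m + 1) ^ 2) * ε := by
    have h1 := sum_not_isRegularPt_le (x := x) hw hw1 M m T hT
    refine le_trans ?_ h1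
    rw [hS₁, Finset.sum_filter, Fintype.sum_prod_type, Finset.sum_filter]
    refine Finset.sum_le_sum fun i _ => ?_
    by_cases hr : IsRegularPt w x M m i
    · simp [hr]
    · simp only [hr, not_false_eq_true, if_true, hf]
      rw [← Finset.mul_sum]
      have := hw i
      nlinarith
  have e2 : ∑ p ∈ (Finset.range (N + 1)).biUnion S₂, f p ≤ (N + 1) * δ := by
    refine (sum_biUnion_le hf0 _ _).trans ?_
    have := Finset.sum_le_card_nsmul (Finset.range (N + 1)) (fun j => ∑ p ∈ S₂ j, f p) δ
      (fun j hj => hδ j (by have := Finset.mem_range.1 hj; omega))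
    rw [Finset.card_range, nsmul_eq_mul] at this
    exact_mod_cast this
  have e3 : ∑ p ∈ I.biUnion S₃, f p ≤ (2 * m + 1) ^ 3 * ε := by
    refine (sum_biUnion_le hf0 _ _).trans ?_
    have := Finset.sum_le_card_nsmul I (fun j => ∑ p ∈ S₃ j, f p) ε
      (fun q _ => sum_product_le_of_fiber hw hw1 hε0 _
        (fun i => sum_isCorrelated_le hw hν hν1 hRc hR hM hMm hmN q.1 q.2.1 q.2.2 i))
    rw [nsmul_eq_mul, hI, Finset.card_product, Finset.card_product, Finset.card_range] at this
    refine this.trans (le_of_eq ?_)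
    push_cast
    ring
  have h0 := Finset.sum_le_sum_of_subset_of_nonneg hsub fun p _ _ => hf0 p
  have h1 := hunion S₁ ((Finset.range (N + 1)).biUnion S₂ ∪ I.biUnion S₃)
  have h2 := hunion ((Finset.range (N + 1)).biUnion S₂) (I.biUnion S₃)
  linarith

open Classical in
/-- The good points of one profile class see many distances. -/
lemma card_image_ge_of_isGoodPair (hw : ∀ i, 0 ≤ w i) (hw1 : ∑ i, w i ≤ 1) {N M m : ℕ} (hM : 3 ≤ M)
    {k : κ} {i₀ : ι} {n b : ℕ} {l : ℝ}
    (H : ScaleChainN (fun k => (profile w x M k i₀ : ℝ) - k) n b l) (hb : b ≤ m) (Z : Finset ι)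
    (hgood : ∀ i ∈ Z, IsGoodPair w x ν y N M m i k)
    (hclass : ∀ i ∈ Z, ∀ j ≤ m, profile w x M j i = profile w x M j i₀)
    (hZ : n * 2 ^ (-(M : ℝ)) < ∑ i ∈ Z, w i) :
    (2 : ℝ) ^ (M * (b - 1 - l - 7 * n)) ≤
      (Z.image fun i => ⌊(2 : ℝ) ^ ((b : ℝ) * M) * dist (x i) (y k)⌋).card := by
  have hM0 : 0 < M := by omega
  refine H.le_card hw hw1 (fun a i => (x i).cell (a * M)) (fun i => dist (x i) (y k)) hM
    (p := fun k => (profile w x M k i₀ : ℝ)) Z ?_ ?_ ?_ hb Z le_rfl hZ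
  · intro a i j hij
    have h1 := Plane.dist_le_of_cell_eq hij
    push_cast at h1
    exact (abs_dist_sub_le _ _ _).trans h1
  · intro i hi a ha
    have := (lt_profile hM0 ((hgood i hi).regular.cellMass_pos ha)).le
    rw [hclass i hi a ha] at this
    refine this.trans_eq ?_
    unfold cellMass
    congr!
  · intro i hi a b d hab hb2 hbm hd
    obtain ⟨k₀, hk₀, hmin⟩ := Finset.exists_min_image (Finset.Icc a b)
      (fun k : ℕ => (profile w x M k i₀ : ℝ) - k) ⟨a, by simp [hab.le]⟩
    have hk₀' := Finset.mem_Icc.1 hk₀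
    have hnc := (hgood i hi).not_correlated a b k₀ hbm (hk₀'.2.trans hbm)
    have hle : localCorr w x (profileClass w x M m i) M a b i (y k) ≤
        2 ^ (4 * M - M * ((profile w x M k₀ i : ℝ) - k₀ + b)) := by
      by_contra! hlt
      refine hnc ⟨⟨hab.le, hb2, hbm, fun k h1 h2 => ?_⟩, hlt⟩
      rw [hclass i hi k (h2.trans hbm), hclass i hi k₀ (hk₀'.2.trans hbm)]
      exact hmin k (Finset.mem_Icc.2 ⟨h1, h2⟩)
    refine le_trans (le_of_eq (b := ∑ j ∈ Z with (x j).cell (a * M) = (x i).cell (a * M) ∧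
      |dist (x i) (y k) - dist (x j) (y k)| ≤ 2 ^ (-((b : ℝ) * M)), w j) (by congr!))
      (le_trans ?_ (hle.trans ?_))
    · refine Finset.sum_le_sum_of_subset_of_nonneg ?_ fun j _ _ => hw j
      intro j hj
      replace hj := Finset.mem_filter.1 hj
      refine Finset.mem_filter.2 ⟨Finset.mem_filter.2 ⟨Finset.mem_univ _, (hgood j hj.1).regular, fun k hk => ?_⟩, hj.2⟩
      rw [hclass i hi k hk, hclass j hj.1 k hk]
    · rw [hclass i hi k₀ (hk₀'.2.trans hbm)]
      apply Real.rpow_le_rpow_of_exponent_le (by norm_num)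
      have := mul_le_mul_of_nonneg_left (hd k₀ hk₀'.1 hk₀'.2) (Nat.cast_nonneg (α := ℝ) M)
      nlinarith

end

open Classical in
/-- A set of regular points of large mass has a large intersection with some profile class. -/
lemma exists_profile_class {ι : Type} [Fintype ι] {w : ι → ℝ} {x : ι → Plane} (hw : ∀ i, 0 ≤ w i)
    (hw1 : ∑ i, w i ≤ 1) {M m : ℕ} (hM : 0 < M) (X : Finset ι)
    (hX : ∀ i ∈ X, IsRegularPt w x M m i) {δ : ℝ} (hδ : 0 < δ) (hXδ : δ ≤ ∑ i ∈ X, w i) :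
    ∃ i₀ ∈ X, δ / (2 * m + 4) ^ (m + 1) ≤
      ∑ i ∈ X with ∀ j ≤ m, profile w x M j i = profile w x M j i₀, w i := by
  set key : ι → (Fin (m + 1) → Fin (2 * m + 4)) := fun i j =>
    Fin.ofNat (2 * m + 4) (profile w x M j i).toNat with hkey
  have hkey_eq : ∀ i ∈ X, ∀ i' ∈ X, key i = key i' → ∀ j ≤ m,
      profile w x M j i = profile w x M j i' := by
    intro i hi i' hi' h j hj
    have hbound : ∀ i ∈ X, 0 ≤ profile w x M j i ∧ profile w x M j i < 2 * m + 4 := by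
      intro i hi
      have h1 := (hX i hi).profile_zero_le hM
      have h2 := (hX i hi).profile_le_add hM (Nat.zero_le j) hj
      refine ⟨profile_nonneg hw hw1 M j i, ?_⟩
      push_cast at h2
      omega
    have h3 := congrArg Fin.val (congrFun h ⟨j, by omega⟩)
    simp only [hkey, Fin.ofNat] at h3
    obtain ⟨h4, h5⟩ := hbound i hi
    obtain ⟨h6, h7⟩ := hbound i' hi'
    rw [Nat.mod_eq_of_lt (by omega), Nat.mod_eq_of_lt (by omega)] at h3
    omega
  have hcard : (Fintype.card (Fin (m + 1) → Fin (2 * m + 4)) : ℝ) = (2 * m + 4) ^ (m + 1) := by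
    simp
  have hL : (0 : ℝ) < (2 * m + 4) ^ (m + 1) := by positivity
  obtain ⟨c, -, hc⟩ := Finset.exists_le_sum_fiber_of_maps_to_of_nsmul_le_sum
    (s := X) (t := Finset.univ) (f := key) (w := w) (b := δ / (2 * m + 4) ^ (m + 1))
    (fun i _ => Finset.mem_univ _) ⟨fun _ => 0, Finset.mem_univ _⟩ (by
      rw [nsmul_eq_mul, Finset.card_univ, hcard, mul_div_cancel₀ _ hL.ne']
      exact hXδ)
  have hpos : 0 < ∑ i ∈ X with key i = c, w i := lt_of_lt_of_le (by positivity) hc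
  obtain ⟨i₀, hi₀, -⟩ := Finset.exists_ne_zero_of_sum_ne_zero hpos.ne'
  rw [Finset.mem_filter] at hi₀
  refine ⟨i₀, hi₀.1, hc.trans (Finset.sum_le_sum_of_subset_of_nonneg ?_ fun i _ _ => hw i)⟩
  intro i hi
  rw [Finset.mem_filter] at hi ⊢
  exact ⟨hi.1, hkey_eq i hi.1 i₀ hi₀.1 (hi.2.trans hi₀.2.symm)⟩

lemma exists_linear_ge_of_two_pow_le {η : ℝ} (hη : 0 < η) :
    ∃ B : ℕ, ∀ b n : ℕ, B ≤ b → 2 ^ n ≤ 2 * b ^ 2 → 1 + 7 * (n : ℝ) ≤ η * b := by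
  have h1 : Tendsto (fun b : ℕ => (8 + 14 * Real.logb 2 b) / (b : ℝ)) atTop (nhds 0) := by
    have h2 : Tendsto (fun b : ℝ => 8 * b⁻¹ + 14 / Real.log 2 * (Real.log b / b)) atTop (nhds 0) := by
      have h3 : Tendsto (fun b : ℝ => Real.log b / b) atTop (nhds 0) :=
        (Real.isLittleO_log_id_atTop).tendsto_div_nhds_zero
      simpa using (tendsto_inv_atTop_zero.const_mul 8).add (h3.const_mul (14 / Real.log 2))
    refine (h2.comp tendsto_natCast_atTop_atTop).congr fun b => ?_
    simp only [Function.comp, Real.logb]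
    ring
  obtain ⟨B, hB⟩ := ((h1.eventually_lt_const hη).and (eventually_ge_atTop 1)).exists_forall_of_atTop
  refine ⟨B, fun b n hb hn => ?_⟩
  obtain ⟨h2, h3⟩ := hB b hb
  have hb0 : (0 : ℝ) < b := by exact_mod_cast h3
  rw [div_lt_iff₀ hb0] at h2
  have h4 : (n : ℝ) ≤ 1 + 2 * Real.logb 2 b := by
    have h5 : (2 : ℝ) ^ (n : ℝ) ≤ 2 * b ^ 2 := by
      rw [Real.rpow_natCast]; exact_mod_cast hn
    have h6 := (Real.le_logb_iff_rpow_le (b := 2) (by norm_num) (by positivity)).2 h5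
    rw [Real.logb_mul (by norm_num) (by positivity), Real.logb_self_eq_one (by norm_num),
      Real.logb_pow] at h6
    exact_mod_cast h6
  linarith

open Classical in
/-- A Frostman configuration spans, from some pin of another one, many distances at some scale. -/
theorem exists_card_image_ge {s t lam η C c R : ℝ} (hs : 1 < s) (ht : 1 < t) (hlam : 0 < lam)
    (hlc : (1 / 2 - (s - 1) - 2 * lam) ^ 2 < 2 * (1 + (s - 1)) * lam) (hη : 0 < η) (hC : 0 ≤ C)
    (hc : 0 < c) (T : Finset (ℤ × ℤ)) (B : ℕ) :
    ∃ N : ℕ, ∀ (ι κ : Type) [Fintype ι] [Fintype κ] (w : ι → ℝ) (x : ι → Plane) (ν : κ → ℝ)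
      (y : κ → Plane) (A : κ → Finset ι), IsFrostman w x C s N → IsFrostman ν y C t N →
      (∀ i k, dist (x i) (y k) ≤ R) → (∀ i, (x i).cell 0 ∈ T) → c ≤ ∑ k, ν k →
      (∀ k, c ≤ ∑ i ∈ A k, w i) → (∀ k, ∀ i ∈ A k, c ≤ dist (x i) (y k)) →
      ∃ k, ∃ n : ℕ, B ≤ n ∧ n ≤ N ∧ (2 : ℝ) ^ (n * (1 - lam - η)) ≤
        ((A k).image fun i => ⌊(2 : ℝ) ^ (n : ℝ) * dist (x i) (y k)⌋).card := by
  obtain ⟨B₀, hB₀⟩ := exists_linear_ge_of_two_pow_le hη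
  obtain ⟨m, hm1, hm⟩ := exists_scaleChain (by linarith) hlam hlc (max B₀ 1)
  obtain ⟨C', γ, hC', hγ, hheavy⟩ := exists_heavy_mass_le (K := R) hs ht hC hc
  obtain ⟨c₁, hc₁⟩ : ∃ c₁ : ℕ, R * (R + 2) ≤ 2 ^ (c₁ : ℝ) := by
    obtain ⟨n, hn⟩ := pow_unbounded_of_one_lt (R * (R + 2)) (one_lt_two)
    exact ⟨n, by rw [Real.rpow_natCast]; exact hn.le⟩
  have hbig : ∀ Y : ℝ, ∀ᶠ M : ℕ in atTop, Y ≤ (2 : ℝ) ^ (M : ℝ) := fun Y => by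
    simp_rw [Real.rpow_natCast]
    exact (tendsto_pow_atTop_atTop_of_one_lt one_lt_two).eventually_ge_atTop Y
  have hsmall : Tendsto (fun M : ℕ => (2 : ℝ) ^ (-(M : ℝ))) atTop (nhds 0) := by
    refine (tendsto_pow_atTop_nhds_zero_of_lt_one (r := (1 / 2 : ℝ)) (by norm_num)
      (by norm_num)).congr fun M => ?_
    rw [Real.rpow_neg (by norm_num), Real.rpow_natCast, one_div, inv_pow]
  have hsmall' : Tendsto (fun M : ℕ => (((m * M : ℕ) : ℝ) + 1) * (C' * ((2 : ℝ) ^ (M : ℝ)) ^ (-γ)))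
      atTop (nhds 0) := by
    have hr : |(2 : ℝ) ^ (-γ)| < 1 := by
      rw [abs_of_pos (by positivity)]
      exact Real.rpow_lt_one_of_one_lt_of_neg (by norm_num) (by linarith)
    have h1 := (tendsto_pow_const_mul_const_pow_of_abs_lt_one 1 hr).const_mul (m * C')
    have h2 := (tendsto_pow_const_mul_const_pow_of_abs_lt_one 0 hr).const_mul C'
    have h3 := h1.add h2
    simp only [mul_zero, add_zero] at h3
    refine h3.congr fun M => ?_
    have h4 : ((2 : ℝ) ^ (M : ℝ)) ^ (-γ) = ((2 : ℝ) ^ (-γ)) ^ M := by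
      rw [← Real.rpow_natCast, ← Real.rpow_mul (by norm_num), ← Real.rpow_mul (by norm_num),
        mul_comm]
    rw [h4]
    push_cast
    ring
  have hmass : Tendsto (fun M : ℕ => ((T.card : ℝ) + (m + 1) ^ 2 + (2 * m + 1) ^ 3) *
      2 ^ (-(M : ℝ)) + (((m * M : ℕ) : ℝ) + 1) * (C' * ((2 : ℝ) ^ (M : ℝ)) ^ (-γ))) atTop (nhds 0) := by
    simpa using (hsmall.const_mul ((T.card : ℝ) + (m + 1) ^ 2 + (2 * m + 1) ^ 3)).add hsmall'
  have hclass : Tendsto (fun M : ℕ => 2 * (m : ℝ) ^ 2 * 2 ^ (-(M : ℝ))) atTop (nhds 0) := by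
    simpa using hsmall.const_mul (2 * (m : ℝ) ^ 2)
  obtain ⟨M, hM3, hMB, hMm, hMC, hMmass, hMclass⟩ := ((eventually_ge_atTop 3).and
    ((eventually_ge_atTop B).and ((hbig (25 * (m + 1) * 2 ^ (c₁ : ℝ))).and
    ((hbig (C * 2 ^ s)).and ((hmass.eventually_lt_const (u := c ^ 2 / 2) (by positivity)).and
    (hclass.eventually_lt_const (u := c ^ 2 / 2 / (2 * m + 4) ^ (m + 1))
      (by positivity))))))).exists
  have hM0 : 0 < M := by omega
  refine ⟨m * M, fun ι κ _ _ w x ν y A hw hν hR hT hνc hA hAc => ?_⟩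
  set S : Finset (ι × κ) := Finset.univ.filter fun p => p.1 ∈ A p.2 with hS
  have hbad := sum_not_isGoodPair_le (x := x) (y := y) hw.nonneg hw.sum_le hν.nonneg hν.sum_le hc₁ hR hM0
    hMm le_rfl T hT S (δ := C' * ((2 : ℝ) ^ (M : ℝ)) ^ (-γ)) (fun j hj =>
      hheavy ι κ w x ν y (m * M) j (2 ^ (M : ℝ)) _ hw hν hj (by positivity) hR
        (fun p hp => hAc _ _ (Finset.mem_filter.1 (Finset.mem_filter.1 hp).1).2)
        (fun p hp => (Finset.mem_filter.1 hp).2.le))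
  have htotal : c ^ 2 ≤ ∑ p ∈ S, w p.1 * ν p.2 := by
    rw [hS, Finset.sum_filter, Fintype.sum_prod_type_right]
    have h1 : ∀ k, c * ν k ≤ ∑ i, if i ∈ A k then w i * ν k else 0 := by
      intro k
      rw [← Finset.sum_filter, Finset.filter_mem_eq_inter, Finset.univ_inter, ← Finset.sum_mul]
      exact mul_le_mul_of_nonneg_right (hA k) (hν.nonneg k)
    refine le_trans ?_ (Finset.sum_le_sum fun k _ => h1 k)
    rw [← Finset.mul_sum, sq]
    exact mul_le_mul_of_nonneg_left hνc hc.le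
  set Z : κ → Finset ι := fun k => (A k).filter fun i => IsGoodPair w x ν y (m * M) M m i k with hZ
  have hgood : ∑ p ∈ S with IsGoodPair w x ν y (m * M) M m p.1 p.2, w p.1 * ν p.2 =
      ∑ k, (∑ i ∈ Z k, w i) * ν k := by
    rw [hS, Finset.filter_filter, Finset.sum_filter, Fintype.sum_prod_type_right]
    refine Finset.sum_congr rfl fun k _ => ?_
    rw [Finset.sum_mul, hZ]
    simp only [Finset.sum_filter]
    rw [← Finset.sum_filter]
    rw [← Finset.sum_filter]
    refine Finset.sum_congr ?_ fun _ _ => rfl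
    ext i
    simp
  obtain ⟨k, hk⟩ : ∃ k, c ^ 2 / 2 ≤ ∑ i ∈ Z k, w i := by
    by_contra! hcon
    have h1 : ∑ k, (∑ i ∈ Z k, w i) * ν k ≤ ∑ k, c ^ 2 / 2 * ν k :=
      Finset.sum_le_sum fun k _ => mul_le_mul_of_nonneg_right (hcon k).le (hν.nonneg k)
    rw [← Finset.mul_sum] at h1
    have h2 : c ^ 2 / 2 * ∑ k, ν k ≤ c ^ 2 / 2 :=
      mul_le_of_le_one_right (by positivity) hν.sum_le
    have h3 := Finset.sum_filter_add_sum_filter_not S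
      (fun p => IsGoodPair w x ν y (m * M) M m p.1 p.2) (fun p => w p.1 * ν p.2)
    linarith
  have hZgood : ∀ i ∈ Z k, IsGoodPair w x ν y (m * M) M m i k := fun i hi =>
    (Finset.mem_filter.1 hi).2
  obtain ⟨i₀, hi₀, hmass₀⟩ := exists_profile_class hw.nonneg hw.sum_le hM0 (Z k)
    (fun i hi => (hZgood i hi).regular) (by positivity) hk
  obtain ⟨b, l, hBb, hbm, hl, hchain⟩ := hm _ (hw.isProfile hM0 hm1 hMC le_rfl
    (hZgood i₀ hi₀).regular)
  obtain ⟨n, l', hN, hl', hn⟩ := hchain.exists_short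
  have hnm : (n : ℝ) ≤ 2 * m ^ 2 := by
    have h1 : n ≤ 2 * m ^ 2 := (Nat.lt_two_pow_self).le.trans (hn.trans (by gcongr))
    exact_mod_cast h1
  have hcard := card_image_ge_of_isGoodPair (N := m * M) (k := k) hw.nonneg hw.sum_le hM3 hN hbm
    ((Z k).filter fun i => ∀ j ≤ m, profile w x M j i = profile w x M j i₀)
    (fun i hi => hZgood i (Finset.mem_filter.1 hi).1)
    (fun i hi => (Finset.mem_filter.1 hi).2) (by
      refine lt_of_lt_of_le (lt_of_le_of_lt ?_ hMclass) hmass₀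
      gcongr)
  refine ⟨k, b * M, ?_, Nat.mul_le_mul_right M hbm, ?_⟩
  · have : 1 ≤ b := le_trans (le_max_right _ _) hBb
    nlinarith
  · push_cast
    refine le_trans ?_ (hcard.trans ?_)
    · apply Real.rpow_le_rpow_of_exponent_le (by norm_num)
      have h1 := hB₀ b n (le_trans (le_max_left _ _) hBb) hn
      have hM' : (0 : ℝ) < M := by exact_mod_cast hM0
      have h2 : (b : ℝ) * (1 - lam - η) ≤ b - 1 - l' - 7 * n := by linarith
      have := mul_le_mul_of_nonneg_left h2 hM'.le
      linarith
    · have : ((Z k).filter fun i => ∀ j ≤ m, profile w x M j i = profile w x M j i₀) ⊆ A k :=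
        (Finset.filter_subset _ _).trans (Finset.filter_subset _ _)
      exact_mod_cast Finset.card_le_card (Finset.image_subset_image this)

/-- The dyadic square with the given level and position. -/
def dyadicSquare (p : ℕ × ℤ × ℤ) : Set Plane := {x | x.cell p.1 = p.2}

/-- The gauge of the `t`-dimensional dyadic content. -/
noncomputable def netGauge (t : ℝ) (n : ℕ) : ℝ≥0∞ := ENNReal.ofReal (2 ^ (-(n * t)))

/-- The cost of a family of dyadic squares. -/
noncomputable def netCost (t : ℝ) (C : Set (ℕ × ℤ × ℤ)) : ℝ≥0∞ :=
  ∑' p, C.indicator (fun p => netGauge t p.1) p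

/-- The `t`-dimensional dyadic content. -/
noncomputable def netContent (t : ℝ) (E : Set Plane) : ℝ≥0∞ :=
  ⨅ (C : Set (ℕ × ℤ × ℤ)) (_ : E ⊆ ⋃ p ∈ C, dyadicSquare p), netCost t C

lemma netContent_le_netCost {t : ℝ} {E : Set Plane} {C : Set (ℕ × ℤ × ℤ)}
    (h : E ⊆ ⋃ p ∈ C, dyadicSquare p) : netContent t E ≤ netCost t C :=
  iInf₂_le C h

lemma exists_netCost_lt {t : ℝ} {E : Set Plane} {u : ℝ≥0∞} (h : netContent t E < u) :
    ∃ C : Set (ℕ × ℤ × ℤ), E ⊆ ⋃ p ∈ C, dyadicSquare p ∧ netCost t C < u := by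
  simpa only [netContent, iInf_lt_iff, exists_prop] using h

lemma netContent_mono (t : ℝ) {E F : Set Plane} (h : E ⊆ F) : netContent t E ≤ netContent t F :=
  le_iInf₂ fun _ hC => netContent_le_netCost (h.trans hC)

lemma netCost_add_of_disjoint (t : ℝ) {C C' : Set (ℕ × ℤ × ℤ)} (h : Disjoint C C') :
    netCost t (C ∪ C') = netCost t C + netCost t C' := by
  rw [netCost, netCost, netCost, ← ENNReal.tsum_add]
  exact tsum_congr fun p => congrFun (indicator_union_of_disjoint h _) p

lemma netCost_mono (t : ℝ) {C C' : Set (ℕ × ℤ × ℤ)} (h : C ⊆ C') : netCost t C ≤ netCost t C' :=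
  ENNReal.tsum_le_tsum fun _ => indicator_le_indicator_of_subset h (fun _ => bot_le) _

lemma netCost_finset (t : ℝ) (D : Finset (ℕ × ℤ × ℤ)) :
    netCost t D = ∑ p ∈ D, netGauge t p.1 := by
  rw [netCost, ← tsum_subtype, Finset.tsum_subtype' D (fun p => netGauge t p.1)]

lemma netContent_le_add (t : ℝ) {E F G : Set Plane} (h : E ⊆ F ∪ G) :
    netContent t E ≤ netContent t F + netContent t G := by
  refine ENNReal.le_of_forall_pos_le_add fun ε hε hfin => ?_
  have hε' : (ε / 2 : ℝ≥0∞) ≠ 0 := by simpa using hε.ne'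
  obtain ⟨h1, h2⟩ := ENNReal.add_lt_top.1 hfin
  obtain ⟨C, hC, hC'⟩ := exists_netCost_lt (ENNReal.lt_add_right h1.ne hε')
  obtain ⟨D, hD, hD'⟩ := exists_netCost_lt (ENNReal.lt_add_right h2.ne hε')
  calc netContent t E ≤ netCost t (C ∪ D \ C) := by
        refine netContent_le_netCost (h.trans ?_)
        rw [union_sdiff_self, biUnion_union]
        exact union_subset_union hC hD
    _ = netCost t C + netCost t (D \ C) := netCost_add_of_disjoint t disjoint_sdiff_right
    _ ≤ (netContent t F + ε / 2) + (netContent t G + ε / 2) :=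
        add_le_add hC'.le ((netCost_mono t sdiff_subset).trans hD'.le)
    _ = netContent t F + netContent t G + ε := by
        rw [add_add_add_comm, ENNReal.add_halves]

lemma netContent_le_sum_add (t : ℝ) (E : Set Plane) (D : Finset (ℕ × ℤ × ℤ)) :
    netContent t E ≤ ∑ p ∈ D, netContent t (E ∩ dyadicSquare p) +
      netContent t (E \ ⋃ p ∈ D, dyadicSquare p) := by
  classical
  induction D using Finset.induction_on with
  | empty => simp
  | insert p D hp ih =>
    rw [Finset.sum_insert hp]
    refine ih.trans ?_
    have : netContent t (E \ ⋃ p ∈ D, dyadicSquare p) ≤ netContent t (E ∩ dyadicSquare p) +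
        netContent t (E \ ⋃ q ∈ insert p D, dyadicSquare q) := by
      refine netContent_le_add t fun x hx => ?_
      by_cases h : x ∈ dyadicSquare p
      · exact Or.inl ⟨hx.1, h⟩
      · refine Or.inr ⟨hx.1, ?_⟩
        rw [Finset.set_biUnion_insert]
        exact fun h' => h'.elim h hx.2
    calc _ ≤ _ := add_le_add_right this _
      _ = _ := by ring

/-- Finite subfamilies of an almost optimal cover are almost optimal. -/
lemma sum_netGauge_le {t : ℝ} {E : Set Plane} {C : Set (ℕ × ℤ × ℤ)} {ε : ℝ≥0∞}
    (hfin : netContent t E ≠ ⊤) (hε : ε ≠ ⊤) (hC : E ⊆ ⋃ p ∈ C, dyadicSquare p)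
    (hcost : netCost t C ≤ netContent t E + ε) (D : Finset (ℕ × ℤ × ℤ)) (hD : ↑D ⊆ C) :
    ∑ p ∈ D, netGauge t p.1 ≤ ∑ p ∈ D, netContent t (E ∩ dyadicSquare p) + ε := by
  have h1 : netCost t C = ∑ p ∈ D, netGauge t p.1 + netCost t (C \ D) := by
    rw [← netCost_finset, ← netCost_add_of_disjoint t disjoint_sdiff_right, union_sdiff_cancel hD]
  have h2 : netContent t (E \ ⋃ p ∈ D, dyadicSquare p) ≤ netCost t (C \ D) := by
    refine netContent_le_netCost fun x hx => ?_
    obtain ⟨p, hp, hxp⟩ := mem_iUnion₂.1 (hC hx.1)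
    exact mem_iUnion₂.2 ⟨p, ⟨hp, fun h => hx.2 (mem_iUnion₂.2 ⟨p, h, hxp⟩)⟩, hxp⟩
  have h3 := netContent_le_sum_add t E D
  have hfin' : netCost t (C \ D) ≠ ⊤ :=
    (((netCost_mono t sdiff_subset).trans hcost).trans_lt
      (ENNReal.add_lt_top.2 ⟨hfin.lt_top, hε.lt_top⟩)).ne
  rw [← ENNReal.add_le_add_iff_right hfin', ← h1]
  calc _ ≤ _ := hcost
    _ ≤ _ := add_le_add_left (h3.trans (add_le_add_right h2 _)) _
    _ = _ := by ring

lemma exists_pos_add_le {n : ℕ} {f g : ℕ → ℝ≥0∞} (h : ∀ a < n, f a < g a) :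
    ∃ δ : ℝ≥0∞, 0 < δ ∧ ∀ a < n, f a + δ ≤ g a := by
  induction n with
  | zero => exact ⟨1, one_pos, by simp⟩
  | succ n ih =>
    obtain ⟨δ, hδ, hδ'⟩ := ih fun a ha => h a (by omega)
    refine ⟨min δ (g n - f n), lt_min hδ (tsub_pos_of_lt (h n (by omega))), fun a ha => ?_⟩
    rcases Nat.lt_succ_iff_lt_or_eq.1 ha with h1 | rfl
    · exact (add_le_add_right (min_le_left _ _) _).trans (hδ' a h1)
    · refine (add_le_add_right (min_le_right _ _) _).trans (le_of_eq ?_)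
      exact add_tsub_cancel_of_le (h a (by omega)).le

/-- The content is additive over a square none of whose ancestors is saturated. -/
lemma netContent_inter_add_diff_le {t : ℝ} {F : Set Plane} (p : ℕ × ℤ × ℤ)
    (h : ∀ x ∈ F ∩ dyadicSquare p, ∀ a < p.1,
      netContent t (F ∩ dyadicSquare (a, x.cell a)) < netGauge t a) :
    netContent t (F ∩ dyadicSquare p) + netContent t (F \ dyadicSquare p) ≤ netContent t F := by
  rcases (F ∩ dyadicSquare p).eq_empty_or_nonempty with he | ⟨x, hx⟩
  · have h0 : netContent t (F ∩ dyadicSquare p) = 0 := by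
      refine le_antisymm ?_ (bot_le)
      rw [he]
      refine (netContent_le_netCost (C := ∅) (empty_subset _)).trans ?_
      simp [netCost]
    rw [h0, zero_add]
    exact netContent_mono t sdiff_subset
  obtain ⟨δ, hδ, hδ'⟩ := exists_pos_add_le (h x hx)
  refine le_of_forall_gt_imp_ge_of_dense fun u hu => ?_
  obtain ⟨C, hC, hCu⟩ := exists_netCost_lt (lt_min hu (ENNReal.lt_add_right hu.ne_top hδ.ne'))
  rw [lt_min_iff] at hCu
  have hno : ∀ a < p.1, (a, x.cell a) ∉ C := by
    intro a ha hmem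
    set r : ℕ × ℤ × ℤ := (a, x.cell a) with hr
    have h1 : netCost t C = netGauge t a + netCost t (C \ {r}) := by
      have := netCost_add_of_disjoint t (disjoint_sdiff_right : Disjoint {r} (C \ {r}))
      rw [union_sdiff_cancel (singleton_subset_iff.2 hmem)] at this
      rw [this, ← Finset.coe_singleton, netCost_finset, Finset.sum_singleton]
    have h2 : netContent t F ≤ netContent t (F ∩ dyadicSquare r) + netCost t (C \ {r}) := by
      refine (netContent_le_add t (inter_union_sdiff F (dyadicSquare r)).ge).trans ?_
      refine add_le_add_right (netContent_le_netCost fun y hy => ?_) _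
      obtain ⟨q, hq, hyq⟩ := mem_iUnion₂.1 (hC hy.1)
      refine mem_iUnion₂.2 ⟨q, ⟨hq, fun he => hy.2 ?_⟩, hyq⟩
      rw [mem_singleton_iff] at he
      rwa [← he]
    refine absurd hCu.2 (not_lt.2 ?_)
    rw [h1]
    calc netContent t F + δ ≤ netContent t (F ∩ dyadicSquare r) + netCost t (C \ {r}) + δ :=
          add_le_add_left h2 _
      _ = (netContent t (F ∩ dyadicSquare r) + δ) + netCost t (C \ {r}) := by ring
      _ ≤ _ := add_le_add_left (hδ' a ha) _
  set C₁ : Set (ℕ × ℤ × ℤ) := {r | r ∈ C ∧ (dyadicSquare r ∩ dyadicSquare p).Nonempty} with hC₁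
  have h1 : netContent t (F ∩ dyadicSquare p) ≤ netCost t C₁ := by
    refine netContent_le_netCost fun y hy => ?_
    obtain ⟨q, hq, hyq⟩ := mem_iUnion₂.1 (hC hy.1)
    exact mem_iUnion₂.2 ⟨q, ⟨hq, y, hyq, hy.2⟩, hyq⟩
  have h2 : netContent t (F \ dyadicSquare p) ≤ netCost t (C \ C₁) := by
    refine netContent_le_netCost fun y hy => ?_
    obtain ⟨q, hq, hyq⟩ := mem_iUnion₂.1 (hC hy.1)
    refine mem_iUnion₂.2 ⟨q, ⟨hq, fun hq1 => hy.2 ?_⟩, hyq⟩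
    obtain ⟨-, z, hzq, hzp⟩ := hq1
    have hle : p.1 ≤ q.1 := by
      by_contra! hlt
      refine hno q.1 hlt ?_
      have : x.cell q.1 = q.2 :=
        (Plane.cell_eq_of_le hlt.le (hx.2.trans hzp.symm : x.cell p.1 = z.cell p.1)).trans hzq
      rw [this]
      exact hq
    exact (Plane.cell_eq_of_le hle (hyq.trans hzq.symm : y.cell q.1 = z.cell q.1)).trans hzp
  calc _ ≤ netCost t C₁ + netCost t (C \ C₁) := add_le_add h1 h2
    _ = netCost t C := by
        rw [← netCost_add_of_disjoint t disjoint_sdiff_right, union_sdiff_cancel fun r hr => hr.1]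
    _ ≤ u := hCu.1.le

lemma sum_netContent_inter_le {t : ℝ} (D : Finset (ℕ × ℤ × ℤ)) (F : Set Plane)
    (hdisj : (D : Set (ℕ × ℤ × ℤ)).PairwiseDisjoint dyadicSquare)
    (h : ∀ p ∈ D, ∀ x ∈ F ∩ dyadicSquare p, ∀ a < p.1,
      netContent t (F ∩ dyadicSquare (a, x.cell a)) < netGauge t a) :
    ∑ p ∈ D, netContent t (F ∩ dyadicSquare p) ≤ netContent t F := by
  classical
  induction D using Finset.induction_on generalizing F with
  | empty => simp
  | insert p D hp ih =>
    rw [Finset.sum_insert hp]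
    refine le_trans (add_le_add_right ?_ _)
      (netContent_inter_add_diff_le p (h p (Finset.mem_insert_self _ _)))
    have hsub : (D : Set (ℕ × ℤ × ℤ)) ⊆ ↑(insert p D) := by simp
    refine le_trans (le_of_eq (Finset.sum_congr rfl fun q hq => ?_))
      (ih (F \ dyadicSquare p) (hdisj.subset hsub) fun q hq x hx a ha => ?_)
    · have hd : Disjoint (dyadicSquare q) (dyadicSquare p) :=
        hdisj (hsub hq) (by simp) fun he => hp (he ▸ hq)
      congr 1
      ext x
      exact ⟨fun hx => ⟨⟨hx.1, disjoint_left.1 hd hx.2⟩, hx.2⟩, fun hx => ⟨hx.1.1, hx.2⟩⟩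
    · exact (netContent_mono t (inter_subset_inter_left _ sdiff_subset)).trans_lt
        (h q (Finset.mem_insert_of_mem hq) x ⟨hx.1.1, hx.2⟩ a ha)

/-- The dyadic content is continuous along increasing sequences of arbitrary sets. -/
theorem netContent_iUnion_le {t : ℝ} {E : ℕ → Set Plane} (hE : Monotone E) {a : ℝ≥0∞}
    (ha : ∀ n, netContent t (E n) ≤ a) : netContent t (⋃ n, E n) ≤ a := by
  classical
  refine ENNReal.le_of_forall_pos_le_add fun ε hε hfin => ?_
  obtain ⟨e, he0, he⟩ := ENNReal.exists_pos_sum_of_countable (ENNReal.coe_ne_zero.2 hε.ne') ℕ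
  have hEfin : ∀ n, netContent t (E n) ≠ ⊤ := fun n => ((ha n).trans_lt hfin).ne
  have hcov : ∀ n, ∃ C : Set (ℕ × ℤ × ℤ), E n ⊆ ⋃ p ∈ C, dyadicSquare p ∧
      netCost t C < netContent t (E n) + e n := fun n =>
    exists_netCost_lt (ENNReal.lt_add_right (hEfin n) (ENNReal.coe_ne_zero.2 (he0 n).ne'))
  choose C hC hCcost using hcov
  set S : Set (ℕ × ℤ × ℤ) := {p | netGauge t p.1 ≤ ⨆ n, netContent t (E n ∩ dyadicSquare p)} with hS
  set U : Set (ℕ × ℤ × ℤ) := S ∪ ⋃ n, C n with hU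
  set D : Set (ℕ × ℤ × ℤ) :=
    {p | p ∈ U ∧ ∀ x ∈ dyadicSquare p, ∀ a < p.1, (a, x.cell a) ∉ U} with hD
  have hcover : ⋃ n, E n ⊆ ⋃ p ∈ D, dyadicSquare p := by
    intro x hx
    obtain ⟨n, hn⟩ := mem_iUnion.1 hx
    obtain ⟨p, hp, hxp⟩ := mem_iUnion₂.1 (hC n hn)
    have hex : ∃ j, (j, x.cell j) ∈ U := by
      refine ⟨p.1, Or.inr (mem_iUnion.2 ⟨n, ?_⟩)⟩
      have : x.cell p.1 = p.2 := hxp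
      rw [this]
      exact hp
    refine mem_iUnion₂.2 ⟨(Nat.find hex, x.cell (Nat.find hex)),
      ⟨Nat.find_spec hex, fun y hy a ha => ?_⟩, rfl⟩
    rw [Plane.cell_eq_of_le (le_of_lt ha) (show y.cell _ = x.cell _ from hy)]
    exact Nat.find_min hex ha
  refine (netContent_le_netCost hcover).trans ?_
  rw [netCost, ENNReal.tsum_eq_iSup_sum]
  refine iSup_le fun P => ?_
  have hPD : ∑ p ∈ P, D.indicator (fun p => netGauge t p.1) p =
      ∑ p ∈ P with p ∈ D, netGauge t p.1 := by
    rw [Finset.sum_filter]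
    exact Finset.sum_congr rfl fun p _ => by rw [indicator_apply]
  rw [hPD]
  set D' := P.filter fun p => p ∈ D with hD'
  have hD'D : ∀ p ∈ D', p ∈ D := fun p hp => (Finset.mem_filter.1 hp).2
  set G : ℕ × ℤ × ℤ → ℝ≥0∞ := fun p => ⨆ n, netContent t (E n ∩ dyadicSquare p) with hG
  have hsat : ∑ p ∈ D' with p ∈ S, netGauge t p.1 ≤ ∑ p ∈ D' with p ∈ S, G p :=
    Finset.sum_le_sum fun p hp => (Finset.mem_filter.1 hp).2
  have hunsat : ∑ p ∈ D' with p ∉ S, netGauge t p.1 ≤ ∑ p ∈ D' with p ∉ S, G p + ε := by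
    have hidx : ∀ p, ∃ n, p ∈ D' → p ∉ S → p ∈ C n := by
      intro p
      by_cases h : p ∈ D' ∧ p ∉ S
      · obtain ⟨n, hn⟩ := mem_iUnion.1 ((hD'D p h.1).1.resolve_left h.2)
        exact ⟨n, fun _ _ => hn⟩
      · exact ⟨0, fun h1 h2 => absurd ⟨h1, h2⟩ h⟩
    choose idx hidx using hidx
    set Q := D'.filter fun p => p ∉ S with hQ
    have hmaps : ∀ p ∈ Q, idx p ∈ Q.image idx := fun p hp => Finset.mem_image_of_mem _ hp
    rw [← Finset.sum_fiberwise_of_maps_to hmaps, ← Finset.sum_fiberwise_of_maps_to hmaps]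
    calc _ ≤ ∑ n ∈ Q.image idx, (∑ p ∈ Q with idx p = n, G p + e n) := by
          refine Finset.sum_le_sum fun n _ => ?_
          refine (sum_netGauge_le (hEfin n) ENNReal.coe_ne_top (hC n) (hCcost n).le _ ?_).trans ?_
          · intro p hp
            have hp' := Finset.mem_filter.1 (Finset.mem_coe.1 hp)
            have hp'' := Finset.mem_filter.1 hp'.1
            rw [← hp'.2]
            exact hidx p hp''.1 hp''.2
          · exact add_le_add_left (Finset.sum_le_sum fun p _ =>
              le_iSup (fun n => netContent t (E n ∩ dyadicSquare p)) n) _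
      _ ≤ _ := by
          rw [Finset.sum_add_distrib]
          exact add_le_add_right ((ENNReal.sum_le_tsum _).trans he.le) _
  have hmain : ∑ p ∈ D', G p ≤ a := by
    change ∑ p ∈ D', ⨆ n, netContent t (E n ∩ dyadicSquare p) ≤ a
    rw [ENNReal.finsetSum_iSup_of_monotone (f := fun p n => netContent t (E n ∩ dyadicSquare p))
      fun p m n hmn => netContent_mono t (inter_subset_inter_left _ (hE hmn))]
    refine iSup_le fun m => (sum_netContent_inter_le D' (E m) ?_ ?_).trans (ha m)
    · intro p hp q hq hpq
      refine disjoint_left.2 fun x hxp hxq => ?_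
      have hp' : (p.1, x.cell p.1) = p := Prod.ext rfl hxp
      have hq' : (q.1, x.cell q.1) = q := Prod.ext rfl hxq
      rcases lt_trichotomy p.1 q.1 with h | h | h
      · exact (hD'D q hq).2 x hxq _ h (hp'.symm ▸ (hD'D p hp).1)
      · exact hpq (by rw [← hp', ← hq', h])
      · exact (hD'D p hp).2 x hxp _ h (hq'.symm ▸ (hD'D q hq).1)
    · intro p hp x hx j hj
      have h1 : (j, x.cell j) ∉ S := fun h => (hD'D p hp).2 x hx.2 j hj (Or.inl h)
      exact (le_iSup (fun n => netContent t (E n ∩ dyadicSquare (j, x.cell j))) m).trans_lt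
        (not_le.1 h1)
  calc _ = ∑ p ∈ D' with p ∈ S, netGauge t p.1 + ∑ p ∈ D' with p ∉ S, netGauge t p.1 :=
        (Finset.sum_filter_add_sum_filter_not _ _ _).symm
    _ ≤ ∑ p ∈ D' with p ∈ S, G p + (∑ p ∈ D' with p ∉ S, G p + ε) := add_le_add hsat hunsat
    _ = ∑ p ∈ D', G p + ε := by rw [← add_assoc, Finset.sum_filter_add_sum_filter_not]
    _ ≤ a + ε := add_le_add_left hmain _

/-- A set of vanishing dyadic content has vanishing Hausdorff measure. -/
lemma hausdorffMeasure_eq_zero_of_netContent {t : ℝ} (ht : 0 < t) {E : Set Plane}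
    (hE : netContent t E = 0) : μH[t] E = 0 := by
  have hcov : ∀ n : ℕ, ∃ C : Set (ℕ × ℤ × ℤ), E ⊆ ⋃ p ∈ C, dyadicSquare p ∧
      netCost t C < netGauge t n := fun n =>
    exists_netCost_lt (by rw [hE]; exact ENNReal.ofReal_pos.2 (by positivity))
  choose C hC hCcost using hcov
  have hlevel : ∀ n, ∀ p ∈ C n, n ≤ p.1 := by
    intro n p hp
    have h1 : netGauge t p.1 ≤ netCost t (C n) := by
      have := netCost_mono t (C := (({p} : Finset (ℕ × ℤ × ℤ)) : Set _)) (C' := C n) (by simpa using hp)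
      rwa [netCost_finset, Finset.sum_singleton] at this
    have h2 := h1.trans_lt (hCcost n)
    rw [netGauge, netGauge, ENNReal.ofReal_lt_ofReal_iff (by positivity),
      Real.rpow_lt_rpow_left_iff (by norm_num), neg_lt_neg_iff, mul_lt_mul_iff_left₀ ht] at h2
    exact_mod_cast h2.le
  have hdiam : ∀ p : ℕ × ℤ × ℤ,
      Metric.ediam (dyadicSquare p) ≤ ENNReal.ofReal (2 * 2 ^ (-(p.1 : ℝ))) := by
    intro p
    refine Metric.ediam_le fun x hx y hy => ?_
    rw [edist_dist]
    exact ENNReal.ofReal_le_ofReal (Plane.dist_le_of_cell_eq (hx.trans hy.symm))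
  have hlim : ∀ u : ℝ, 0 < u → ∀ c : ℝ,
      Tendsto (fun n : ℕ => ENNReal.ofReal (c * 2 ^ (-(n * u)))) atTop (nhds 0) := by
    intro u hu c
    have h1 : Tendsto (fun n : ℕ => c * ((2 : ℝ) ^ (-u)) ^ n) atTop (nhds 0) := by
      simpa using (tendsto_pow_atTop_nhds_zero_of_lt_one (by positivity)
        (Real.rpow_lt_one_of_one_lt_of_neg one_lt_two (by linarith : -u < 0))).const_mul c
    have h2 := ENNReal.tendsto_ofReal h1
    rw [ENNReal.ofReal_zero] at h2
    refine h2.congr fun n => ?_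
    rw [← Real.rpow_natCast, ← Real.rpow_mul (by norm_num)]
    congr 3
    ring
  have hmain := Measure.hausdorffMeasure_le_liminf_tsum (ι := fun n => C n) t E
    (fun n => ENNReal.ofReal (2 * 2 ^ (-((n : ℝ) * 1)))) (hlim 1 one_pos 2)
    (fun n p => dyadicSquare p) (Eventually.of_forall fun n p => (hdiam _).trans
      (ENNReal.ofReal_le_ofReal (by
        have : (n : ℝ) ≤ (p : ℕ × ℤ × ℤ).1 := by exact_mod_cast hlevel n _ p.2
        rw [mul_one]
        gcongr
        norm_num)))
    (Eventually.of_forall fun n => by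
      rw [iUnion_subtype]
      exact hC n)
  refine le_antisymm (hmain.trans ?_) (bot_le)
  have hbound : ∀ n : ℕ, ∑' p : C n, Metric.ediam (dyadicSquare p) ^ t ≤
      ENNReal.ofReal (2 ^ t * 2 ^ (-(n * t))) := by
    intro n
    calc ∑' p : C n, Metric.ediam (dyadicSquare p) ^ t
        ≤ ∑' p : C n, ENNReal.ofReal (2 ^ t) * netGauge t (p : ℕ × ℤ × ℤ).1 := by
          refine ENNReal.tsum_le_tsum fun p => ?_
          refine (ENNReal.rpow_le_rpow (hdiam _) ht.le).trans (le_of_eq ?_)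
          rw [ENNReal.ofReal_rpow_of_nonneg (by positivity) ht.le, netGauge,
            ← ENNReal.ofReal_mul (by positivity), Real.mul_rpow (by norm_num) (by positivity),
            ← Real.rpow_mul (by norm_num), neg_mul]
      _ = ENNReal.ofReal (2 ^ t) * netCost t (C n) := by
          rw [ENNReal.tsum_mul_left, netCost, ← tsum_subtype]
      _ ≤ _ := by
          rw [ENNReal.ofReal_mul (by positivity)]
          exact mul_le_mul_right (hCcost n).le _
  refine (liminf_le_liminf (Eventually.of_forall hbound)).trans ?_
  exact (hlim t ht (2 ^ t)).liminf_eq.le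

lemma Plane.finite_cells (n : ℕ) (q : ℤ × ℤ) :
    {c | ∃ p : Plane, p.cell 0 = q ∧ p.cell n = c}.Finite := by
  refine (Finset.finite_toSet (Finset.Icc (2 ^ n * q.1) (2 ^ n * (q.1 + 1)) ×ˢ
    Finset.Icc (2 ^ n * q.2) (2 ^ n * (q.2 + 1)))).subset ?_
  have key : ∀ u : ℝ, ⌊(2 : ℝ) ^ n * u⌋ ∈
      Finset.Icc (2 ^ n * ⌊(2 : ℝ) ^ 0 * u⌋) (2 ^ n * (⌊(2 : ℝ) ^ 0 * u⌋ + 1)) := by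
    intro u
    rw [pow_zero, one_mul, Finset.mem_Icc]
    constructor
    · rw [Int.le_floor]
      push_cast
      exact mul_le_mul_of_nonneg_left (Int.floor_le u) (by positivity)
    · refine Int.floor_le_iff.2 ?_
      push_cast
      have := mul_le_mul_of_nonneg_left (Int.lt_floor_add_one u).le
        (by positivity : (0 : ℝ) ≤ 2 ^ n)
      linarith
  rintro c ⟨p, rfl, rfl⟩
  exact Finset.mem_coe.2 (Finset.mem_product.2 ⟨key _, key _⟩)

open Classical in
/-- Among the weights subject to the dyadic growth condition there is one such that each point lies
in a saturated cell. -/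
lemma exists_saturated_weight {ι : Type*} [Fintype ι] (x : ι → Plane) (t : ℝ) (N : ℕ) :
    ∃ w : ι → ℝ, (∀ i, 0 ≤ w i) ∧
      (∀ i, ∀ j ≤ N, ∑ k with (x k).cell j = (x i).cell j, w k ≤ 2 ^ (-(j * t))) ∧
      ∀ i, ∃ j ≤ N, ∑ k with (x k).cell j = (x i).cell j, w k = 2 ^ (-(j * t)) := by
  set K : Set (ι → ℝ) := {w | (∀ i, 0 ≤ w i) ∧
    ∀ i, ∀ j ≤ N, ∑ k with (x k).cell j = (x i).cell j, w k ≤ 2 ^ (-(j * t))} with hK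
  have hclosed : IsClosed K := by
    have : K = (⋂ i, {w | 0 ≤ w i}) ∩ ⋂ i, ⋂ j, ⋂ (_ : j ≤ N),
        {w | ∑ k with (x k).cell j = (x i).cell j, w k ≤ 2 ^ (-(j * t))} := by
      ext w
      simp [hK]
    rw [this]
    refine (isClosed_iInter fun i => isClosed_le continuous_const (continuous_apply i)).inter
      (isClosed_iInter fun i => isClosed_iInter fun j => isClosed_iInter fun _ =>
        isClosed_le (by fun_prop) continuous_const)
  have hcomp : IsCompact K := by
    refine IsCompact.of_isClosed_subset (isCompact_Icc (a := 0)
      (b := fun _ => (2 : ℝ) ^ (-((0 : ℕ) * t)))) hclosed fun w hw => ⟨hw.1, fun i => ?_⟩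
    refine le_trans ?_ (hw.2 i 0 (Nat.zero_le _))
    exact Finset.single_le_sum (f := w) (fun k _ => hw.1 k) (by simp)
  obtain ⟨w, hw, hmax⟩ := hcomp.exists_isMaxOn
    ⟨0, fun _ => le_rfl, fun i j _ => by simpa using by positivity⟩
    (f := fun w : ι → ℝ => ∑ i, w i) (by fun_prop)
  refine ⟨w, hw.1, hw.2, fun i => ?_⟩
  by_contra! hne
  obtain ⟨j₀, hj₀, hmin⟩ := Finset.exists_min_image (Finset.range (N + 1))
    (fun j => (2 : ℝ) ^ (-(j * t)) - ∑ k with (x k).cell j = (x i).cell j, w k)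
    ⟨0, by simp⟩
  set δ := (2 : ℝ) ^ (-(j₀ * t)) - ∑ k with (x k).cell j₀ = (x i).cell j₀, w k with hδ
  have hj₀N : j₀ ≤ N := Nat.lt_succ_iff.1 (Finset.mem_range.1 hj₀)
  have hδpos : 0 < δ := sub_pos.2 (lt_of_le_of_ne (hw.2 i j₀ hj₀N) (hne j₀ hj₀N))
  have hsum : ∀ s : Finset ι, ∑ k ∈ s, (w + Pi.single i δ : ι → ℝ) k =
      ∑ k ∈ s, w k + if i ∈ s then δ else 0 := by
    intro s
    simp only [Pi.add_apply, Finset.sum_add_distrib, Pi.single_apply, Finset.sum_ite_eq']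
  have hmem : (w + Pi.single i δ : ι → ℝ) ∈ K := by
    refine ⟨fun k => add_nonneg (hw.1 k) ?_, fun l j hj => ?_⟩
    · rcases eq_or_ne k i with rfl | h
      · simpa using hδpos.le
      · simp [h]
    · rw [hsum]
      split_ifs with h
      · rw [← (Finset.mem_filter.1 h).2]
        have := hmin j (Finset.mem_range.2 (Nat.lt_succ_iff.2 hj))
        linarith
      · rw [add_zero]
        exact hw.2 l j hj
  have h1 : ∑ k, (w + Pi.single i δ : ι → ℝ) k ≤ ∑ k, w k := hmax hmem
  rw [hsum, if_pos (Finset.mem_univ i)] at h1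
  linarith

open Classical in
/-- Discrete Frostman lemma. -/
theorem exists_isFrostman {t : ℝ} {E : Set Plane} {q : ℤ × ℤ}
    (hE : ∀ p ∈ E, p.cell 0 = q) (N : ℕ) :
    ∃ (ι : Type) (_ : Fintype ι) (w : ι → ℝ) (x : ι → Plane), (∀ i, x i ∈ E) ∧
      IsFrostman w x 25 t N ∧ netContent t E ≤ ENNReal.ofReal (∑ i, w i) := by
  set ι : Type := {c : ℤ × ℤ // ∃ p ∈ E, p.cell N = c} with hι
  have hfin : Finite ι := Finite.to_subtype ((Plane.finite_cells N q).subset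
    fun c ⟨p, hp, hpc⟩ => ⟨p, hE p hp, hpc⟩)
  have := Fintype.ofFinite ι
  choose x hxE hxc using fun i : ι => i.2
  obtain ⟨w, hw0, hwle, hsat⟩ := exists_saturated_weight x t N
  refine ⟨ι, this, w, x, hxE, ⟨hw0, ?_, fun p j hj => ?_⟩, ?_⟩
  · rcases isEmpty_or_nonempty ι with h | ⟨⟨i⟩⟩
    · simp
    · have h0 := hwle i 0 (Nat.zero_le _)
      rw [Finset.filter_true_of_mem fun k _ => (hE _ (hxE k)).trans (hE _ (hxE i)).symm] at h0
      simpa using h0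
  · refine le_trans ?_ (sum_ball_le hw0 x Finset.univ j (B := 2 ^ (-(j * t))) (by positivity)
      (fun i _ => hwle i j hj) p)
    refine Finset.sum_le_sum_of_subset_of_nonneg (fun i hi => ?_) fun i _ _ => hw0 i
    have hpos : (0 : ℝ) < 2 ^ (-(j : ℝ)) := by positivity
    refine Finset.mem_filter.2 ⟨Finset.mem_univ i, (Finset.mem_filter.1 hi).2.trans (by linarith)⟩
  · set P : ι → ℕ → Prop := fun i j => j ≤ N ∧
      ∑ k with (x k).cell j = (x i).cell j, w k = 2 ^ (-(j * t)) with hP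
    have hex : ∀ i, ∃ j, P i j := hsat
    set lev : ι → ℕ := fun i => Nat.find (hex i) with hlev
    set g : ι → ℕ × ℤ × ℤ := fun i => (lev i, (x i).cell (lev i)) with hg
    have hPtrans : ∀ i k j, (x i).cell j = (x k).cell j → P k j → P i j := by
      intro i k j h h'
      refine ⟨h'.1, ?_⟩
      rw [h]
      exact h'.2
    have hgeq : ∀ i k, (x k).cell (lev i) = (x i).cell (lev i) → g k = g i := by
      intro i k h
      have h1 : lev k ≤ lev i := Nat.find_min' _ (hPtrans k i _ h (Nat.find_spec (hex i)))
      have h2 : lev i ≤ lev k := Nat.find_min' _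
        (hPtrans i k _ (Plane.cell_eq_of_le h1 h).symm (Nat.find_spec (hex k)))
      have h3 : lev k = lev i := le_antisymm h1 h2
      simp only [hg, h3, h]
    have hcov : E ⊆ ⋃ p ∈ ((Finset.univ.image g : Finset _) : Set (ℕ × ℤ × ℤ)),
        dyadicSquare p := by
      intro y hy
      set i : ι := ⟨y.cell N, y, hy, rfl⟩ with hi
      refine mem_iUnion₂.2 ⟨g i, Finset.mem_coe.2 (Finset.mem_image_of_mem g (Finset.mem_univ i)), ?_⟩
      exact Plane.cell_eq_of_le (Nat.find_spec (hex i)).1 (hxc i).symm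
    refine (netContent_le_netCost hcov).trans ?_
    rw [netCost_finset]
    simp only [netGauge]
    rw [← ENNReal.ofReal_sum_of_nonneg fun p _ => by positivity]
    refine ENNReal.ofReal_le_ofReal (le_of_eq ?_)
    rw [← Finset.sum_fiberwise_of_maps_to (t := Finset.univ.image g) (g := g)
      fun i hi => Finset.mem_image_of_mem g hi]
    refine Finset.sum_congr rfl fun p hp => ?_
    obtain ⟨i, -, rfl⟩ := Finset.mem_image.1 hp
    rw [← (Nat.find_spec (hex i)).2]
    refine Finset.sum_congr (Finset.ext fun k => ?_) fun _ _ => rfl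
    simp only [Finset.mem_filter, Finset.mem_univ, true_and]
    refine ⟨hgeq i k, fun h => ?_⟩
    have h1 : lev k = lev i := congrArg Prod.fst h
    have h2 : (x k).cell (lev k) = (x i).cell (lev i) := congrArg Prod.snd h
    rwa [h1] at h2

/-- A continuous image of the Baire space of content greater than `a` contains a compact set which
is a decreasing limit of sets of content greater than `a`. -/
lemma exists_compact_of_netContent {t : ℝ} {f : (ℕ → ℕ) → Plane} (hf : Continuous f) {a : ℝ≥0∞}
    (ha : a < netContent t (range f)) :
    ∃ (K : Set Plane) (E : ℕ → Set Plane), IsCompact K ∧ K ⊆ range f ∧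
      (∀ n, E n ⊆ range f ∧ a < netContent t (E n)) ∧
      ∀ U, IsOpen U → K ⊆ U → ∀ᶠ n in atTop, E n ⊆ U := by
  have hstep : ∀ (n : ℕ) (S : Set (ℕ → ℕ)), ∃ k, a < netContent t (f '' S) →
      a < netContent t (f '' (S ∩ {α | α n ≤ k})) := by
    intro n S
    by_cases h : a < netContent t (f '' S)
    · by_contra! hcon
      refine absurd h (not_lt.2 ?_)
      have hU : f '' S = ⋃ k, f '' (S ∩ {α | α n ≤ k}) := by
        rw [← image_iUnion, ← inter_iUnion]
        congr 1
        refine (inter_eq_left.2 fun α _ => mem_iUnion.2 ⟨α n, le_refl (α n)⟩).symm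
      rw [hU]
      refine netContent_iUnion_le (fun k l hkl => image_mono fun α hα => ?_) fun k => (hcon k).2
      exact ⟨hα.1, le_trans (show α n ≤ k from hα.2) hkl⟩
    · exact ⟨0, fun h' => absurd h' h⟩
  choose k hk using hstep
  set S : ℕ → Set (ℕ → ℕ) := fun n =>
    Nat.rec univ (fun n S => S ∩ {α | α n ≤ k n S}) n with hS
  have hSsucc : ∀ n, S (n + 1) = S n ∩ {α | α n ≤ k n (S n)} := fun n => rfl
  set b : ℕ → ℕ := fun n => k n (S n) with hb
  have hSmem : ∀ n α, α ∈ S n ↔ ∀ i < n, α i ≤ b i := by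
    intro n α
    induction n with
    | zero => simp [hS]
    | succ n ih =>
      rw [hSsucc, mem_inter_iff, ih, Nat.forall_lt_succ_right]
      rfl
  have hSa : ∀ n, a < netContent t (f '' S n) := by
    intro n
    induction n with
    | zero => simpa [hS] using ha
    | succ n ih => exact hk n (S n) ih
  set L : Set (ℕ → ℕ) := univ.pi fun i => Iic (b i) with hL
  have hLc : IsCompact L := isCompact_univ_pi fun i => (finite_Iic (b i)).isCompact
  refine ⟨f '' L, fun n => f '' S n, hLc.image hf, image_subset_range _ _,
    fun n => ⟨image_subset_range _ _, hSa n⟩, fun U hU hLU => ?_⟩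
  have hanti : ∀ m n, m ≤ n → S n ⊆ S m := fun m n hmn α hα =>
    (hSmem m α).2 fun i hi => (hSmem n α).1 hα i (hi.trans_le hmn)
  suffices h : ∃ n, f '' S n ⊆ U by
    obtain ⟨n, hn⟩ := h
    filter_upwards [eventually_ge_atTop n] with m hm
    exact (image_mono (hanti n m hm)).trans hn
  by_contra! hcon
  have hex : ∀ n, ∃ α ∈ S n, f α ∉ U := by
    intro n
    obtain ⟨y, ⟨α, hα, rfl⟩, hy⟩ := not_subset.1 (hcon n)
    exact ⟨α, hα, hy⟩
  choose α hα hαU using hex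
  have hβL : ∀ n, (fun i => min (α n i) (b i)) ∈ L := fun n i _ =>
    mem_Iic.2 (min_le_right (α n i) (b i))
  obtain ⟨β, hβ, φ, hφ, hlim⟩ := hLc.tendsto_subseq hβL
  have hlim' : Tendsto (fun n => α (φ n)) atTop (nhds β) := by
    rw [tendsto_pi_nhds] at hlim ⊢
    intro i
    refine (hlim i).congr' ?_
    filter_upwards [eventually_gt_atTop i] with n hn
    exact min_eq_left ((hSmem _ _).1 (hα (φ n)) i (hn.trans_le (hφ.id_le n)))
  have hev := ((hf.tendsto β).comp hlim').eventually (hU.mem_nhds (hLU (mem_image_of_mem f hβ)))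
  obtain ⟨n, hn⟩ := hev.exists
  exact hαU (φ n) hn

/-- Probability measures on a compact set have a limit along a subnet. -/
lemma exists_limit_measure {B : Set Plane} (hB : IsCompact B) (P : ℕ → Measure Plane)
    (hP : ∀ n, IsProbabilityMeasure (P n)) (hPB : ∀ n, P n Bᶜ = 0) :
    ∃ μ : Measure Plane, IsProbabilityMeasure μ ∧
      ∀ G, IsOpen G → ∀ c, (∀ᶠ n in atTop, P n G ≤ c) → μ G ≤ c := by
  set Q : ℕ → ProbabilityMeasure Plane := fun n => ⟨P n, hP n⟩ with hQ
  have htight : IsTightMeasureSet {((μ : ProbabilityMeasure Plane) : Measure Plane) | μ ∈ range Q} := by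
    rw [isTightMeasureSet_iff_exists_isCompact_measure_compl_le]
    rintro ε -
    refine ⟨B, hB, ?_⟩
    rintro _ ⟨_, ⟨n, rfl⟩, rfl⟩
    exact (hPB n).trans_le bot_le
  have hcomp := isCompact_closure_of_isTightMeasureSet htight
  set F : Ultrafilter ℕ := hyperfilter ℕ with hF
  have hFat : (F : Filter ℕ) ≤ atTop := by
    rw [← Nat.cofinite_eq_atTop]
    exact hyperfilter_le_cofinite
  obtain ⟨μ, -, hμ⟩ := hcomp.ultrafilter_le_nhds (F.map Q) (by
    rw [le_principal_iff]
    exact mem_of_superset (mem_map.2 (univ_mem' fun n => mem_range_self n)) subset_closure)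
  refine ⟨μ, μ.2, fun G hG c hc => ?_⟩
  have h1 : Tendsto Q (F : Filter ℕ) (nhds μ) := hμ
  refine (ProbabilityMeasure.le_liminf_measure_open_of_tendsto h1 hG).trans ?_
  refine liminf_le_of_frequently_le' ?_
  exact (show ∀ᶠ n in (F : Filter ℕ), P n G ≤ c from hFat hc).frequently

/-- A set of large content carries discrete probability measures subject to growth bounds. -/
lemma exists_measure_of_netContent {t a : ℝ} (ha : 0 < a) {E : Set Plane} {q : ℤ × ℤ}
    (hE : ∀ p ∈ E, p.cell 0 = q) (haE : ENNReal.ofReal a < netContent t E) (N : ℕ) :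
    ∃ P : Measure Plane, IsProbabilityMeasure P ∧ P Eᶜ = 0 ∧ ∀ (p : Plane) (j : ℕ), j ≤ N →
      P (Metric.ball p (2 ^ (-(j : ℝ)))) ≤ ENNReal.ofReal (25 / a * 2 ^ (-(j * t))) := by
  classical
  obtain ⟨ι, _, w, x, hxE, hF, hW⟩ := exists_isFrostman (t := t) hE N
  set W := ∑ i, w i with hWdef
  have haW : a < W := (ENNReal.ofReal_lt_ofReal_iff_of_nonneg ha.le).1 (haE.trans_le hW)
  have hW0 : 0 < W := ha.trans haW
  set P : Measure Plane := ∑ i, ENNReal.ofReal (w i / W) • Measure.dirac (x i) with hP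
  have hPS : ∀ S : Set Plane, P S = ENNReal.ofReal (∑ i with x i ∈ S, w i / W) := by
    intro S
    rw [hP, Measure.finsetSum_apply, ENNReal.ofReal_sum_of_nonneg fun i _ =>
      div_nonneg (hF.nonneg i) hW0.le, Finset.sum_filter]
    refine Finset.sum_congr rfl fun i _ => ?_
    rw [Measure.smul_apply, Measure.dirac_apply, smul_eq_mul, indicator_apply]
    split_ifs <;> simp
  refine ⟨P, ⟨?_⟩, ?_, fun p j hj => ?_⟩
  · rw [hPS]
    simp only [mem_univ, Finset.filter_true]
    rw [← Finset.sum_div, div_self hW0.ne', ENNReal.ofReal_one]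
  · rw [hPS]
    simp [hxE]
  · rw [hPS, ← Finset.sum_div]
    refine ENNReal.ofReal_le_ofReal ?_
    have h1 : ∑ i with x i ∈ Metric.ball p (2 ^ (-(j : ℝ))), w i ≤ 25 * 2 ^ (-(j * t)) := by
      refine le_trans ?_ (hF.ball_le p j hj)
      refine le_trans (Finset.sum_le_sum_of_subset_of_nonneg (fun i hi => ?_)
        fun i _ _ => hF.nonneg i) (le_of_eq (by congr!))
      · have := Metric.mem_ball'.1 (Finset.mem_filter.1 hi).2
        exact Finset.mem_filter.2 ⟨Finset.mem_univ i, this.le⟩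
    calc _ ≤ (25 * 2 ^ (-(j * t))) / a :=
          div_le_div₀ (by positivity) h1 ha haW.le
      _ = _ := by ring

/-- Frostman's lemma for Borel sets in the plane. -/
theorem exists_frostman_measure {t : ℝ} {A : Set Plane} (hA : MeasurableSet A) {q : ℤ × ℤ}
    (hAq : ∀ p ∈ A, p.cell 0 = q) (h : netContent t A ≠ 0) :
    ∃ (μ : Measure Plane) (C : ℝ), IsProbabilityMeasure μ ∧ μ Aᶜ = 0 ∧ 0 ≤ C ∧
      ∀ (p : Plane) (j : ℕ),
        μ (Metric.ball p (2 ^ (-(j : ℝ)))) ≤ ENNReal.ofReal (C * 2 ^ (-(j * t))) := by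
  have han := hA.analyticSet
  rw [AnalyticSet] at han
  rcases han with rfl | ⟨f, hf, rfl⟩
  · refine absurd (le_antisymm ((netContent_le_netCost (C := ∅) (empty_subset _)).trans ?_) bot_le) h
    simp [netCost]
  obtain ⟨a', ha'0, ha'⟩ := exists_between (pos_iff_ne_zero.2 h)
  have ha'top : a' ≠ ⊤ := ha'.ne_top
  set a := a'.toReal with ha_def
  have ha : 0 < a := ENNReal.toReal_pos ha'0.ne' ha'top
  rw [← ENNReal.ofReal_toReal ha'top] at ha'
  obtain ⟨K, E, hK, hKA, hE, hEU⟩ := exists_compact_of_netContent hf ha'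
  have hP : ∀ n, ∃ P : Measure Plane, IsProbabilityMeasure P ∧ P (E n)ᶜ = 0 ∧
      ∀ (p : Plane) (j : ℕ), j ≤ n →
      P (Metric.ball p (2 ^ (-(j : ℝ)))) ≤ ENNReal.ofReal (25 / a * 2 ^ (-(j * t))) := fun n =>
    exists_measure_of_netContent ha (fun p hp => hAq p ((hE n).1 hp)) (hE n).2 n
  choose P hP1 hPE hPball using hP
  set p₀ := f 0 with hp₀
  have hB : range f ⊆ Metric.closedBall p₀ 2 := by
    intro y hy
    have := Plane.dist_le_of_cell_eq ((hAq y hy).trans (hAq p₀ (mem_range_self _)).symm)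
    simpa using this
  obtain ⟨μ, hμ1, hμ⟩ := exists_limit_measure (isCompact_closedBall p₀ 2) P hP1 fun n =>
    measure_mono_null (compl_subset_compl.2 ((hE n).1.trans hB)) (hPE n)
  refine ⟨μ, 25 / a, hμ1, ?_, by positivity, fun p j => hμ _ Metric.isOpen_ball _ ?_⟩
  · refine measure_mono_null (compl_subset_compl.2 hKA) ?_
    refine measure_null_of_locally_null _ fun y hy => ?_
    obtain ⟨r, hr, hrK⟩ := Metric.nhds_basis_closedBall.mem_iff.1
      (hK.isClosed.isOpen_compl.mem_nhds hy)
    refine ⟨Metric.ball y r, mem_nhdsWithin_of_mem_nhds (Metric.ball_mem_nhds y hr), ?_⟩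
    refine le_antisymm (hμ _ Metric.isOpen_ball 0 ?_) bot_le
    filter_upwards [hEU _ Metric.isClosed_closedBall.isOpen_compl
      (subset_compl_comm.1 hrK)] with n hn
    refine (measure_mono_null (fun z hz => ?_) (hPE n)).le
    exact fun hzE => hn hzE (Metric.ball_subset_closedBall hz)
  · filter_upwards [eventually_ge_atTop j] with n hn
    exact hPball n p j hn

lemma Plane.measurable_cell (n : ℕ) : Measurable fun p : Plane => p.cell n := by
  have h : ∀ i : Fin 2, Measurable fun p : Plane => ⌊(2 : ℝ) ^ n * p i⌋ := fun i =>
    Int.measurable_floor.comp (by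
      have : Continuous fun p : Plane => (2 : ℝ) ^ n * p i := by fun_prop
      exact this.measurable)
  exact (h 0).prodMk (h 1)

lemma IsFrostman.mono {ι : Type*} [Fintype ι] {w : ι → ℝ} {x : ι → Plane} {C C' t : ℝ} {N N' : ℕ}
    (h : IsFrostman w x C t N) (hC : C ≤ C') (hN : N' ≤ N) : IsFrostman w x C' t N' :=
  ⟨h.nonneg, h.sum_le, fun p j hj => (h.ball_le p j (hj.trans hN)).trans
    (mul_le_mul_of_nonneg_right hC (by positivity))⟩

/-- A measure subject to a Frostman condition can be discretised at any given scale. -/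
lemma exists_isFrostman_of_measure {μ : Measure Plane} [IsProbabilityMeasure μ] {C t : ℝ}
    (hC : 0 ≤ C) (ht : 0 ≤ t)
    (hμ : ∀ (p : Plane) (j : ℕ),
      μ (Metric.ball p (2 ^ (-(j : ℝ)))) ≤ ENNReal.ofReal (C * 2 ^ (-(j * t))))
    {A : Set Plane} {q : ℤ × ℤ} (hAq : ∀ p ∈ A, p.cell 0 = q) (N : ℕ) :
    ∃ (ι : Type) (_ : Fintype ι) (w : ι → ℝ) (x : ι → Plane), (∀ i, x i ∈ A) ∧
      IsFrostman w x ((C + 1) * 2 ^ (2 * t)) t N ∧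
      ∀ S ⊆ A, ∃ I : Finset ι, μ.real S ≤ ∑ i ∈ I, w i ∧
        ∀ i ∈ I, ∃ p ∈ S, p.cell N = (x i).cell N := by
  classical
  set ι : Type := {c : ℤ × ℤ // ∃ p ∈ A, p.cell N = c} with hι
  have hfin : Finite ι := Finite.to_subtype ((Plane.finite_cells N q).subset
    fun c ⟨p, hp, hpc⟩ => ⟨p, hAq p hp, hpc⟩)
  have := Fintype.ofFinite ι
  choose x hxA hxc using fun i : ι => i.2
  set Q : ι → Set Plane := fun i => {p | p.cell N = i.1} with hQ
  have hsum : ∀ I : Finset ι, ∑ i ∈ I, μ.real (Q i) = μ.real (⋃ i ∈ I, Q i) := by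
    intro I
    have hmeas : ∀ i : ι, MeasurableSet (Q i) := fun i =>
      Plane.measurable_cell N (measurableSet_singleton i.1)
    refine (measureReal_biUnion_finset ?_ (fun i _ => hmeas i)
      fun i _ => measure_ne_top μ (Q i)).symm
    intro i _ j _ hij
    refine disjoint_left.2 fun p hp hp' => hij (Subtype.ext ?_)
    exact (show p.cell N = i.1 from hp).symm.trans hp'
  refine ⟨ι, this, fun i => μ.real (Q i), x, hxA, ⟨fun i => measureReal_nonneg, ?_, ?_⟩, ?_⟩
  · rw [hsum]
    exact measureReal_le_one
  · intro p j hj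
    rw [hsum]
    rcases lt_or_ge j 2 with h2 | h2
    · refine (measureReal_le_one (μ := μ)).trans ?_
      rw [mul_assoc, ← Real.rpow_add (by norm_num)]
      have h3 : (1 : ℝ) ≤ 2 ^ (2 * t + -(j * t)) := by
        refine Real.one_le_rpow (by norm_num) ?_
        have : (j : ℝ) ≤ 2 := by exact_mod_cast h2.le
        nlinarith
      nlinarith
    · have hsub : (⋃ i ∈ Finset.univ.filter fun i => dist p (x i) ≤ 2 ^ (-(j : ℝ)), Q i) ⊆
          Metric.ball p (2 ^ (-((j - 2 : ℕ) : ℝ))) := by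
        intro y hy
        obtain ⟨i, hi, hyi⟩ := mem_iUnion₂.1 hy
        have h3 := (Finset.mem_filter.1 hi).2
        have h4 : dist (x i) y ≤ 2 * 2 ^ (-(N : ℝ)) :=
          Plane.dist_le_of_cell_eq ((hxc i).trans (show y.cell N = i.1 from hyi).symm)
        have h5 : (2 : ℝ) ^ (-(N : ℝ)) ≤ 2 ^ (-(j : ℝ)) :=
          Real.rpow_le_rpow_of_exponent_le (by norm_num) (neg_le_neg (by exact_mod_cast hj))
        have h6 : (2 : ℝ) ^ (-((j - 2 : ℕ) : ℝ)) = 4 * 2 ^ (-(j : ℝ)) := by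
          rw [Nat.cast_sub h2, neg_sub, sub_eq_add_neg, Real.rpow_add (by norm_num)]
          norm_num
        have h7 : (0 : ℝ) < 2 ^ (-(j : ℝ)) := by positivity
        rw [Metric.mem_ball', h6]
        have := dist_triangle p (x i) y
        linarith
      refine (measureReal_mono hsub).trans ((ENNReal.toReal_le_of_le_ofReal (by positivity)
        (hμ p (j - 2))).trans ?_)
      rw [Nat.cast_sub h2, mul_assoc, ← Real.rpow_add (by norm_num)]
      refine mul_le_mul (by linarith) (le_of_eq ?_) (by positivity) (by positivity)
      congr 1
      push_cast
      ring
  · intro S hS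
    refine ⟨Finset.univ.filter fun i => ∃ p ∈ S, p.cell N = (x i).cell N, ?_,
      fun i hi => (Finset.mem_filter.1 hi).2⟩
    rw [hsum]
    refine measureReal_mono (fun p hp => ?_) (measure_ne_top μ _)
    set i : ι := ⟨p.cell N, p, hS hp, rfl⟩ with hi
    exact mem_iUnion₂.2 ⟨i, Finset.mem_filter.2 ⟨Finset.mem_univ i, p, hp, (hxc i).symm⟩, rfl⟩

/-- Points near a set with small covering number occupy few dyadic intervals. -/
lemma card_image_floor_le {ι : Type*} {F : Set ℝ} {n : ℕ} {K : ℝ}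
    (hF : coverNum F (1 / 2 ^ n) < ENNReal.ofReal K) (I : Finset ι) (d : ι → ℝ)
    (hd : ∀ i ∈ I, ∃ u ∈ F, |d i - u| ≤ 2 * 2 ^ (-(n : ℝ))) :
    ((I.image fun i => ⌊(2 : ℝ) ^ (n : ℝ) * d i⌋).card : ℝ) ≤ 7 * K := by
  classical
  simp only [coverNum, iInf_lt_iff, exists_prop] at hF
  obtain ⟨V, hFV, hV⟩ := hF
  have hVK : (V.card : ℝ) ≤ K := by
    rw [← ENNReal.ofReal_natCast, ENNReal.ofReal_lt_ofReal_iff_of_nonneg (by positivity)] at hV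
    exact hV.le
  have hsub : (I.image fun i => ⌊(2 : ℝ) ^ (n : ℝ) * d i⌋) ⊆
      V.biUnion fun v => Finset.Icc (⌊(2 : ℝ) ^ (n : ℝ) * v⌋ - 3) (⌊(2 : ℝ) ^ (n : ℝ) * v⌋ + 3) := by
    intro z hz
    obtain ⟨i, hi, rfl⟩ := Finset.mem_image.1 hz
    obtain ⟨u, hu, hdu⟩ := hd i hi
    obtain ⟨v, hv, huv⟩ := mem_iUnion₂.1 (hFV hu)
    refine Finset.mem_biUnion.2 ⟨v, hv, ?_⟩
    rw [Metric.mem_ball, Real.dist_eq] at huv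
    have h1 := two_rpow_neg_mul_pow n
    rw [Real.rpow_natCast]
    have hpos : (0 : ℝ) < 2 ^ n := by positivity
    have h2 : (1 : ℝ) / 2 ^ n * 2 ^ n = 1 := by field_simp
    obtain ⟨a1, a2⟩ := abs_lt.1 huv
    obtain ⟨b1, b2⟩ := abs_le.1 hdu
    have c1 : (2 : ℝ) ^ n * d i < 2 ^ n * v + 3 := by nlinarith
    have c2 : (2 : ℝ) ^ n * v - 3 < 2 ^ n * d i := by nlinarith
    have e1 := Int.floor_le ((2 : ℝ) ^ n * v)
    have e2 := Int.lt_floor_add_one ((2 : ℝ) ^ n * v)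
    rw [Finset.mem_Icc]
    constructor
    · rw [Int.le_floor]
      push_cast
      linarith
    · rw [Int.floor_le_iff]
      push_cast
      linarith
  have hcard := (Finset.card_le_card hsub).trans (Finset.card_biUnion_le_card_mul V _ 7 fun v _ => by
    rw [Int.card_Icc]
    omega)
  have : ((I.image fun i => ⌊(2 : ℝ) ^ (n : ℝ) * d i⌋).card : ℝ) ≤ V.card * 7 := by
    exact_mod_cast hcard
  linarith

/-- The pins seeing a non-negligible part of the set in few distances have zero content. -/
theorem netContent_pins_eq_zero {s t lam η ψ C : ℝ} (hs : 1 < s) (ht : 1 < t) (hlam : 0 < lam)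
    (hlc : (1 / 2 - (s - 1) - 2 * lam) ^ 2 < 2 * (1 + (s - 1)) * lam) (hη : 0 < η)
    (hψ : ψ < 1 - lam - η) (hC : 0 ≤ C) {μ : Measure Plane} [IsProbabilityMeasure μ]
    (hμ : ∀ (p : Plane) (j : ℕ),
      μ (Metric.ball p (2 ^ (-(j : ℝ)))) ≤ ENNReal.ofReal (C * 2 ^ (-(j * s))))
    {A : Set Plane} {q : ℤ × ℤ} (hAq : ∀ p ∈ A, p.cell 0 = q) (m : ℕ) (r : ℤ × ℤ) :
    netContent t {y : Plane | y.cell 0 = r ∧ ∃ F : Set ℝ,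
      1 / ((m : ℝ) + 1) ≤ μ.real {x | x ∈ A ∧ dist x y ∈ F ∧ 1 / ((m : ℝ) + 1) ≤ dist x y} ∧
      ∀ n ≥ m, coverNum F (1 / 2 ^ n) < ENNReal.ofReal (2 ^ (ψ * n))} = 0 := by
  classical
  set Y : Set Plane := {y : Plane | y.cell 0 = r ∧ ∃ F : Set ℝ,
      1 / ((m : ℝ) + 1) ≤ μ.real {x | x ∈ A ∧ dist x y ∈ F ∧ 1 / ((m : ℝ) + 1) ≤ dist x y} ∧
      ∀ n ≥ m, coverNum F (1 / 2 ^ n) < ENNReal.ofReal (2 ^ (ψ * n))} with hY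
  by_contra hne
  obtain ⟨a', ha'0, ha'⟩ := exists_between (pos_iff_ne_zero.2 hne)
  set a := a'.toReal with ha_def
  have ha : 0 < a := ENNReal.toReal_pos ha'0.ne' ha'.ne_top
  rw [← ENNReal.ofReal_toReal ha'.ne_top] at ha'
  set δ : ℝ := 1 / ((m : ℝ) + 1) with hδdef
  have hδ : 0 < δ := by positivity
  set c := min a (δ / 2) with hc_def
  have hc : 0 < c := lt_min ha (by positivity)
  obtain ⟨R, hR⟩ : ∃ R : ℝ, ∀ x ∈ A, ∀ y ∈ Y, dist x y ≤ R := by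
    rcases A.eq_empty_or_nonempty with rfl | ⟨x₀, hx₀⟩
    · exact ⟨0, by simp⟩
    rcases Y.eq_empty_or_nonempty with hYe | ⟨y₀, hy₀⟩
    · exact ⟨0, by simp [hYe]⟩
    refine ⟨2 + dist x₀ y₀ + 2, fun x hx y hy => ?_⟩
    have h1 := Plane.dist_le_of_cell_eq ((hAq x hx).trans (hAq x₀ hx₀).symm)
    have h2 := Plane.dist_le_of_cell_eq (hy₀.1.trans hy.1.symm)
    simp only [Nat.cast_zero, neg_zero, Real.rpow_zero, mul_one] at h1 h2
    linarith [dist_triangle4 x x₀ y₀ y]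
  set C₁ := max ((C + 1) * 2 ^ (2 * s)) 25 with hC₁
  obtain ⟨B₁, hB₁⟩ := exists_nat_ge (3 / (1 - lam - η - ψ))
  obtain ⟨B₂, hB₂⟩ : ∃ B : ℕ, 2 * (2 : ℝ) ^ (-(B : ℝ)) ≤ δ / 2 := by
    obtain ⟨B, hB⟩ := exists_pow_lt_of_lt_one (by positivity : 0 < δ / 4)
      (by norm_num : (1 / 2 : ℝ) < 1)
    refine ⟨B, ?_⟩
    rw [Real.rpow_neg (by norm_num), Real.rpow_natCast, ← inv_pow, ← one_div]
    linarith
  set B := max m (max B₁ B₂) with hB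
  obtain ⟨N, hN⟩ := exists_card_image_ge (R := R) hs ht hlam hlc hη
    (le_max_of_le_right (by norm_num) : 0 ≤ C₁) hc {q} B
  obtain ⟨ι, _, w, x, hxA, hw, hI⟩ :=
    exists_isFrostman_of_measure hC (by linarith) hμ hAq (max N B)
  obtain ⟨κ, _, ν, y, hyY, hν, hνsum⟩ := exists_isFrostman (t := t) (E := Y) (fun p hp => hp.1) N
  choose F hFμ hFcov using fun k => (hyY k).2
  choose I hIμ hIp using fun k => hI
    {x | x ∈ A ∧ dist x (y k) ∈ F k ∧ 1 / ((m : ℝ) + 1) ≤ dist x (y k)} fun x hx => hx.1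
  have hclose : ∀ k, ∀ i ∈ I k, ∃ p ∈ A, dist p (y k) ∈ F k ∧ δ ≤ dist p (y k) ∧
      |dist (x i) (y k) - dist p (y k)| ≤ 2 * 2 ^ (-((max N B : ℕ) : ℝ)) := by
    intro k i hi
    obtain ⟨p, ⟨hpA, hpF, hpδ⟩, hpc⟩ := hIp k i hi
    exact ⟨p, hpA, hpF, hpδ, (abs_dist_sub_le (x i) p (y k)).trans
      (Plane.dist_le_of_cell_eq hpc.symm)⟩
  have hmono : ∀ n₁ n₂ : ℕ, n₁ ≤ n₂ → (2 : ℝ) ^ (-(n₂ : ℝ)) ≤ 2 ^ (-(n₁ : ℝ)) := fun n₁ n₂ h =>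
    Real.rpow_le_rpow_of_exponent_le (by norm_num) (neg_le_neg (by exact_mod_cast h))
  obtain ⟨k, n, hBn, hnN, hcard⟩ := hN ι κ w x ν y I
    (hw.mono (le_max_left _ _) (le_max_left _ _)) (hν.mono (le_max_right _ _) le_rfl)
    (fun i k => hR _ (hxA i) _ (hyY k)) (fun i => Finset.mem_singleton.2 (hAq _ (hxA i)))
    ((min_le_left _ _).trans ((ENNReal.ofReal_lt_ofReal_iff_of_nonneg ha.le).1
      (ha'.trans_le hνsum)).le)
    (fun k => (min_le_right _ _).trans ((by linarith : δ / 2 ≤ δ).trans ((hFμ k).trans (hIμ k))))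
    (fun k i hi => by
      obtain ⟨p, -, -, hpδ, hp⟩ := hclose k i hi
      have h1 := hmono B₂ (max N B)
        ((le_max_right _ _).trans ((le_max_right _ _).trans (le_max_right _ _)))
      have h2 := (abs_le.1 hp).1
      exact (min_le_right _ _).trans (by linarith))
  have hle := card_image_floor_le (hFcov k n (le_trans (le_max_left _ _) hBn)) (I k)
    (fun i => dist (x i) (y k)) (fun i hi => by
      obtain ⟨p, -, hpF, -, hp⟩ := hclose k i hi
      refine ⟨_, hpF, hp.trans ?_⟩
      have := hmono n (max N B) (hnN.trans (le_max_left _ _))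
      linarith)
  have hgap : (8 : ℝ) * 2 ^ (ψ * n) ≤ 2 ^ (n * (1 - lam - η)) := by
    have h8 : (8 : ℝ) = 2 ^ (3 : ℝ) := by norm_num
    rw [h8, ← Real.rpow_add (by norm_num)]
    refine Real.rpow_le_rpow_of_exponent_le (by norm_num) ?_
    have hn : 3 / (1 - lam - η - ψ) ≤ n := hB₁.trans (by
      exact_mod_cast ((le_max_left _ _).trans (le_max_right _ _)).trans hBn)
    rw [div_le_iff₀ (by linarith)] at hn
    linarith
  have hpos : (0 : ℝ) < 2 ^ (ψ * n) := by positivity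
  have hcard' := hcard.trans (le_trans (le_of_eq (by congr!)) hle)
  linarith

/-- Choice of exponents slightly worse than the ones in the dimension bound. -/
lemma exists_exponents {s ψ : ℝ} (hs1 : 1 < s) (hs2 : s < 3 / 2)
    (hψ : ψ < (1 + s + Real.sqrt (3 * s * (2 - s))) / 4) :
    ∃ u lam η : ℝ, 1 < u ∧ u < s ∧ 0 < lam ∧ 0 < η ∧ ψ < 1 - lam - η ∧
      (1 / 2 - (u - 1) - 2 * lam) ^ 2 < 2 * (1 + (u - 1)) * lam := by
  set d := Real.sqrt (3 * s * (2 - s)) with hd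
  have hdpos : 0 < d := Real.sqrt_pos.2 (by nlinarith)
  have hdsq : d ^ 2 = 3 * s * (2 - s) := Real.sq_sqrt (by nlinarith)
  have hd3 : d < 3 - s := by
    refine lt_of_pow_lt_pow_left₀ 2 (by linarith) ?_
    rw [hdsq]
    nlinarith
  obtain ⟨lam, h1, h2⟩ := exists_between
    (lt_min (by linarith : (3 - s - d) / 4 < 1 - ψ) (by linarith : (3 - s - d) / 4 < (3 - s + d) / 4))
  obtain ⟨h3, h4⟩ := lt_min_iff.1 h2
  have hlam : 0 < lam := by linarith
  have hP : (1 / 2 - (s - 1) - 2 * lam) ^ 2 < 2 * (1 + (s - 1)) * lam := by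
    nlinarith [mul_pos (sub_pos.2 h1) (sub_pos.2 h4)]
  have hev : ∀ᶠ u in nhdsWithin s (Iio s),
      (1 / 2 - (u - 1) - 2 * lam) ^ 2 < 2 * (1 + (u - 1)) * lam := by
    refine Filter.Eventually.filter_mono nhdsWithin_le_nhds ?_
    exact ContinuousAt.eventually_lt (by fun_prop) (by fun_prop) hP
  obtain ⟨u, hu, hu'⟩ := (hev.and (Ioo_mem_nhdsLT hs1)).exists
  exact ⟨u, lam, (1 - ψ - lam) / 2, hu'.1, hu'.2, hlam, by linarith, by linarith, hu⟩

lemma exists_coverNum_lt_of_ubDim_lt {F : Set ℝ} {ψ : ℝ} (h : ubDim F < ENNReal.ofReal ψ) :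
    ∃ k : ℕ, ∀ n ≥ k, coverNum F (1 / 2 ^ n) < ENNReal.ofReal (2 ^ (ψ * n)) := by
  rw [ubDim] at h
  split_ifs at h with htop
  · exact absurd h not_top_lt
  push Not at htop
  obtain ⟨k, hk⟩ := eventually_atTop.1 (eventually_lt_of_limsup_lt h)
  refine ⟨max k 1, fun n hn => ?_⟩
  have hn1 : (0 : ℝ) < n := by exact_mod_cast (le_of_max_le_right hn : 1 ≤ n)
  have h1 := (ENNReal.ofReal_lt_ofReal_iff'.1 (hk n (le_of_max_le_left hn))).1
  rw [div_lt_iff₀ hn1] at h1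
  rw [← ENNReal.ofReal_toReal (htop n), ENNReal.ofReal_lt_ofReal_iff (by positivity)]
  rcases (ENNReal.toReal_nonneg (a := coverNum F (1 / 2 ^ n))).eq_or_lt with h0 | h0
  · rw [← h0]
    positivity
  · exact (Real.logb_lt_iff_lt_rpow (by norm_num) h0).1 h1

lemma measure_singleton_eq_zero_of_frostman {μ : Measure Plane} {C s : ℝ} (hs : 0 < s)
    (hμ : ∀ (p : Plane) (j : ℕ),
      μ (Metric.ball p (2 ^ (-(j : ℝ)))) ≤ ENNReal.ofReal (C * 2 ^ (-(j * s)))) (p : Plane) :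
    μ {p} = 0 := by
  have h1 : Tendsto (fun n : ℕ => C * ((2 : ℝ) ^ (-s)) ^ n) atTop (nhds 0) := by
    simpa using (tendsto_pow_atTop_nhds_zero_of_lt_one (by positivity)
      (Real.rpow_lt_one_of_one_lt_of_neg one_lt_two (by linarith : -s < 0))).const_mul C
  have h2 := ENNReal.tendsto_ofReal h1
  rw [ENNReal.ofReal_zero] at h2
  refine le_antisymm (ge_of_tendsto' h2 fun n => ?_) bot_le
  refine (measure_mono (singleton_subset_iff.2 (Metric.mem_ball_self (by positivity)))).trans
    ((hμ p n).trans (le_of_eq ?_))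
  rw [← Real.rpow_natCast, ← Real.rpow_mul (by norm_num)]
  congr 3
  ring

/-- Some unit cell meets a set in a subset of positive content. -/
lemma exists_netContent_ne_zero {A : Set Plane} {u : ℝ} (hu : 0 < u)
    (hA : ENNReal.ofReal u < dimH A) :
    ∃ q : ℤ × ℤ, netContent u (A ∩ {p | p.cell 0 = q}) ≠ 0 := by
  by_contra! hcon
  refine absurd hA (not_lt.2 ?_)
  have hU : A = ⋃ q : ℤ × ℤ, A ∩ {p | p.cell 0 = q} := by
    ext p
    simp
  rw [hU, dimH_iUnion]
  refine iSup_le fun q => ?_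
  refine dimH_le_of_hausdorffMeasure_ne_top (d := u.toNNReal) ?_
  rw [Real.coe_toNNReal u hu.le, hausdorffMeasure_eq_zero_of_netContent hu (hcon q)]
  exact ENNReal.zero_ne_top

lemma dimH_le_one_of_netContent {E : Set Plane} (h : ∀ t : ℝ, 1 < t → netContent t E = 0) :
    dimH E ≤ 1 := by
  refine le_of_forall_gt_imp_ge_of_dense fun b hb => ?_
  obtain ⟨t, ht1, htb⟩ := ENNReal.lt_iff_exists_nnreal_btwn.1 hb
  have ht : (1 : ℝ) < t := by exact_mod_cast ht1
  refine le_trans ?_ htb.le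
  refine dimH_le_of_hausdorffMeasure_ne_top (d := t) ?_
  rw [hausdorffMeasure_eq_zero_of_netContent (by linarith) (h t ht)]
  exact ENNReal.zero_ne_top

/-- The pins whose distance set is covered by sets of upper box dimension less than a fixed number
below the threshold. -/
lemma dimH_pins_le_one {A : Set Plane} (hA : MeasurableSet A) {s : ℝ}
    (hs1 : 1 < s) (hs2 : s < 3 / 2) (hdim : dimH A = ENNReal.ofReal s) {ψ : ℝ}
    (hψ : ψ < (1 + s + Real.sqrt (3 * s * (2 - s))) / 4) :
    dimH {y : Plane | ∃ F : ℕ → Set ℝ, (fun x => dist x y) '' A ⊆ ⋃ n, F n ∧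
      ∀ n, ubDim (F n) < ENNReal.ofReal ψ} ≤ 1 := by
  obtain ⟨u, lam, η, hu1, hus, hlam, hη, hψ', hlc⟩ := exists_exponents hs1 hs2 hψ
  obtain ⟨q, hq⟩ := exists_netContent_ne_zero (by linarith : 0 < u) (A := A) (by
    rw [hdim]
    exact (ENNReal.ofReal_lt_ofReal_iff (by linarith)).2 hus)
  set A' := A ∩ {p | p.cell 0 = q} with hA'
  have hA'q : ∀ p ∈ A', p.cell 0 = q := fun p hp => hp.2
  obtain ⟨μ, C, hμ1, hμA, hC, hμ⟩ := exists_frostman_measure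
    (hA.inter (Plane.measurable_cell 0 (measurableSet_singleton q))) hA'q hq
  set Y : ℕ → ℤ × ℤ → Set Plane := fun m r => {y : Plane | y.cell 0 = r ∧ ∃ F : Set ℝ,
      1 / ((m : ℝ) + 1) ≤ μ.real {x | x ∈ A' ∧ dist x y ∈ F ∧ 1 / ((m : ℝ) + 1) ≤ dist x y} ∧
      ∀ n ≥ m, coverNum F (1 / 2 ^ n) < ENNReal.ofReal (2 ^ (ψ * n))} with hY
  have hYdim : ∀ m r, dimH (Y m r) ≤ 1 := fun m r => dimH_le_one_of_netContent fun t ht =>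
    netContent_pins_eq_zero hu1 ht hlam hlc hη hψ' hC hμ hA'q m r
  have hanti : ∀ m k : ℕ, m ≤ k → 1 / ((k : ℝ) + 1) ≤ 1 / ((m : ℝ) + 1) := fun m k h => by
    have : (m : ℝ) ≤ k := by exact_mod_cast h
    gcongr
  have hcover : {y : Plane | ∃ F : ℕ → Set ℝ, (fun x => dist x y) '' A ⊆ ⋃ n, F n ∧
      ∀ n, ubDim (F n) < ENNReal.ofReal ψ} ⊆ ⋃ m, ⋃ r, Y m r := by
    rintro y ⟨F, hAF, hF⟩
    set Z : ℕ → ℕ → Set Plane := fun n m =>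
      {x | x ∈ A' ∧ dist x y ∈ F n ∧ 1 / ((m : ℝ) + 1) ≤ dist x y} with hZ
    have hex : ∃ n m, μ (Z n m) ≠ 0 := by
      by_contra! hcon
      have h1 : (univ : Set Plane) ⊆ A'ᶜ ∪ ({y} ∪ ⋃ n, ⋃ m, Z n m) := by
        intro x _
        by_cases hx : x ∈ A'
        · right
          rcases eq_or_ne x y with rfl | hxy
          · exact Or.inl rfl
          · right
            obtain ⟨n, hn⟩ := mem_iUnion.1 (hAF (mem_image_of_mem _ hx.1))
            obtain ⟨m, hm⟩ := exists_nat_one_div_lt (dist_pos.2 hxy)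
            exact mem_iUnion.2 ⟨n, mem_iUnion.2 ⟨m, hx, hn, hm.le⟩⟩
        · exact Or.inl hx
      have h2 : μ univ = 0 := measure_mono_null h1 (measure_union_null hμA (measure_union_null
        (measure_singleton_eq_zero_of_frostman (by linarith) hμ y)
        (measure_iUnion_null fun n => measure_iUnion_null fun m => hcon n m)))
      rw [measure_univ] at h2
      exact one_ne_zero h2
    obtain ⟨n, m, hnm⟩ := hex
    have hpos : 0 < μ.real (Z n m) := ENNReal.toReal_pos hnm (measure_ne_top μ _)
    obtain ⟨j, hj⟩ := exists_nat_one_div_lt hpos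
    obtain ⟨k, hk⟩ := exists_coverNum_lt_of_ubDim_lt (hF n)
    refine mem_iUnion.2 ⟨max j (max m k), mem_iUnion.2 ⟨y.cell 0, rfl, F n, ?_, fun l hl =>
      hk l (((le_max_right _ _).trans (le_max_right _ _)).trans hl)⟩⟩
    refine ((hanti _ _ (le_max_left _ _)).trans hj.le).trans (measureReal_mono ?_ ?_)
    · exact fun x hx => ⟨hx.1, hx.2.1,
        (hanti _ _ ((le_max_left m k).trans (le_max_right j _))).trans hx.2.2⟩
    · exact measure_ne_top μ _
  refine (dimH_mono hcover).trans ?_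
  rw [dimH_iUnion]
  refine iSup_le fun m => ?_
  rw [dimH_iUnion]
  exact iSup_le fun r => hYdim m r

/-- **Theorem.** Let `A ⊆ ℝ²` be a Borel set with `dimH A = s ∈ (1, 3/2)`. Then the set of
pins `y` for which the pinned distance set `Δ_y(A)` has packing dimension strictly less than
`(1 + s + √(3s(2-s)))/4` has Hausdorff dimension at most `1`. -/
theorem statement2 (A : Set (EuclideanSpace ℝ (Fin 2))) (hA : MeasurableSet A) (s : ℝ)
    (hs1 : 1 < s) (hs2 : s < 3 / 2) (hdim : dimH A = ENNReal.ofReal s) :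
    dimH {y : EuclideanSpace ℝ (Fin 2) |
        pDim ((fun x => dist x y) '' A) <
          ENNReal.ofReal ((1 + s + Real.sqrt (3 * s * (2 - s))) / 4)} ≤ 1 := by
  set φ := (1 + s + Real.sqrt (3 * s * (2 - s))) / 4 with hφ
  have hcover : {y : Plane | pDim ((fun x => dist x y) '' A) < ENNReal.ofReal φ} ⊆
      ⋃ ψ : {ψ : ℚ // (ψ : ℝ) < φ}, {y : Plane | ∃ F : ℕ → Set ℝ,
        (fun x => dist x y) '' A ⊆ ⋃ n, F n ∧ ∀ n, ubDim (F n) < ENNReal.ofReal (ψ.1 : ℝ)} := by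
    intro y hy
    have hy' : pDim ((fun x => dist x y) '' A) < ENNReal.ofReal φ := hy
    simp only [pDim, iInf_lt_iff, exists_prop] at hy'
    obtain ⟨F, hAF, hF⟩ := hy'
    obtain ⟨ψ, -, h1, h2⟩ := ENNReal.lt_iff_exists_rat_btwn.1 hF
    refine mem_iUnion.2 ⟨⟨ψ, (ENNReal.ofReal_lt_ofReal_iff'.1 h2).1⟩, F, hAF, fun n => ?_⟩
    exact (le_iSup (fun n => ubDim (F n)) n).trans_lt h1
  refine (dimH_mono hcover).trans ?_
  rw [dimH_iUnion]
  exact iSup_le fun ψ => dimH_pins_le_one hA hs1 hs2 hdim ψ.2
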